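/- The set of corrector functions is uniformly Lipschitz continuous: there exists a constant K > 0 such that every corrector χ satisfies |χ(m₁) − χ(m₂)| ≤ K d(m₁, m₂) for all m₁, m₂ ∈ P(𝕋^d). -/

import Mathlib

/- Common framework for "On the long time convergence of potential MFG" (M. Masoero).

We work on the flat torus `𝕋^d`, modeled as `Td d := Fin d → AddCircle 1`.
Smooth functions on the torus are represented by `ℤ^d`-periodic functions on
`Vd d := Fin d → ℝ`; a function on `Vd d` is transported to the torus through the
canonical (measurable) section `secT : Td d → Vd d`.  Probability measures on the
torus are `PTd d := ProbabilityMeasure (Td d)`, endowed with the 1-Wasserstein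
distance `W1` defined through Kantorovich duality.  The Fokker--Planck equations
and their stationary analogues are stated in the sense of distributions, i.e.
against smooth periodic test functions; `σ` is the viscosity parameter
(everywhere `σ = 1` except in the non-convex example). -/

open MeasureTheory Real Set Filter

noncomputable section

abbrev Vd (d : ℕ) : Type := Fin d → ℝ
abbrev Td (d : ℕ) : Type := Fin d → AddCircle (1 : ℝ)

instance factOneposR : Fact ((0:ℝ) < 1) := ⟨one_pos⟩

/-- The canonical measurable section of the torus, with values in `[0,1)^d`. -/
def secT {d : ℕ} (y : Td d) : Vd d := fun i => ((AddCircle.equivIco 1 0) (y i)).1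

/-- The vector of `ℝ^d` associated with an integer vector. -/
def intVec {d : ℕ} (z : Fin d → ℤ) : Vd d := fun i => (z i : ℝ)

/-- Euclidean scalar product on `ℝ^d`. -/
def dotp {d : ℕ} (a b : Vd d) : ℝ := ∑ i, a i * b i

/-- Squared euclidean norm on `ℝ^d`. -/
def sqnorm {d : ℕ} (a : Vd d) : ℝ := ∑ i, (a i)^2

/-- Spatial gradient. -/
def gradv {d : ℕ} (g : Vd d → ℝ) (x : Vd d) : Vd d := fun i => fderiv ℝ g x (Pi.single i 1)

/-- Second derivative of `g` at `x` in the directions `v, w`. -/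
def D2 {d : ℕ} (g : Vd d → ℝ) (x v w : Vd d) : ℝ := fderiv ℝ (fun y => fderiv ℝ g y v) x w

/-- Laplacian. -/
def lapl {d : ℕ} (g : Vd d → ℝ) (x : Vd d) : ℝ := ∑ i, D2 g x (Pi.single i 1) (Pi.single i 1)

/-- Divergence of a vector field. -/
def divv {d : ℕ} (b : Vd d → Vd d) (x : Vd d) : ℝ :=
  ∑ i, fderiv ℝ (fun y => b y i) x (Pi.single i 1)

/-- Time derivative of a time dependent function. -/
def tderiv {d : ℕ} (u : ℝ → Vd d → ℝ) (t : ℝ) (x : Vd d) : ℝ := deriv (fun s => u s x) t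

abbrev PTd (d : ℕ) := ProbabilityMeasure (Td d)

/-- The 1-Wasserstein (Monge--Kantorovich) distance, via Kantorovich duality. -/
def W1 {d : ℕ} (μ ν : PTd d) : ℝ :=
  sSup { r | ∃ φ : Td d → ℝ, LipschitzWith 1 φ ∧
    r = (∫ y, φ y ∂(μ : Measure (Td d))) - ∫ y, φ y ∂(ν : Measure (Td d)) }

/-- The convex combination `(1-t) μ + t ν`. -/
def lineComb {d : ℕ} (t : ℝ) (μ ν : PTd d) : Measure (Td d) :=
  ENNReal.ofReal (1 - t) • (μ : Measure (Td d)) + ENNReal.ofReal t • (ν : Measure (Td d))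

/-- The standing assumptions of the paper: a Hamiltonian `H` (a `ℤ^d`-periodic function of
`(x,p)`), its convex conjugate `Hstar` in the `p` variable, a `C²` coupling function
`Fc` on `P(𝕋^d)` with flat derivative `Fd` (represented by periodic functions on `ℝ^d`),
with the regularity and growth conditions of the paper. -/
structure MFGSetting (d : ℕ) where
  H : Vd d → Vd d → ℝ
  Hstar : Vd d → Vd d → ℝ
  Fc : PTd d → ℝ
  Fd : Measure (Td d) → Vd d → ℝ
  Cbar : ℝ
  Cbar_pos : 0 < Cbar
  θ : ℝ
  θ_mem : θ ∈ Set.Ioo (0:ℝ) 1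
  Cg : ℝ
  Cg_pos : 0 < Cg
  CF : ℝ
  H_smooth : ContDiff ℝ 2 (fun q : Vd d × Vd d => H q.1 q.2)
  H_per : ∀ (x : Vd d) (z : Fin d → ℤ) (p : Vd d), H (x + intVec z) p = H x p
  Dpp_lip : ∃ L : ℝ, 0 ≤ L ∧ ∀ (x p₁ p₂ v w : Vd d),
    |D2 (fun p => H x p) p₁ v w - D2 (fun p => H x p) p₂ v w| ≤ L * ‖p₁ - p₂‖ * ‖v‖ * ‖w‖
  Dpp_lower : ∀ x p v : Vd d, Cbar⁻¹ * sqnorm v ≤ D2 (fun p' => H x p') p v v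
  Dpp_upper : ∀ x p v : Vd d, D2 (fun p' => H x p') p v v ≤ Cbar * sqnorm v
  Dxx_growth : ∀ x p v w : Vd d,
    |D2 (fun x' => H x' p) x v w| ≤ Cg * (1 + ‖p‖) ^ (1 + θ) * ‖v‖ * ‖w‖
  Dxp_growth : ∀ x p v w : Vd d,
    |fderiv ℝ (fun x' => fderiv ℝ (fun p' => H x' p') p v) x w| ≤ Cg * (1 + ‖p‖) ^ θ * ‖v‖ * ‖w‖
  Hstar_eq : ∀ x q : Vd d, IsLUB (Set.range fun p => dotp q p - H x p) (Hstar x q)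
  Fd_per : ∀ (μ : Measure (Td d)) (x : Vd d) (z : Fin d → ℤ), Fd μ (x + intVec z) = Fd μ x
  Fd_smooth : ∀ μ : Measure (Td d), IsProbabilityMeasure μ → ContDiff ℝ 2 (Fd μ)
  Fd_D2_bound : ∀ μ : Measure (Td d), IsProbabilityMeasure μ →
    ∀ x v w : Vd d, |D2 (Fd μ) x v w| ≤ CF * ‖v‖ * ‖w‖
  flat_deriv : ∀ μ ν : PTd d,
    Fc ν - Fc μ = ∫ t in Set.Icc (0:ℝ) 1,
      ((∫ y, Fd (lineComb t μ ν) (secT y) ∂(ν : Measure (Td d))) -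
        ∫ y, Fd (lineComb t μ ν) (secT y) ∂(μ : Measure (Td d)))
  Fd_normalized : ∀ μ : PTd d, (∫ y, Fd (μ : Measure (Td d)) (secT y) ∂(μ : Measure (Td d))) = 0
  Fc_bounded : ∃ M : ℝ, ∀ μ : PTd d, |Fc μ| ≤ M
  Fd_bounded : ∃ M : ℝ, ∀ (μ : PTd d) (x : Vd d), |Fd (μ : Measure (Td d)) x| ≤ M

/-- Smooth periodic test functions on `[0,∞) × 𝕋^d` (resp. `ℝ × 𝕋^d`). -/
def IsTestFun {d : ℕ} (φ : ℝ → Vd d → ℝ) : Prop :=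
  ContDiff ℝ 2 (fun q : ℝ × Vd d => φ q.1 q.2) ∧
  ∀ (t : ℝ) (x : Vd d) (z : Fin d → ℤ), φ t (x + intVec z) = φ t x

/-- The weak (distributional) formulation of the Fokker--Planck equation
`-∂ₜ m + σ Δ m + div(m α) = 0` between times `s₁` and `s₂`. -/
def FPeq {d : ℕ} (σ : ℝ) (m : ℝ → PTd d) (α : ℝ → Td d → Vd d) (s₁ s₂ : ℝ) : Prop :=
  ∀ φ : ℝ → Vd d → ℝ, IsTestFun φ →
    (∫ y, φ s₂ (secT y) ∂(m s₂ : Measure (Td d))) -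
      (∫ y, φ s₁ (secT y) ∂(m s₁ : Measure (Td d))) =
    ∫ s in s₁..s₂, ∫ y, (tderiv φ s (secT y) + σ * lapl (φ s) (secT y)
        - dotp (α s y) (gradv (φ s) (secT y))) ∂(m s : Measure (Td d))

/-- Continuity of a curve of measures with respect to the 1-Wasserstein distance. -/
def W1ContOn {d : ℕ} (m : ℝ → PTd d) (I : Set ℝ) : Prop :=
  ∀ t ∈ I, ∀ ε > 0, ∃ η > 0, ∀ s ∈ I, |s - t| < η → W1 (m s) (m t) < ε

/-- Continuity of a function on `P(𝕋^d)` with respect to the 1-Wasserstein distance. -/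
def W1Continuous {d : ℕ} (χ : PTd d → ℝ) : Prop :=
  ∀ μ : PTd d, ∀ ε > 0, ∃ η > 0, ∀ ν : PTd d, W1 μ ν < η → |χ ν - χ μ| < ε

/-- W1-closed subsets of `P(𝕋^d)`. -/
def IsClosedW1 {d : ℕ} (C : Set (PTd d)) : Prop :=
  ∀ μ : PTd d, (∀ ε > 0, ∃ ν ∈ C, W1 μ ν < ε) → μ ∈ C

/-- The running cost `∫ H*(x,α(s)) dm(s) + 𝓕(m(s))`. -/
def runCost {d : ℕ} (S : MFGSetting d) (m : ℝ → PTd d) (α : ℝ → Td d → Vd d) (s : ℝ) : ℝ :=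
  (∫ y, S.Hstar (secT y) (α s y) ∂(m s : Measure (Td d))) + S.Fc (m s)

/-- Admissible pairs `(m,α)` on `[0,T]` starting from `m₀` (with `α ∈ L²_m`). -/
def AdmOn {d : ℕ} (S : MFGSetting d) (σ : ℝ) (m₀ : PTd d) (T : ℝ)
    (m : ℝ → PTd d) (α : ℝ → Td d → Vd d) : Prop :=
  m 0 = m₀ ∧ W1ContOn m (Set.Icc 0 T) ∧
  (∀ s₁ s₂ : ℝ, 0 ≤ s₁ → s₁ ≤ s₂ → s₂ ≤ T → FPeq σ m α s₁ s₂) ∧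
  Measurable (fun q : ℝ × Td d => α q.1 q.2) ∧
  (∫⁻ s in Set.Ioc (0:ℝ) T, ∫⁻ y, ENNReal.ofReal (sqnorm (α s y)) ∂(m s : Measure (Td d))) < ⊤ ∧
  IntervalIntegrable (runCost S m α) volume 0 T

/-- Admissible pairs `(m,α)` on `[0,T]` starting from `m₀`, with `α` merely in `L¹_m`
(the class `Π_T` used for problems with prescribed endpoints). -/
def AdmOn1 {d : ℕ} (S : MFGSetting d) (σ : ℝ) (m₀ : PTd d) (T : ℝ)
    (m : ℝ → PTd d) (α : ℝ → Td d → Vd d) : Prop :=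
  m 0 = m₀ ∧ W1ContOn m (Set.Icc 0 T) ∧
  (∀ s₁ s₂ : ℝ, 0 ≤ s₁ → s₁ ≤ s₂ → s₂ ≤ T → FPeq σ m α s₁ s₂) ∧
  Measurable (fun q : ℝ × Td d => α q.1 q.2) ∧
  (∫⁻ s in Set.Ioc (0:ℝ) T, ∫⁻ y, ENNReal.ofReal (Real.sqrt (sqnorm (α s y)))
      ∂(m s : Measure (Td d))) < ⊤ ∧
  IntervalIntegrable (runCost S m α) volume 0 T

/-- The finite horizon cost. -/
def costT {d : ℕ} (S : MFGSetting d) (m : ℝ → PTd d) (α : ℝ → Td d → Vd d) (T : ℝ) : ℝ :=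
  ∫ s in (0:ℝ)..T, runCost S m α s

/-- The value `𝒰(T,m₀)` of the finite horizon problem. -/
def Ufun {d : ℕ} (S : MFGSetting d) (σ : ℝ) (T : ℝ) (m₀ : PTd d) : ℝ :=
  sInf { r | ∃ m α, AdmOn S σ m₀ T m α ∧ r = costT S m α T }

/-- Admissible pairs for the infinite horizon `δ`-discounted problem. -/
def AdmDisc {d : ℕ} (S : MFGSetting d) (σ : ℝ) (δ : ℝ) (m₀ : PTd d)
    (m : ℝ → PTd d) (α : ℝ → Td d → Vd d) : Prop :=
  m 0 = m₀ ∧ W1ContOn m (Set.Ici 0) ∧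
  (∀ s₁ s₂ : ℝ, 0 ≤ s₁ → s₁ ≤ s₂ → FPeq σ m α s₁ s₂) ∧
  Measurable (fun q : ℝ × Td d => α q.1 q.2) ∧
  (∫⁻ s in Set.Ioi (0:ℝ), ENNReal.ofReal (Real.exp (-δ * s)) *
      ∫⁻ y, ENNReal.ofReal (sqnorm (α s y)) ∂(m s : Measure (Td d))) < ⊤ ∧
  Integrable (fun s => Real.exp (-δ * s) * runCost S m α s) (volume.restrict (Set.Ioi 0))

/-- The discounted cost. -/
def costDisc {d : ℕ} (S : MFGSetting d) (δ : ℝ) (m : ℝ → PTd d) (α : ℝ → Td d → Vd d) : ℝ :=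
  ∫ s in Set.Ioi (0:ℝ), Real.exp (-δ * s) * runCost S m α s

/-- The value `𝒱_δ(m₀)` of the discounted problem. -/
def Vfun {d : ℕ} (S : MFGSetting d) (σ : ℝ) (δ : ℝ) (m₀ : PTd d) : ℝ :=
  sInf { r | ∃ m α, AdmDisc S σ δ m₀ m α ∧ r = costDisc S δ m α }

/-- `D_p H (x, p)`. -/
def DpH {d : ℕ} (S : MFGSetting d) (x p : Vd d) : Vd d :=
  fun i => fderiv ℝ (fun p' => S.H x p') p (Pi.single i 1)

/-- `C^{1,2}` regularity on `I × 𝕋^d` of a (periodic) time-dependent function. -/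
def Creg12 {d : ℕ} (u : ℝ → Vd d → ℝ) (I : Set ℝ) : Prop :=
  ContinuousOn (fun q : ℝ × Vd d => u q.1 q.2) (I ×ˢ Set.univ) ∧
  (∀ x : Vd d, ∀ t ∈ I, DifferentiableAt ℝ (fun s => u s x) t) ∧
  (∀ t ∈ I, ContDiff ℝ 2 (u t)) ∧
  (∀ t ∈ I, ∀ (x : Vd d) (z : Fin d → ℤ), u t (x + intVec z) = u t x)

/-- `(u,m)` is a classical solution of the `δ`-discounted MFG system on `[0,∞) × 𝕋^d`:
`-∂ₜ u - Δ u + δ u + H(x,Du) = F(x,m)` and `-∂ₜ m + Δ m + div(m D_pH(x,Du)) = 0`. -/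
def SolvesDiscMFG {d : ℕ} (S : MFGSetting d) (δ : ℝ) (u : ℝ → Vd d → ℝ) (m : ℝ → PTd d) : Prop :=
  Creg12 u (Set.Ici 0) ∧
  (∀ t ∈ Set.Ici (0:ℝ), ∀ x : Vd d,
    - tderiv u t x - lapl (u t) x + δ * u t x + S.H x (gradv (u t) x)
      = S.Fd (m t : Measure (Td d)) x) ∧
  W1ContOn m (Set.Ici 0) ∧
  (∀ s₁ s₂ : ℝ, 0 ≤ s₁ → s₁ ≤ s₂ →
    FPeq 1 m (fun s y => DpH S (secT y) (gradv (u s) (secT y))) s₁ s₂)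

/-- Admissible pairs for the stationary (ergodic) problem:
`σ Δ m + div(m α) = 0` in the sense of distributions and `α ∈ L²_m`. -/
def StatAdm {d : ℕ} (σ : ℝ) (m : PTd d) (α : Td d → Vd d) : Prop :=
  Measurable α ∧
  (∫⁻ y, ENNReal.ofReal (sqnorm (α y)) ∂(m : Measure (Td d))) < ⊤ ∧
  ∀ g : Vd d → ℝ, ContDiff ℝ 2 g → (∀ (x : Vd d) (z : Fin d → ℤ), g (x + intVec z) = g x) →
    (∫ y, (σ * lapl g (secT y) - dotp (α y) (gradv g (secT y))) ∂(m : Measure (Td d))) = 0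

/-- `ergInf S σ = -λ̄`, the value of the stationary minimization problem. -/
def ergInf {d : ℕ} (S : MFGSetting d) (σ : ℝ) : ℝ :=
  sInf { r | ∃ m α, StatAdm σ m α ∧
    r = (∫ y, S.Hstar (secT y) (α y) ∂(m : Measure (Td d))) + S.Fc m }

/-- The set of values over which the dynamic programming principle for a corrector
`χ` takes its infimum. -/
def DPPval {d : ℕ} (S : MFGSetting d) (σ : ℝ) (χ : PTd d → ℝ) (lam t : ℝ) (m₀ : PTd d) :
    Set ℝ :=
  { r | ∃ m α, AdmOn S σ m₀ t m α ∧
      r = (∫ s in (0:ℝ)..t, runCost S m α s) + χ (m t) + lam * t }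

/-- `χ` is a corrector function: it is continuous and satisfies the dynamic
programming principle with the critical value `λ`. -/
def IsCorrector {d : ℕ} (S : MFGSetting d) (σ : ℝ) (lam : ℝ) (χ : PTd d → ℝ) : Prop :=
  W1Continuous χ ∧ ∀ (m₀ : PTd d) (t : ℝ), 0 < t → χ m₀ = sInf (DPPval S σ χ lam t m₀)

/-- `(m,α)` is a calibrated curve (defined on all of `ℝ`). -/
def IsCalibrated {d : ℕ} (S : MFGSetting d) (σ : ℝ) (lam : ℝ)
    (m : ℝ → PTd d) (α : ℝ → Td d → Vd d) : Prop :=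
  W1ContOn m Set.univ ∧
  (∀ s₁ s₂ : ℝ, s₁ ≤ s₂ → FPeq σ m α s₁ s₂) ∧
  Measurable (fun q : ℝ × Td d => α q.1 q.2) ∧
  (∀ t₁ t₂ : ℝ, (∫⁻ s in Set.Ioc t₁ t₂,
      ∫⁻ y, ENNReal.ofReal (sqnorm (α s y)) ∂(m s : Measure (Td d))) < ⊤) ∧
  (∀ t₁ t₂ : ℝ, IntervalIntegrable (runCost S m α) volume t₁ t₂) ∧
  ∃ χ : PTd d → ℝ, IsCorrector S σ lam χ ∧ ∀ t₁ t₂ : ℝ, t₁ < t₂ →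
    χ (m t₁) = lam * (t₂ - t₁) + (∫ s in t₁..t₂, runCost S m α s) + χ (m t₂)

/-- The projected Mather set. -/
def MatherSet {d : ℕ} (S : MFGSetting d) (σ : ℝ) (lam : ℝ) : Set (PTd d) :=
  { μ | ∃ m α, IsCalibrated S σ lam m α ∧ m 0 = μ }

/-- Invariant subsets of the projected Mather set. -/
def IsInvariantMFG {d : ℕ} (S : MFGSetting d) (σ : ℝ) (lam : ℝ) (C : Set (PTd d)) : Prop :=
  ∀ μ ∈ C, ∃ m α, IsCalibrated S σ lam m α ∧ m 0 = μ ∧ ∀ t : ℝ, m t ∈ C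

/-- Minimal invariant subsets of the projected Mather set. -/
def IsMinimalInvariant {d : ℕ} (S : MFGSetting d) (σ : ℝ) (lam : ℝ) (N : Set (PTd d)) : Prop :=
  N.Nonempty ∧ N ⊆ MatherSet S σ lam ∧ IsClosedW1 N ∧ IsInvariantMFG S σ lam N ∧
  ∀ C : Set (PTd d), C ⊆ N → C.Nonempty → IsClosedW1 C → IsInvariantMFG S σ lam C → C = N

/-- `δ 𝒱_δ → -λ` uniformly as `δ → 0⁺`. -/
def IsLimitValueV {d : ℕ} (S : MFGSetting d) (σ : ℝ) (lam : ℝ) : Prop :=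
  ∀ ε > 0, ∃ δ₀ > 0, ∀ δ : ℝ, 0 < δ → δ ≤ δ₀ → ∀ μ : PTd d,
    |δ * Vfun S σ δ μ - (-lam)| < ε

/-- `𝒰(T,·)/T → -λ` uniformly as `T → ∞`. -/
def IsLimitValueU {d : ℕ} (S : MFGSetting d) (σ : ℝ) (lam : ℝ) : Prop :=
  ∀ ε > 0, ∃ T₀ : ℝ, ∀ T : ℝ, T₀ ≤ T → ∀ μ : PTd d,
    |Ufun S σ T μ / T - (-lam)| < ε

/-- A function `Φ` on `P(𝕋^d)` is `C¹` with flat derivative `dΦ` (normalized so that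
`∫ dΦ(m,·) dm = 0`, periodic in the space variable and jointly continuous). -/
def IsC1Flat {d : ℕ} (Φ : PTd d → ℝ) (dΦ : Measure (Td d) → Vd d → ℝ) : Prop :=
  (∀ (μ : Measure (Td d)) (x : Vd d) (z : Fin d → ℤ), dΦ μ (x + intVec z) = dΦ μ x) ∧
  (∀ μ ν : PTd d,
    Φ ν - Φ μ = ∫ t in Set.Icc (0:ℝ) 1,
      ((∫ y, dΦ (lineComb t μ ν) (secT y) ∂(ν : Measure (Td d))) -
        ∫ y, dΦ (lineComb t μ ν) (secT y) ∂(μ : Measure (Td d)))) ∧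
  (∀ μ : PTd d, (∫ y, dΦ (μ : Measure (Td d)) (secT y) ∂(μ : Measure (Td d))) = 0) ∧
  (∀ ε > 0, ∀ (μ : PTd d) (x : Vd d), ∃ η > 0, ∀ (ν : PTd d) (x' : Vd d),
    W1 μ ν < η → ‖x' - x‖ < η → |dΦ (ν : Measure (Td d)) x' - dΦ (μ : Measure (Td d)) x| < ε)

section partA
open scoped Topology

def piT {d : ℕ} (x : Vd d) : Td d := fun i => (x i : AddCircle (1:ℝ))

lemma piT_secT {d : ℕ} (y : Td d) : piT (secT y) = y := by
  funext i
  exact (AddCircle.equivIco 1 0).symm_apply_apply (y i)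

lemma continuous_piT {d : ℕ} : Continuous (piT : Vd d → Td d) :=
  continuous_pi fun i => (AddCircle.continuous_mk' 1).comp (continuous_apply i)

lemma piT_add {d : ℕ} (x y : Vd d) : piT (x + y) = piT x + piT y := by
  funext i; simp [piT]

lemma piT_eq {d : ℕ} {x y : Vd d} (h : piT x = piT y) : ∃ z : Fin d → ℤ, x = y + intVec z := by
  have : ∀ i, ∃ n : ℤ, x i = y i + n := by
    intro i
    have h1 : ((x i - y i : ℝ) : AddCircle (1:ℝ)) = 0 := by
      rw [AddCircle.coe_sub, sub_eq_zero]; exact congrFun h i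
    obtain ⟨n, hn⟩ := (AddCircle.coe_eq_zero_iff (1:ℝ)).1 h1
    exact ⟨n, by simp at hn; linarith⟩
  choose z hz using this
  exact ⟨z, by funext i; simp [intVec, hz i]⟩

lemma per_sec {d : ℕ} {E : Type*} {g : Vd d → E} (hg : ∀ x (z : Fin d → ℤ), g (x + intVec z) = g x)
    (x : Vd d) : g (secT (piT x)) = g x := by
  obtain ⟨z, hz⟩ := piT_eq (piT_secT (piT x))
  rw [hz, hg]

lemma per_sec_add {d : ℕ} {E : Type*} {g : Vd d → E} (hg : ∀ x (z : Fin d → ℤ), g (x + intVec z) = g x)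
    (y : Td d) (v : Vd d) : g (secT (y + piT v)) = g (secT y + v) := by
  rw [← per_sec hg (secT y + v), piT_add, piT_secT]

lemma measurable_secT {d : ℕ} : Measurable (secT : Td d → Vd d) := by
  refine measurable_pi_lambda _ fun i => ?_
  exact measurable_subtype_coe.comp ((AddCircle.measurableEquivIco 1 0).measurable.comp (measurable_pi_apply i))

lemma isOpenQuot_piT {d : ℕ} : IsOpenQuotientMap (piT : Vd d → Td d) := by
  exact IsOpenQuotientMap.piMap fun i => QuotientAddGroup.isOpenQuotientMap_mk

lemma cont_sec {d : ℕ} {Z E : Type*} [TopologicalSpace Z] [TopologicalSpace E] {g : Z → Vd d → E}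
    (hc : Continuous fun q : Z × Vd d => g q.1 q.2)
    (hg : ∀ s x (z : Fin d → ℤ), g s (x + intVec z) = g s x) :
    Continuous fun q : Z × Td d => g q.1 (secT q.2) := by
  have hq : IsOpenQuotientMap (Prod.map (id : Z → Z) (piT : Vd d → Td d)) :=
    IsOpenQuotientMap.id.prodMap isOpenQuot_piT
  rw [hq.isQuotientMap.continuous_iff]
  convert hc using 2 with q
  exact per_sec (hg q.1) q.2

lemma cont_sec1 {d : ℕ} {E : Type*} [TopologicalSpace E] {g : Vd d → E}
    (hc : Continuous g) (hg : ∀ x (z : Fin d → ℤ), g (x + intVec z) = g x) :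
    Continuous fun y : Td d => g (secT y) := by
  rw [isOpenQuot_piT.isQuotientMap.continuous_iff]
  have : (fun y => g (secT y)) ∘ piT = g := funext (per_sec hg)
  rwa [this]

/-! test functions -/
section test
variable {d : ℕ} {φ : ℝ → Vd d → ℝ}

lemma IsTestFun.tder (h : IsTestFun φ) (s : ℝ) (x : Vd d) :
    HasDerivAt (fun r => φ r x) (fderiv ℝ (fun q : ℝ × Vd d => φ q.1 q.2) (s, x) (1, 0)) s := by
  have h1 : HasFDerivAt (fun q : ℝ × Vd d => φ q.1 q.2) _ (s, x) :=
    (h.1.differentiable (by norm_num) (s,x)).hasFDerivAt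
  have h2 : HasDerivAt (fun r : ℝ => (r, x)) ((1:ℝ), (0 : Vd d)) s :=
    (hasDerivAt_id s).prodMk (hasDerivAt_const s x)
  exact h1.comp_hasDerivAt s h2

lemma IsTestFun.xder (h : IsTestFun φ) (s : ℝ) (x : Vd d) :
    HasFDerivAt (φ s) ((fderiv ℝ (fun q : ℝ × Vd d => φ q.1 q.2) (s, x)).comp
      (ContinuousLinearMap.inr ℝ ℝ (Vd d))) x := by
  have h1 : HasFDerivAt (fun q : ℝ × Vd d => φ q.1 q.2) _ (s, x) :=
    (h.1.differentiable (by norm_num) (s,x)).hasFDerivAt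
  exact h1.comp x (hasFDerivAt_prodMk_right s x)

lemma IsTestFun.xsmooth (h : IsTestFun φ) (s : ℝ) : ContDiff ℝ 2 (φ s) :=
  h.1.comp (contDiff_prodMk_right s)

lemma IsTestFun.fderiv_x (h : IsTestFun φ) (s : ℝ) (x v : Vd d) :
    fderiv ℝ (φ s) x v = fderiv ℝ (fun q : ℝ × Vd d => φ q.1 q.2) (s, x) (0, v) := by
  rw [(h.xder s x).fderiv]; simp

lemma IsTestFun.cont_tderiv (h : IsTestFun φ) : Continuous fun q : ℝ × Vd d => tderiv φ q.1 q.2 := by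
  have : (fun q : ℝ × Vd d => tderiv φ q.1 q.2) =
      fun q => fderiv ℝ (fun q : ℝ × Vd d => φ q.1 q.2) q (1, 0) := by
    funext q; exact (h.tder q.1 q.2).deriv
  rw [this]
  exact (h.1.continuous_fderiv (by norm_num)).clm_apply continuous_const

lemma IsTestFun.c1_x (h : IsTestFun φ) (v : Vd d) :
    ContDiff ℝ 1 fun q : ℝ × Vd d => fderiv ℝ (φ q.1) q.2 v := by
  have : (fun q : ℝ × Vd d => fderiv ℝ (φ q.1) q.2 v) =
      fun q => fderiv ℝ (fun q : ℝ × Vd d => φ q.1 q.2) q (0, v) := by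
    funext q; exact h.fderiv_x q.1 q.2 v
  rw [this]
  exact (h.1.fderiv_right (m := 1) (by norm_num)).clm_apply contDiff_const

lemma IsTestFun.cont_gradv (h : IsTestFun φ) :
    Continuous fun q : ℝ × Vd d => gradv (φ q.1) q.2 :=
  continuous_pi fun i => (h.c1_x (Pi.single i 1)).continuous

lemma IsTestFun.cont_D2 (h : IsTestFun φ) (v w : Vd d) :
    Continuous fun q : ℝ × Vd d => D2 (φ q.1) q.2 v w := by
  have : (fun q : ℝ × Vd d => D2 (φ q.1) q.2 v w) =
      fun q => fderiv ℝ (fun q : ℝ × Vd d => fderiv ℝ (φ q.1) q.2 v) q (0, w) := by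
    funext q
    have h1 : HasFDerivAt (fun q : ℝ × Vd d => fderiv ℝ (φ q.1) q.2 v) _ (q.1, q.2) :=
      ((h.c1_x v).differentiable (by norm_num) (q.1, q.2)).hasFDerivAt
    have h2 := h1.comp q.2 (hasFDerivAt_prodMk_right q.1 q.2)
    have h3 : fderiv ℝ (fun y => fderiv ℝ (φ q.1) y v) q.2 = _ := h2.fderiv
    simp only [D2, h3]; simp
  rw [this]
  exact ((h.c1_x v).continuous_fderiv (by norm_num)).clm_apply continuous_const

lemma IsTestFun.cont_lapl (h : IsTestFun φ) : Continuous fun q : ℝ × Vd d => lapl (φ q.1) q.2 :=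
  continuous_finsetSum _ fun i _ => h.cont_D2 _ _

lemma fderiv_per {E : Type*} [NormedAddCommGroup E] [NormedSpace ℝ E] {g : Vd d → E} (hg : ∀ x (z : Fin d → ℤ), g (x + intVec z) = g x) (x : Vd d)
    (z : Fin d → ℤ) : fderiv ℝ g (x + intVec z) = fderiv ℝ g x := by
  rw [← fderiv_comp_add_right]
  congr 1; funext y; exact hg y z

lemma gradv_per {g : Vd d → ℝ} (hg : ∀ x (z : Fin d → ℤ), g (x + intVec z) = g x) (x : Vd d)
    (z : Fin d → ℤ) : gradv g (x + intVec z) = gradv g x := by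
  funext i; simp only [gradv, fderiv_per hg]

lemma D2_per {g : Vd d → ℝ} (hg : ∀ x (z : Fin d → ℤ), g (x + intVec z) = g x) (x v w : Vd d)
    (z : Fin d → ℤ) : D2 g (x + intVec z) v w = D2 g x v w := by
  simp only [D2]
  rw [fderiv_per]
  intro x z; rw [fderiv_per hg]

lemma lapl_per {g : Vd d → ℝ} (hg : ∀ x (z : Fin d → ℤ), g (x + intVec z) = g x) (x : Vd d)
    (z : Fin d → ℤ) : lapl g (x + intVec z) = lapl g x := by
  simp only [lapl, D2_per hg]

lemma IsTestFun.cs_val (h : IsTestFun φ) : Continuous fun q : ℝ × Td d => φ q.1 (secT q.2) :=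
  cont_sec h.1.continuous h.2
lemma IsTestFun.cs_t (h : IsTestFun φ) : Continuous fun q : ℝ × Td d => tderiv φ q.1 (secT q.2) :=
  cont_sec h.cont_tderiv (fun s x z => by simp only [tderiv, h.2])
lemma IsTestFun.cs_l (h : IsTestFun φ) : Continuous fun q : ℝ × Td d => lapl (φ q.1) (secT q.2) :=
  cont_sec h.cont_lapl (fun s x z => lapl_per (h.2 s) x z)
lemma IsTestFun.cs_g (h : IsTestFun φ) : Continuous fun q : ℝ × Td d => gradv (φ q.1) (secT q.2) :=
  cont_sec h.cont_gradv (fun s x z => gradv_per (h.2 s) x z)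

lemma bdd_strip {E : Type*} [NormedAddCommGroup E] {g : ℝ × Td d → E} (hg : Continuous g) :
    ∃ C : ℝ, 0 ≤ C ∧ ∀ s ∈ Icc (0:ℝ) 1, ∀ y, ‖g (s, y)‖ ≤ C := by
  obtain ⟨C, hC⟩ := ((isCompact_Icc (a := (0:ℝ)) (b := 1)).prod (isCompact_univ (X := Td d))).exists_bound_of_continuousOn hg.continuousOn
  exact ⟨max C 0, le_max_right _ _, fun s hs y => (hC (s, y) ⟨hs, mem_univ _⟩).trans (le_max_left _ _)⟩

end test
end partA

section partB
open scoped Topology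

lemma riesz_dom {X : Type*} [MeasurableSpace X] (μ : Measure X) [IsFiniteMeasure μ] {V : Type*}
    [AddCommGroup V] [Module ℝ V] (T : V →ₗ[ℝ] Lp ℝ 2 μ) (l : V →ₗ[ℝ] ℝ)
    (h : ∀ v, l v ≤ ∫ x, max (T v x) 0 ∂μ) :
    ∃ f : X → ℝ, Measurable f ∧ (∀ x, 0 ≤ f x ∧ f x ≤ 1) ∧ ∀ v, l v = ∫ x, f x * T v x ∂μ := by
  have hint : ∀ u : Lp ℝ 2 μ, Integrable u μ := fun u => (Lp.memLp u).integrable (by norm_num)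
  have hintp : ∀ u : Lp ℝ 2 μ, Integrable (fun x => max (u x) 0) μ := fun u => (hint u).pos_part
  have hker : ∀ v, T v = 0 → l v = 0 := by
    have key : ∀ v, T v = 0 → l v ≤ 0 := by
      intro v hv
      refine (h v).trans_eq ?_
      rw [hv]
      have : (fun x => max ((0 : Lp ℝ 2 μ) x) 0) =ᵐ[μ] fun _ => (0:ℝ) := by
        filter_upwards [Lp.coeFn_zero ℝ 2 μ] with x hx; rw [hx]; simp
      rw [integral_congr_ae this]; simp
    intro v hv
    have h1 := key v hv
    have h2 := key (-v) (by rw [map_neg, hv, neg_zero])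
    rw [map_neg] at h2; linarith
  obtain ⟨σ, hσ⟩ := LinearMap.exists_rightInverse_of_surjective T.rangeRestrict
    T.range_rangeRestrict
  have hTσ : ∀ u, T (σ u) = u := fun u => by
    have := LinearMap.congr_fun hσ u
    exact congrArg Subtype.val this
  have hlσ : ∀ v, l (σ ⟨T v, LinearMap.mem_range_self T v⟩) = l v := fun v => by
    have := hker (σ ⟨T v, LinearMap.mem_range_self T v⟩ - v) (by rw [map_sub, hTσ]; simp)
    rw [map_sub] at this; linarith
  obtain ⟨g, hg1, hg2⟩ := exists_extension_of_le_sublinear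
    (⟨LinearMap.range T, l.comp σ⟩ : Lp ℝ 2 μ →ₗ.[ℝ] ℝ) (fun u => ∫ x, max (u x) 0 ∂μ) (by
      intro c hc u
      rw [← integral_const_mul]
      refine integral_congr_ae ?_
      filter_upwards [Lp.coeFn_smul c u] with x hx
      rw [hx, mul_max_of_nonneg _ _ hc.le]; simp) (by
      intro u v
      rw [← integral_add (hintp u) (hintp v)]
      refine integral_mono_ae (hintp _) ((hintp u).add (hintp v)) ?_
      filter_upwards [Lp.coeFn_add u v] with x hx
      rw [hx]
      simp only [Pi.add_apply]
      exact max_le (add_le_add (le_max_left _ _) (le_max_left _ _))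
        (add_nonneg (le_max_right _ _) (le_max_right _ _))) (by
      rintro ⟨u, v, rfl⟩
      exact (hlσ v).trans_le (h v))
  have hgT : ∀ v, g (T v) = l v := fun v =>
    (hg1 ⟨T v, LinearMap.mem_range_self T v⟩).trans (hlσ v)
  let one : Lp ℝ 2 μ := (memLp_const (1:ℝ)).toLp
  have hone : one =ᵐ[μ] fun _ => (1:ℝ) := MemLp.coeFn_toLp _
  have hb : ∀ u : Lp ℝ 2 μ, g u ≤ ‖one‖ * ‖u‖ := by
    intro u
    refine (hg2 u).trans ?_
    have h1 : ∫ x, max (u x) 0 ∂μ ≤ inner ℝ one |u| := by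
      rw [L2.inner_def]
      refine integral_mono_ae (hintp u) (L2.integrable_inner _ _) ?_
      filter_upwards [hone, Lp.coeFn_abs u] with x h1 h2
      rw [h1, h2]; simp [le_abs_self]
    refine h1.trans ((real_inner_le_norm _ _).trans ?_)
    rw [norm_abs_eq_norm]
  let G : Lp ℝ 2 μ →L[ℝ] ℝ := g.mkContinuous ‖one‖ (fun u => by
    rw [Real.norm_eq_abs, abs_le]
    refine ⟨?_, hb u⟩
    have := hb (-u)
    rw [map_neg, norm_neg] at this; linarith)
  let f0 : Lp ℝ 2 μ := (InnerProductSpace.toDual ℝ (Lp ℝ 2 μ)).symm G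
  have hf0 : ∀ u, g u = ∫ x, f0 x * u x ∂μ := by
    intro u
    have h1 : inner ℝ f0 u = G u := InnerProductSpace.toDual_symm_apply
    rw [L2.inner_def] at h1
    change _ = g u at h1
    rw [← h1]
    refine integral_congr_ae (Eventually.of_forall fun x => ?_)
    simp [mul_comm]
  have hmeas : Measurable f0 := (Lp.stronglyMeasurable f0).measurable
  have hind : ∀ s, MeasurableSet s → ∀ c : ℝ, c * ∫ x in s, f0 x ∂μ ≤ ∫ x in s, max c 0 ∂μ := by
    intro s hs c
    let u : Lp ℝ 2 μ := indicatorConstLp 2 hs (measure_ne_top μ s) c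
    have hu : u =ᵐ[μ] s.indicator fun _ => c := indicatorConstLp_coeFn
    have h1 := hg2 u
    rw [hf0] at h1
    have e1 : ∫ x, f0 x * u x ∂μ = c * ∫ x in s, f0 x ∂μ := by
      rw [← integral_const_mul, ← integral_indicator hs]
      refine integral_congr_ae ?_
      filter_upwards [hu] with x hx
      rw [hx]; by_cases hxs : x ∈ s <;> simp [hxs, mul_comm]
    have e2 : ∫ x, max (u x) 0 ∂μ = ∫ x in s, max c 0 ∂μ := by
      rw [← integral_indicator hs]
      refine integral_congr_ae ?_
      filter_upwards [hu] with x hx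
      rw [hx]; by_cases hxs : x ∈ s <;> simp [hxs]
    rw [e1] at h1
    exact h1.trans_eq e2
  have hpos : 0 ≤ᵐ[μ] f0 := by
    refine ae_nonneg_of_forall_setIntegral_nonneg (hint f0) fun s hs _ => ?_
    have := hind s hs (-1)
    simp at this
    linarith
  have hle : f0 ≤ᵐ[μ] fun _ => (1:ℝ) := by
    refine ae_le_of_forall_setIntegral_le (hint f0) (integrable_const _) fun s hs _ => ?_
    have := hind s hs 1
    simpa using this
  refine ⟨fun x => max 0 (min 1 (f0 x)), measurable_const.max (measurable_const.min hmeas),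
    fun x => ⟨le_max_left _ _, max_le zero_le_one (min_le_left _ _)⟩, fun v => ?_⟩
  rw [← hgT, hf0]
  refine integral_congr_ae ?_
  filter_upwards [hpos, hle] with x h1 h2
  rw [min_eq_right h2, max_eq_right (show (0:ℝ) ≤ f0 x from h1)]

lemma riesz_two {X Y : Type*} [MeasurableSpace X] [MeasurableSpace Y] (A : Measure X)
    (B : Measure Y) [IsFiniteMeasure A] [IsFiniteMeasure B] {V : Type*}
    [AddCommGroup V] [Module ℝ V] (T₁ : V →ₗ[ℝ] X → ℝ) (T₂ : V →ₗ[ℝ] Y → ℝ) (l : V →ₗ[ℝ] ℝ)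
    (m₁ : ∀ v, Measurable (T₁ v)) (m₂ : ∀ v, Measurable (T₂ v))
    (i₁ : ∀ v, Integrable (fun x => T₁ v x ^ 2) A) (i₂ : ∀ v, Integrable (fun x => T₂ v x ^ 2) B)
    (h : ∀ v, l v ≤ (∫ x, max (T₁ v x) 0 ∂A) + ∫ x, max (T₂ v x) 0 ∂B) :
    ∃ (f₁ : X → ℝ) (f₂ : Y → ℝ), Measurable f₁ ∧ Measurable f₂ ∧ (∀ x, 0 ≤ f₁ x ∧ f₁ x ≤ 1) ∧
      (∀ x, 0 ≤ f₂ x ∧ f₂ x ≤ 1) ∧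
      ∀ v, l v = (∫ x, f₁ x * T₁ v x ∂A) + ∫ x, f₂ x * T₂ v x ∂B := by
  let μ : Measure (X ⊕ Y) := A.map Sum.inl + B.map Sum.inr
  have hI : ∀ g : X ⊕ Y → ℝ, Measurable g → Integrable (fun x => g (Sum.inl x)) A →
      Integrable (fun x => g (Sum.inr x)) B → Integrable g μ ∧
        ∫ z, g z ∂μ = (∫ x, g (Sum.inl x) ∂A) + ∫ x, g (Sum.inr x) ∂B := by
    intro g hg ha hb
    have h1 : Integrable g (A.map Sum.inl) :=
      (integrable_map_measure hg.aestronglyMeasurable measurable_inl.aemeasurable).2 ha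
    have h2 : Integrable g (B.map Sum.inr) :=
      (integrable_map_measure hg.aestronglyMeasurable measurable_inr.aemeasurable).2 hb
    refine ⟨h1.add_measure h2, ?_⟩
    rw [integral_add_measure h1 h2, integral_map measurable_inl.aemeasurable
      hg.aestronglyMeasurable, integral_map measurable_inr.aemeasurable hg.aestronglyMeasurable]
  let T : V → X ⊕ Y → ℝ := fun v => Sum.elim (T₁ v) (T₂ v)
  have hTm : ∀ v, Measurable (T v) := fun v => (m₁ v).sumElim (m₂ v)
  have hT2 : ∀ v, MemLp (T v) 2 μ := fun v =>
    (memLp_two_iff_integrable_sq (hTm v).aestronglyMeasurable).2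
      (hI _ ((hTm v).pow_const 2) (i₁ v) (i₂ v)).1
  have i1 : ∀ v, Integrable (T₁ v) A := fun v =>
    ((memLp_two_iff_integrable_sq (m₁ v).aestronglyMeasurable).2 (i₁ v)).integrable (by norm_num)
  have i2 : ∀ v, Integrable (T₂ v) B := fun v =>
    ((memLp_two_iff_integrable_sq (m₂ v).aestronglyMeasurable).2 (i₂ v)).integrable (by norm_num)
  let TL : V →ₗ[ℝ] Lp ℝ 2 μ :=
    { toFun := fun v => (hT2 v).toLp
      map_add' := fun u v => by
        rw [← MemLp.toLp_add]; congr 1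
        funext z; rcases z with z | z <;> simp [T]
      map_smul' := fun c v => by
        rw [RingHom.id_apply, ← MemLp.toLp_const_smul]; congr 1
        funext z; rcases z with z | z <;> simp [T] }
  have hTL : ∀ v, TL v =ᵐ[μ] T v := fun v => MemLp.coeFn_toLp (hT2 v)
  obtain ⟨f, hf, hf01, hfl⟩ := riesz_dom μ TL l (fun v => by
    have : ∫ z, max (TL v z) 0 ∂μ = ∫ z, max (T v z) 0 ∂μ :=
      integral_congr_ae ((hTL v).mono fun z hz => by simp only [hz])
    rw [this, (hI _ ((hTm v).max measurable_const) (i1 v).pos_part (i2 v).pos_part).2]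
    exact h v)
  refine ⟨fun x => f (Sum.inl x), fun x => f (Sum.inr x), hf.comp measurable_inl,
    hf.comp measurable_inr, fun x => hf01 _, fun x => hf01 _, fun v => ?_⟩
  have : ∫ z, f z * TL v z ∂μ = ∫ z, f z * T v z ∂μ :=
    integral_congr_ae ((hTL v).mono fun z hz => by simp only [hz])
  rw [hfl, this]
  refine (hI _ (hf.mul (hTm v)) ?_ ?_).2
  · exact (i1 v).bdd_mul (c := 1) (hf.comp measurable_inl).aestronglyMeasurable
      (Eventually.of_forall fun x => by
        rw [Real.norm_eq_abs, abs_of_nonneg (hf01 _).1]; exact (hf01 _).2)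
  · exact (i2 v).bdd_mul (c := 1) (hf.comp measurable_inr).aestronglyMeasurable
      (Eventually.of_forall fun x => by
        rw [Real.norm_eq_abs, abs_of_nonneg (hf01 _).1]; exact (hf01 _).2)
end partB

section partC
open scoped Topology

section gfp
variable {d : ℕ}

def Lop (φ : ℝ → Vd d → ℝ) (β : ℝ × Td d → Vd d) (q : ℝ × Td d) : ℝ :=
  tderiv φ q.1 (secT q.2) + lapl (φ q.1) (secT q.2) - dotp (β q) (gradv (φ q.1) (secT q.2))

structure GFP (A : Measure (ℝ × Td d)) (β : ℝ × Td d → Vd d) (μ₀ μ₁ : Measure (Td d)) : Prop where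
  finA : IsFiniteMeasure A
  fin0 : IsFiniteMeasure μ₀
  fin1 : IsFiniteMeasure μ₁
  supp : ∀ᵐ q ∂A, q.1 ∈ Ioc (0:ℝ) 1
  meas : Measurable β
  l2 : Integrable (fun q => sqnorm (β q)) A
  fp : ∀ φ : ℝ → Vd d → ℝ, IsTestFun φ →
    (∫ y, φ 1 (secT y) ∂μ₁) - (∫ y, φ 0 (secT y) ∂μ₀) = ∫ q, Lop φ β q ∂A

lemma sqnorm_nonneg (a : Vd d) : 0 ≤ sqnorm a := Finset.sum_nonneg fun _ _ => sq_nonneg _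

lemma dotp_sq_le (a b : Vd d) : (dotp a b) ^ 2 ≤ sqnorm a * sqnorm b :=
  Finset.sum_mul_sq_le_sq_mul_sq _ _ _

lemma sqnorm_le_norm (a : Vd d) : sqnorm a ≤ d * ‖a‖ ^ 2 := by
  have : ∀ i ∈ Finset.univ, (a i) ^ 2 ≤ ‖a‖ ^ 2 := fun i _ => by
    rw [← sq_abs]; exact pow_le_pow_left₀ (abs_nonneg _) (norm_le_pi_norm a i) 2
  refine (Finset.sum_le_sum this).trans ?_
  simp

lemma continuous_sqnorm : Continuous (sqnorm : Vd d → ℝ) :=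
  continuous_finsetSum _ fun i _ => (continuous_apply i).pow 2
lemma continuous_dotp : Continuous (fun q : Vd d × Vd d => dotp q.1 q.2) :=
  continuous_finsetSum _ fun i _ => ((continuous_apply i).comp continuous_fst).mul
    ((continuous_apply i).comp continuous_snd)

lemma Lop_meas {φ : ℝ → Vd d → ℝ} (h : IsTestFun φ) {β : ℝ × Td d → Vd d} (hβ : Measurable β) :
    Measurable (Lop φ β) :=
  (h.cs_t.measurable.add h.cs_l.measurable).sub
    (continuous_dotp.measurable.comp (hβ.prodMk h.cs_g.measurable))

lemma Lop_sq {φ : ℝ → Vd d → ℝ} (h : IsTestFun φ) : ∃ C : ℝ, 0 ≤ C ∧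
    ∀ (β : ℝ × Td d → Vd d) (q : ℝ × Td d), q.1 ∈ Icc (0:ℝ) 1 →
      (Lop φ β q) ^ 2 ≤ C * (1 + sqnorm (β q)) := by
  obtain ⟨C₁, h1, hC₁⟩ := bdd_strip h.cs_t
  obtain ⟨C₂, h2, hC₂⟩ := bdd_strip h.cs_l
  obtain ⟨C₃, h3, hC₃⟩ := bdd_strip (continuous_sqnorm.comp h.cs_g)
  refine ⟨3 * (C₁ ^ 2 + C₂ ^ 2 + C₃), by positivity, fun β q hq => ?_⟩
  have a1 := hC₁ q.1 hq q.2
  have a2 := hC₂ q.1 hq q.2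
  have a3 := hC₃ q.1 hq q.2
  have b1 := sq_le_sq' (abs_le.1 a1).1 (abs_le.1 a1).2
  have b2 := sq_le_sq' (abs_le.1 a2).1 (abs_le.1 a2).2
  have b3 := dotp_sq_le (β q) (gradv (φ q.1) (secT q.2))
  have b4 := (abs_le.1 a3).2
  simp only [Function.comp] at b4
  have b5 := mul_le_mul_of_nonneg_left b4 (sqnorm_nonneg (β q))
  have b6 := sqnorm_nonneg (β q)
  unfold Lop
  set u := tderiv φ q.1 (secT q.2)
  set v := lapl (φ q.1) (secT q.2)
  set w := dotp (β q) (gradv (φ q.1) (secT q.2))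
  have e : (u + v - w) ^ 2 ≤ 3 * (u ^ 2 + v ^ 2 + w ^ 2) := by
    nlinarith [sq_nonneg (u - v), sq_nonneg (u + w), sq_nonneg (v + w)]
  have : 0 ≤ (C₁ ^ 2 + C₂ ^ 2) * sqnorm (β q) := by positivity
  nlinarith

lemma GFP.int_sq {A : Measure (ℝ × Td d)} {β μ₀ μ₁} (G : GFP A β μ₀ μ₁) {φ : ℝ → Vd d → ℝ}
    (h : IsTestFun φ) : Integrable (fun q => Lop φ β q ^ 2) A := by
  have := G.finA
  obtain ⟨C, hC, hb⟩ := Lop_sq h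
  refine Integrable.mono' (((integrable_const (1:ℝ)).add G.l2).const_mul C)
    ((Lop_meas h G.meas).pow_const 2).aestronglyMeasurable ?_
  filter_upwards [G.supp] with q hq
  rw [Real.norm_eq_abs, abs_of_nonneg (sq_nonneg _)]
  exact hb β q ⟨hq.1.le, hq.2⟩

lemma GFP.int {A : Measure (ℝ × Td d)} {β μ₀ μ₁} (G : GFP A β μ₀ μ₁) {φ : ℝ → Vd d → ℝ}
    (h : IsTestFun φ) : Integrable (Lop φ β) A := by
  have := G.finA
  exact ((memLp_two_iff_integrable_sq (Lop_meas h G.meas).aestronglyMeasurable).2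
    (G.int_sq h)).integrable (by norm_num)

lemma IsTestFun.cs_slice {φ : ℝ → Vd d → ℝ} (h : IsTestFun φ) (s : ℝ) :
    Continuous fun y : Td d => φ s (secT y) :=
  h.cs_val.comp (continuous_const.prodMk continuous_id)

lemma cont_int {f : Td d → ℝ} (hf : Continuous f) (μ : Measure (Td d)) [IsFiniteMeasure μ] :
    Integrable f μ := by
  obtain ⟨C, hC⟩ := isCompact_univ.exists_bound_of_continuousOn hf.continuousOn
  exact Integrable.mono' (integrable_const C) hf.measurable.aestronglyMeasurable
    (Eventually.of_forall fun y => hC y (mem_univ _))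

/-! algebra of test functions -/
lemma lapl_hasD2 {g : Vd d → ℝ} (hg : ContDiff ℝ 2 g) (x v : Vd d) :
    HasFDerivAt (fun y => fderiv ℝ g y v) (fderiv ℝ (fun y => fderiv ℝ g y v) x) x :=
  (((hg.fderiv_right (m := 1) (by norm_num)).clm_apply contDiff_const).differentiable
    (by norm_num) x).hasFDerivAt

lemma gradv_add {f g : Vd d → ℝ} (hf : ContDiff ℝ 2 f) (hg : ContDiff ℝ 2 g) (x : Vd d) :
    gradv (f + g) x = gradv f x + gradv g x := by
  funext i
  simp only [gradv, Pi.add_apply]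
  rw [fderiv_add (hf.differentiable (by norm_num) x) (hg.differentiable (by norm_num) x)]; rfl

lemma lapl_add {f g : Vd d → ℝ} (hf : ContDiff ℝ 2 f) (hg : ContDiff ℝ 2 g) (x : Vd d) :
    lapl (f + g) x = lapl f x + lapl g x := by
  simp only [lapl, ← Finset.sum_add_distrib]
  refine Finset.sum_congr rfl fun i _ => ?_
  simp only [D2]
  have : (fun y => fderiv ℝ (f + g) y (Pi.single i 1)) =
      fun y => fderiv ℝ f y (Pi.single i 1) + fderiv ℝ g y (Pi.single i 1) := by
    funext y
    rw [fderiv_add (hf.differentiable (by norm_num) y) (hg.differentiable (by norm_num) y)]; rfl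
  rw [this, ((lapl_hasD2 hf x _).fun_add (lapl_hasD2 hg x _)).fderiv]; rfl

lemma Lop_add {φ ψ : ℝ → Vd d → ℝ} (hφ : IsTestFun φ) (hψ : IsTestFun ψ) (β : ℝ × Td d → Vd d)
    (q : ℝ × Td d) : Lop (φ + ψ) β q = Lop φ β q + Lop ψ β q := by
  have h1 : tderiv (φ + ψ) q.1 (secT q.2) = tderiv φ q.1 (secT q.2) + tderiv ψ q.1 (secT q.2) :=
    (((hφ.tder q.1 (secT q.2)).differentiableAt.hasDerivAt).add
      ((hψ.tder q.1 (secT q.2)).differentiableAt.hasDerivAt)).deriv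
  simp only [Lop, h1, Pi.add_apply, lapl_add (hφ.xsmooth q.1) (hψ.xsmooth q.1),
    gradv_add (hφ.xsmooth q.1) (hψ.xsmooth q.1), dotp, mul_add, Finset.sum_add_distrib]
  ring

lemma IsTestFun.comp {φ : ℝ → Vd d → ℝ} (h : IsTestFun φ) {B : ℝ → ℝ} (hB : ContDiff ℝ 2 B) :
    IsTestFun (fun s x => B (φ s x)) :=
  ⟨hB.comp h.1, fun s x z => by simp only [h.2]⟩

lemma Lop_comp {φ : ℝ → Vd d → ℝ} (h : IsTestFun φ) {B B1 B2 : ℝ → ℝ}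
    (h1 : ∀ r, HasDerivAt B (B1 r) r) (h2 : ∀ r, HasDerivAt B1 (B2 r) r)
    (β : ℝ × Td d → Vd d) (q : ℝ × Td d) :
    Lop (fun s x => B (φ s x)) β q = B1 (φ q.1 (secT q.2)) * Lop φ β q +
      B2 (φ q.1 (secT q.2)) * sqnorm (gradv (φ q.1) (secT q.2)) := by
  have hf : ∀ y, HasFDerivAt (fun x => B (φ q.1 x)) (B1 (φ q.1 y) • fderiv ℝ (φ q.1) y) y :=
    fun y => (h1 _).comp_hasFDerivAt y (((h.xsmooth q.1).differentiable (by norm_num) y).hasFDerivAt)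
  have ht : tderiv (fun s x => B (φ s x)) q.1 (secT q.2) =
      B1 (φ q.1 (secT q.2)) * tderiv φ q.1 (secT q.2) := by
    have := (h1 (φ q.1 (secT q.2))).comp q.1 (h.tder q.1 (secT q.2)).differentiableAt.hasDerivAt
    exact this.deriv
  have hD : ∀ v, D2 (fun x => B (φ q.1 x)) (secT q.2) v v = B1 (φ q.1 (secT q.2)) *
      D2 (φ q.1) (secT q.2) v v + B2 (φ q.1 (secT q.2)) * (fderiv ℝ (φ q.1) (secT q.2) v) ^ 2 := by
    intro v
    simp only [D2]
    have e : (fun y => fderiv ℝ (fun x => B (φ q.1 x)) y v) =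
        fun y => B1 (φ q.1 y) * fderiv ℝ (φ q.1) y v := by
      funext y; rw [(hf y).fderiv]; rfl
    have g1 : HasFDerivAt (fun x => B1 (φ q.1 x)) _ (secT q.2) :=
      (h2 _).comp_hasFDerivAt (secT q.2)
        (((h.xsmooth q.1).differentiable (by norm_num) (secT q.2)).hasFDerivAt)
    rw [e, (g1.fun_mul (lapl_hasD2 (h.xsmooth q.1) (secT q.2) v)).fderiv]
    simp; ring
  have hg : ∀ v, fderiv ℝ (fun x => B (φ q.1 x)) (secT q.2) v =
      B1 (φ q.1 (secT q.2)) * fderiv ℝ (φ q.1) (secT q.2) v := by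
    intro v; rw [(hf _).fderiv]; rfl
  simp only [Lop, ht, lapl, hD, hg, dotp, sqnorm, gradv, Finset.sum_add_distrib, ← Finset.mul_sum]
  have : ∑ x, β q x * (B1 (φ q.1 (secT q.2)) * fderiv ℝ (φ q.1) (secT q.2) (Pi.single x 1)) =
      B1 (φ q.1 (secT q.2)) * ∑ x, β q x * fderiv ℝ (φ q.1) (secT q.2) (Pi.single x 1) := by
    rw [Finset.mul_sum]; exact Finset.sum_congr rfl fun i _ => by ring
  rw [this]; ring

lemma Lop_smul {φ : ℝ → Vd d → ℝ} (h : IsTestFun φ) (c : ℝ) (β : ℝ × Td d → Vd d)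
    (q : ℝ × Td d) : Lop (c • φ) β q = c * Lop φ β q := by
  have := Lop_comp h (B := fun r => c * r) (B1 := fun _ => c) (B2 := fun _ => 0)
    (fun r => by simpa using (hasDerivAt_id r).const_mul c) (fun r => hasDerivAt_const r c) β q
  simp only [zero_mul, add_zero] at this
  exact this

/-- comparison -/
lemma GFP.compare {A : Measure (ℝ × Td d)} {β μ₀ μ₁} (G : GFP A β μ₀ μ₁) {φ : ℝ → Vd d → ℝ}
    (h : IsTestFun φ) : ∫ y, max (φ 0 (secT y)) 0 ∂μ₀ ≤
      (∫ q, max (-Lop φ β q) 0 ∂A) + ∫ y, max (φ 1 (secT y)) 0 ∂μ₁ := by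
  have := G.finA; have := G.fin0; have := G.fin1
  refine le_of_forall_pos_le_add fun e he => ?_
  obtain ⟨δ, hδ, hδe⟩ : ∃ δ > 0, δ * μ₁.real univ ≤ e :=
    ⟨e / (μ₁.real univ + 1), by positivity, by
      rw [div_mul_eq_mul_div, div_le_iff₀ (by positivity)]
      nlinarith [measureReal_nonneg (μ := μ₁) (s := univ)]⟩
  let R : ℝ → ℝ := fun r => √(r ^ 2 + δ ^ 2)
  have hRp : ∀ r, 0 < r ^ 2 + δ ^ 2 := fun r => by positivity
  have hR0 : ∀ r, 0 < R r := fun r => Real.sqrt_pos.2 (hRp r)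
  have hR2 : ∀ r, R r ^ 2 = r ^ 2 + δ ^ 2 := fun r => Real.sq_sqrt (hRp r).le
  let B : ℝ → ℝ := fun r => (r + R r) / 2
  have hRd : ∀ r, HasDerivAt R (r / R r) r := fun r => by
    have h1 : HasDerivAt (fun r : ℝ => r ^ 2 + δ ^ 2) (2 * r) r := by
      simpa using (hasDerivAt_pow 2 r).add_const (δ ^ 2)
    convert h1.sqrt (hRp r).ne' using 1
    change r / R r = 2 * r / (2 * R r)
    rw [mul_div_mul_left _ _ two_ne_zero]
  have hB1 : ∀ r, HasDerivAt B ((1 + r / R r) / 2) r := fun r =>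
    ((hasDerivAt_id r).add (hRd r)).div_const 2
  have hB2 : ∀ r, HasDerivAt (fun r => (1 + r / R r) / 2) (δ ^ 2 / R r ^ 3 / 2) r := fun r => by
    have := ((((hasDerivAt_id r).div (hRd r) (hR0 r).ne').const_add 1).div_const 2)
    refine this.congr_deriv ?_
    have h0 := hR0 r
    have h2 := hR2 r
    change (1 * R r - r * (r / R r)) / R r ^ 2 / 2 = δ ^ 2 / R r ^ 3 / 2
    field_simp
    linarith
  have hBs : ContDiff ℝ 2 B := by
    refine ((contDiff_id.add (ContDiff.sqrt ?_ fun r => (hRp r).ne')).div_const 2)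
    exact (contDiff_id.pow 2).add contDiff_const
  have hle : ∀ r, max r 0 ≤ B r := fun r => by
    have : |r| ≤ R r := by
      rw [← Real.sqrt_sq_eq_abs]; exact Real.sqrt_le_sqrt (by nlinarith)
    have h1 := neg_abs_le r; have h2 := le_abs_self r
    refine max_le ?_ ?_ <;> simp only [B] <;> linarith
  have hge : ∀ r, B r ≤ max r 0 + δ := fun r => by
    have : R r ≤ |r| + δ := by
      refine Real.sqrt_le_iff.2 ⟨by positivity, ?_⟩
      nlinarith [abs_nonneg r, sq_abs r]
    have h1 := le_max_left r 0; have h2 := le_max_right r 0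
    simp only [B]
    rcases abs_cases r with ⟨h3, _⟩ | ⟨h3, _⟩ <;> linarith
  have hD : ∀ r, 0 ≤ (1 + r / R r) / 2 ∧ (1 + r / R r) / 2 ≤ 1 := fun r => by
    have h1 : |r / R r| ≤ 1 := by
      rw [abs_div, abs_of_pos (hR0 r), div_le_one (hR0 r), ← Real.sqrt_sq_eq_abs]
      exact Real.sqrt_le_sqrt (by nlinarith)
    have := abs_le.1 h1
    constructor <;> linarith
  have hT := h.comp hBs
  have hfp := G.fp _ hT
  have i0 := cont_int (hT.cs_slice 0) μ₀
  have i1 := cont_int (hT.cs_slice 1) μ₁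
  have j1 := (cont_int (h.cs_slice 1) μ₁).pos_part
  have k1 : ∫ y, max (φ 0 (secT y)) 0 ∂μ₀ ≤ ∫ y, B (φ 0 (secT y)) ∂μ₀ :=
    integral_mono (cont_int (h.cs_slice 0) μ₀).pos_part i0 fun y => hle _
  have k2 : ∫ y, B (φ 1 (secT y)) ∂μ₁ ≤ (∫ y, max (φ 1 (secT y)) 0 ∂μ₁) + δ * μ₁.real univ := by
    have : (∫ y, max (φ 1 (secT y)) 0 ∂μ₁) + δ * μ₁.real univ =
        ∫ y, (max (φ 1 (secT y)) 0 + δ) ∂μ₁ := by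
      rw [integral_add j1 (integrable_const _)]; simp [mul_comm]
    rw [this]
    exact integral_mono i1 (j1.add (integrable_const _)) fun y => hge _
  have k3 : -∫ q, max (-Lop φ β q) 0 ∂A ≤ ∫ q, Lop (fun s x => B (φ s x)) β q ∂A := by
    rw [← integral_neg]
    refine integral_mono ((G.int h).neg.pos_part.neg) (G.int hT) fun q => ?_
    dsimp only
    rw [Lop_comp h hB1 hB2]
    have a1 := hD (φ q.1 (secT q.2))
    have a2 : 0 ≤ δ ^ 2 / R (φ q.1 (secT q.2)) ^ 3 / 2 *
        sqnorm (gradv (φ q.1) (secT q.2)) :=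
      mul_nonneg (by have := hR0 (φ q.1 (secT q.2)); positivity) (sqnorm_nonneg _)
    have a3 := le_max_left (-Lop φ β q) 0
    have a4 := le_max_right (-Lop φ β q) 0
    nlinarith [mul_nonneg a1.1 (sub_nonneg.2 a3), mul_nonneg (sub_nonneg.2 a1.2) a4]
  linarith
end gfp
end partC

section partD
open scoped Topology

section wdens
variable {X : Type*} [MeasurableSpace X]

def wd (μ : Measure X) (f : X → ℝ) : Measure X := μ.withDensity fun x => ENNReal.ofReal (f x)

lemma wd_int {μ : Measure X} {f : X → ℝ} (hf : Measurable f) (h0 : ∀ x, 0 ≤ f x) (g : X → ℝ) :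
    ∫ x, g x ∂(wd μ f) = ∫ x, f x * g x ∂μ := by
  unfold wd
  rw [integral_withDensity_eq_integral_toReal_smul hf.ennreal_ofReal
    (Eventually.of_forall fun x => ENNReal.ofReal_lt_top)]
  simp [ENNReal.toReal_ofReal (h0 _)]

lemma wd_le {μ : Measure X} {f : X → ℝ} (h1 : ∀ x, f x ≤ 1) : wd μ f ≤ μ := by
  have := withDensity_mono (μ := μ) (f := fun x => ENNReal.ofReal (f x)) (g := 1)
    (Eventually.of_forall fun x => by simpa using ENNReal.ofReal_le_one.2 (h1 x))
  rwa [withDensity_one] at this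

lemma wd_fin {μ : Measure X} [IsFiniteMeasure μ] {f : X → ℝ} (h1 : ∀ x, f x ≤ 1) :
    IsFiniteMeasure (wd μ f) := isFiniteMeasure_of_le μ (wd_le h1)

lemma wd_compl {μ : Measure X} {f : X → ℝ} (hf : Measurable f) (h0 : ∀ x, 0 ≤ f x ∧ f x ≤ 1) :
    wd μ f + wd μ (fun x => 1 - f x) = μ := by
  unfold wd
  rw [← withDensity_add_left hf.ennreal_ofReal]
  conv_rhs => rw [← withDensity_one (μ := μ)]
  congr 1; funext x
  simp only [Pi.add_apply]
  rw [← ENNReal.ofReal_add (h0 x).1 (by linarith [(h0 x).2])]; simp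

lemma exists_split (A B : Measure X) [IsFiniteMeasure A] [IsFiniteMeasure B] :
    ∃ w : X → ℝ, Measurable w ∧ (∀ x, 0 ≤ w x ∧ w x ≤ 1) ∧ A = wd (A + B) w ∧
      B = wd (A + B) (fun x => 1 - w x) := by
  have hle : A ≤ A + B := Measure.le_add_right le_rfl
  have hac : A ≪ A + B := hle.absolutelyContinuous
  let r := A.rnDeriv (A + B)
  have hr : (A + B).withDensity r = A := Measure.withDensity_rnDeriv_eq _ _ hac
  have hrm : Measurable r := Measure.measurable_rnDeriv _ _
  have h1 : r ≤ᵐ[A + B] fun _ => 1 := by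
    refine ae_le_of_forall_setLIntegral_le_of_sigmaFinite hrm fun s hs _ => ?_
    rw [← withDensity_apply _ hs, hr]
    simpa using hle s
  have hwm : Measurable (fun x => min 1 (r x).toReal) := measurable_const.min hrm.ennreal_toReal
  have h01 : ∀ x, 0 ≤ min 1 (r x).toReal ∧ min 1 (r x).toReal ≤ 1 := fun x =>
    ⟨le_min zero_le_one ENNReal.toReal_nonneg, min_le_left _ _⟩
  have hA : wd (A + B) (fun x => min 1 (r x).toReal) = A := by
    conv_rhs => rw [← hr]
    refine withDensity_congr_ae ?_
    filter_upwards [h1] with x hx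
    rw [min_eq_right (by simpa using ENNReal.toReal_mono ENNReal.one_ne_top hx),
      ENNReal.ofReal_toReal (ne_top_of_le_ne_top ENNReal.one_ne_top hx)]
  refine ⟨fun x => min 1 (r x).toReal, hwm, h01, hA.symm, ?_⟩
  have hc := wd_compl (μ := A + B) hwm h01
  rw [hA] at hc
  ext s hs
  have := congrArg (fun m : Measure X => m s) hc
  simp only [Measure.add_apply] at this
  exact ((ENNReal.add_right_inj (measure_ne_top A s)).1 this).symm

lemma wd_integrable {μ : Measure X} {f : X → ℝ} (h1 : ∀ x, f x ≤ 1) {g : X → ℝ}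
    (hg : Integrable g μ) : Integrable g (wd μ f) := hg.mono_measure (wd_le h1)

lemma wd_integrable' {μ : Measure X} {f : X → ℝ} (hf : Measurable f) (h0 : ∀ x, 0 ≤ f x)
    {g : X → ℝ} : Integrable g (wd μ f) ↔ Integrable (fun x => f x * g x) μ := by
  unfold wd
  rw [integrable_withDensity_iff_integrable_smul' hf.ennreal_ofReal
    (Eventually.of_forall fun x => ENNReal.ofReal_lt_top)]
  simp [ENNReal.toReal_ofReal (h0 _)]
end wdens

section ops
variable {d : ℕ}

def testSub (d : ℕ) : Submodule ℝ (ℝ → Vd d → ℝ) where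
  carrier := {φ | IsTestFun φ}
  add_mem' := fun {a b} ha hb => ⟨ha.1.add hb.1, fun t x z => by simp [ha.2, hb.2]⟩
  zero_mem' := ⟨contDiff_const, fun _ _ _ => rfl⟩
  smul_mem' := fun c a ha => by
    refine ⟨?_, fun t x z => by simp [ha.2]⟩
    have h : ContDiff ℝ 2 (fun q : ℝ × Vd d => a q.1 q.2) := ha.1
    exact (contDiff_const (c := c)).mul h

lemma GFP.wd_of {A : Measure (ℝ × Td d)} {β μ₀ μ₁} (G : GFP A β μ₀ μ₁) {f : ℝ × Td d → ℝ}
    {g f₁ : Td d → ℝ} (hf : Measurable f) (hg : Measurable g) (hf₁ : Measurable f₁)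
    (h0 : ∀ x, 0 ≤ f x ∧ f x ≤ 1) (g0 : ∀ x, 0 ≤ g x ∧ g x ≤ 1) (f0 : ∀ x, 0 ≤ f₁ x ∧ f₁ x ≤ 1)
    (h : ∀ φ, IsTestFun φ → (∫ y, f₁ y * φ 1 (secT y) ∂μ₁) - (∫ y, g y * φ 0 (secT y) ∂μ₀) =
      ∫ q, f q * Lop φ β q ∂A) : GFP (wd A f) β (wd μ₀ g) (wd μ₁ f₁) := by
  have := G.finA; have := G.fin0; have := G.fin1
  refine ⟨wd_fin fun x => (h0 x).2, wd_fin fun x => (g0 x).2, wd_fin fun x => (f0 x).2,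
    (wd_le (fun x => (h0 x).2)).absolutelyContinuous.ae_le G.supp, G.meas,
    wd_integrable (fun x => (h0 x).2) G.l2, fun φ hφ => ?_⟩
  rw [wd_int hf fun x => (h0 x).1, wd_int hg fun x => (g0 x).1, wd_int hf₁ fun x => (f0 x).1]
  exact h φ hφ

lemma int_mul01 {X : Type*} [MeasurableSpace X] {μ : Measure X} {f g : X → ℝ} (hf : Measurable f)
    (h0 : ∀ x, 0 ≤ f x ∧ f x ≤ 1) (hg : Integrable g μ) : Integrable (fun x => f x * g x) μ :=
  hg.bdd_mul (c := 1) hf.aestronglyMeasurable (Eventually.of_forall fun x => by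
        rw [Real.norm_eq_abs, abs_of_nonneg (h0 _).1]; exact (h0 _).2)

lemma GFP.decomp {A : Measure (ℝ × Td d)} {β μ₀ μ₁} (G : GFP A β μ₀ μ₁)
    {g : Td d → ℝ} (hg : Measurable g) (g0 : ∀ x, 0 ≤ g x ∧ g x ≤ 1) :
    ∃ (f : ℝ × Td d → ℝ) (f₁ : Td d → ℝ), Measurable f ∧ Measurable f₁ ∧
      (∀ x, 0 ≤ f x ∧ f x ≤ 1) ∧ (∀ x, 0 ≤ f₁ x ∧ f₁ x ≤ 1) ∧
      GFP (wd A f) β (wd μ₀ g) (wd μ₁ f₁) ∧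
      GFP (wd A fun x => 1 - f x) β (wd μ₀ fun x => 1 - g x) (wd μ₁ fun x => 1 - f₁ x) := by
  have := G.finA; have := G.fin0; have := G.fin1
  have i0 : ∀ φ : testSub d, Integrable (fun y => φ.1 0 (secT y)) μ₀ := fun φ =>
    cont_int (φ.2.cs_slice 0) μ₀
  have i1 : ∀ φ : testSub d, Integrable (fun y => φ.1 1 (secT y)) μ₁ := fun φ =>
    cont_int (φ.2.cs_slice 1) μ₁
  let l : testSub d →ₗ[ℝ] ℝ :=
    { toFun := fun φ => ∫ y, g y * φ.1 0 (secT y) ∂μ₀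
      map_add' := fun φ ψ => by
        rw [← integral_add (int_mul01 hg g0 (i0 φ)) (int_mul01 hg g0 (i0 ψ))]
        simp [mul_add]
      map_smul' := fun c φ => by
        rw [RingHom.id_apply, smul_eq_mul, ← integral_const_mul]
        simp [mul_left_comm] }
  let T₁ : testSub d →ₗ[ℝ] ℝ × Td d → ℝ :=
    { toFun := fun φ q => -Lop φ.1 β q
      map_add' := fun φ ψ => by
        funext q
        have := Lop_add φ.2 ψ.2 β q
        simp only [Submodule.coe_add, this, Pi.add_apply]; ring
      map_smul' := fun c φ => by
        funext q
        have := Lop_smul φ.2 c β q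
        simp only [Submodule.coe_smul, this, Pi.smul_apply, smul_eq_mul, RingHom.id_apply]; ring }
  let T₂ : testSub d →ₗ[ℝ] Td d → ℝ :=
    { toFun := fun φ y => φ.1 1 (secT y)
      map_add' := fun φ ψ => rfl
      map_smul' := fun c φ => rfl }
  obtain ⟨f, f₁, hf, hf₁, h0, f0, hl⟩ := riesz_two A μ₁ T₁ T₂ l
    (fun φ => (Lop_meas φ.2 G.meas).neg) (fun φ => (φ.2.cs_slice 1).measurable)
    (fun φ => by simpa [T₁] using G.int_sq φ.2)
    (fun φ => cont_int ((φ.2.cs_slice 1).pow 2) μ₁)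
    (fun φ => by
      refine le_trans ?_ (G.compare φ.2)
      refine integral_mono (int_mul01 hg g0 (i0 φ)) (i0 φ).pos_part fun y => ?_
      dsimp only
      have a1 := le_max_left (φ.1 0 (secT y)) 0
      have a2 := le_max_right (φ.1 0 (secT y)) 0
      nlinarith [mul_nonneg (g0 y).1 (sub_nonneg.2 a1), mul_nonneg (sub_nonneg.2 (g0 y).2) a2])
  have key : ∀ φ, IsTestFun φ → (∫ y, f₁ y * φ 1 (secT y) ∂μ₁) -
      (∫ y, g y * φ 0 (secT y) ∂μ₀) = ∫ q, f q * Lop φ β q ∂A := by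
    intro φ hφ
    have := hl ⟨φ, hφ⟩
    simp only [l, T₁, T₂, LinearMap.coe_mk, AddHom.coe_mk, mul_neg, integral_neg] at this
    linarith
  refine ⟨f, f₁, hf, hf₁, h0, f0, G.wd_of hf hg hf₁ h0 g0 f0 key,
    G.wd_of (measurable_const.sub hf) (measurable_const.sub hg) (measurable_const.sub hf₁)
      (fun x => ⟨by linarith [(h0 x).2], by linarith [(h0 x).1]⟩)
      (fun x => ⟨by linarith [(g0 x).2], by linarith [(g0 x).1]⟩)
      (fun x => ⟨by linarith [(f0 x).2], by linarith [(f0 x).1]⟩) fun φ hφ => ?_⟩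
  have e1 := key φ hφ
  have e2 := G.fp φ hφ
  simp only [sub_mul, one_mul]
  rw [integral_sub (i1 ⟨φ, hφ⟩) (int_mul01 hf₁ f0 (i1 ⟨φ, hφ⟩)),
    integral_sub (i0 ⟨φ, hφ⟩) (int_mul01 hg g0 (i0 ⟨φ, hφ⟩)),
    integral_sub (G.int hφ) (int_mul01 hf h0 (G.int hφ))]
  linarith

lemma GFP.smul {A : Measure (ℝ × Td d)} {β μ₀ μ₁} (G : GFP A β μ₀ μ₁) {c : ENNReal} (hc : c ≠ ⊤) :
    GFP (c • A) β (c • μ₀) (c • μ₁) := by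
  have := G.finA; have := G.fin0; have := G.fin1
  refine ⟨A.smul_finite hc, μ₀.smul_finite hc, μ₁.smul_finite hc,
    Measure.ae_smul_measure G.supp c, G.meas, G.l2.smul_measure hc, fun φ hφ => ?_⟩
  simp only [integral_smul_measure, smul_eq_mul]
  rw [← G.fp φ hφ]; ring

lemma sqnorm_convex {w : ℝ} (h : 0 ≤ w ∧ w ≤ 1) (a b : Vd d) :
    sqnorm (w • a + (1 - w) • b) ≤ w * sqnorm a + (1 - w) * sqnorm b := by
  simp only [sqnorm, Finset.mul_sum, ← Finset.sum_add_distrib]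
  refine Finset.sum_le_sum fun i _ => ?_
  simp only [Pi.add_apply, Pi.smul_apply, smul_eq_mul]
  nlinarith [mul_nonneg (mul_nonneg h.1 (sub_nonneg.2 h.2)) (sq_nonneg (a i - b i))]

lemma GFP.add {A A' : Measure (ℝ × Td d)} {β β' μ₀ μ₁ μ₀' μ₁'} (G : GFP A β μ₀ μ₁)
    (G' : GFP A' β' μ₀' μ₁') : ∃ γ, GFP (A + A') γ (μ₀ + μ₀') (μ₁ + μ₁') ∧
      ∀ h : ℝ × Td d → Vd d → ℝ, (∀ q, ConvexOn ℝ univ (h q)) → Integrable (fun q => h q (β q)) A →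
        Integrable (fun q => h q (β' q)) A' → Integrable (fun q => h q (γ q)) (A + A') →
        ∫ q, h q (γ q) ∂(A + A') ≤ (∫ q, h q (β q) ∂A) + ∫ q, h q (β' q) ∂A' := by
  have := G.finA; have := G.fin0; have := G.fin1
  have := G'.finA; have := G'.fin0; have := G'.fin1
  obtain ⟨w, hw, w0, e1, e2⟩ := exists_split A A'
  set M := A + A' with hM
  have w0' : ∀ x, 0 ≤ 1 - w x ∧ 1 - w x ≤ 1 :=
    fun x => ⟨by linarith [(w0 x).2], by linarith [(w0 x).1]⟩
  have hw' : Measurable fun x => 1 - w x := measurable_const.sub hw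
  have I1 : ∀ u : ℝ × Td d → ℝ, ∫ q, u q ∂A = ∫ q, w q * u q ∂M := fun u => by
    conv_lhs => rw [e1]
    exact wd_int hw (fun x => (w0 x).1) u
  have I2 : ∀ u : ℝ × Td d → ℝ, ∫ q, u q ∂A' = ∫ q, (1 - w q) * u q ∂M := fun u => by
    conv_lhs => rw [e2]
    exact wd_int hw' (fun x => (w0' x).1) u
  have J1 : ∀ u : ℝ × Td d → ℝ, Integrable u A → Integrable (fun q => w q * u q) M := fun u hu => by
    rw [e1] at hu
    exact (wd_integrable' hw fun x => (w0 x).1).1 hu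
  have J2 : ∀ u : ℝ × Td d → ℝ, Integrable u A' → Integrable (fun q => (1 - w q) * u q) M :=
    fun u hu => by
      rw [e2] at hu
      exact (wd_integrable' hw' fun x => (w0' x).1).1 hu
  have hγ : Measurable fun q => w q • β q + (1 - w q) • β' q :=
    (hw.smul G.meas).add (hw'.smul G'.meas)
  refine ⟨fun q => w q • β q + (1 - w q) • β' q, ⟨inferInstance, inferInstance, inferInstance,
    ae_add_measure_iff.2 ⟨G.supp, G'.supp⟩, hγ, ?_, fun φ hφ => ?_⟩, fun h hc i1 i2 i3 => ?_⟩
  · refine Integrable.mono' ((J1 _ G.l2).add (J2 _ G'.l2))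
      (continuous_sqnorm.measurable.comp hγ).aestronglyMeasurable (Eventually.of_forall fun q => ?_)
    rw [Real.norm_eq_abs, abs_of_nonneg (sqnorm_nonneg _)]
    exact sqnorm_convex (w0 q) _ _
  · rw [integral_add_measure (cont_int (hφ.cs_slice 1) _) (cont_int (hφ.cs_slice 1) _),
      integral_add_measure (cont_int (hφ.cs_slice 0) _) (cont_int (hφ.cs_slice 0) _)]
    have : ∫ q, Lop φ (fun q => w q • β q + (1 - w q) • β' q) q ∂M =
        (∫ q, w q * Lop φ β q ∂M) + ∫ q, (1 - w q) * Lop φ β' q ∂M := by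
      rw [← integral_add (J1 _ (G.int hφ)) (J2 _ (G'.int hφ))]
      refine integral_congr_ae (Eventually.of_forall fun q => ?_)
      simp only [Lop, dotp, Pi.add_apply, Pi.smul_apply, smul_eq_mul, add_mul,
        Finset.sum_add_distrib, mul_assoc, ← Finset.mul_sum]
      ring
    rw [this, ← I1, ← I2, ← G.fp φ hφ, ← G'.fp φ hφ]; ring
  · rw [I1, I2, ← integral_add (J1 _ i1) (J2 _ i2)]
    refine integral_mono i3 ((J1 _ i1).add (J2 _ i2)) fun q => ?_
    exact (hc q).2 (mem_univ _) (mem_univ _) (w0 q).1 (w0' q).1 (by ring)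

end ops
end partD

section partE
open scoped Topology

section transl
variable {d : ℕ}

def shiftM (Z : Vd d) (q : ℝ × Td d) : ℝ × Td d := (q.1, q.2 + piT ((1 - q.1) • Z))

lemma continuous_shiftM (Z : Vd d) : Continuous (shiftM Z) :=
  continuous_fst.prodMk (continuous_snd.add (continuous_piT.comp
    ((continuous_const.sub continuous_fst).smul continuous_const)))

lemma piT_neg (x : Vd d) : piT (-x) = -piT x := by funext i; simp [piT]
lemma piT_zero : piT (0 : Vd d) = 0 := by funext i; simp [piT]

def unshiftM (Z : Vd d) (q : ℝ × Td d) : ℝ × Td d := (q.1, q.2 - piT ((1 - q.1) • Z))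
lemma continuous_unshiftM (Z : Vd d) : Continuous (unshiftM Z) :=
  continuous_fst.prodMk (continuous_snd.sub (continuous_piT.comp
    ((continuous_const.sub continuous_fst).smul continuous_const)))
lemma unshift_shift (Z : Vd d) (q) : unshiftM Z (shiftM Z q) = q := by
  simp [unshiftM, shiftM]

lemma test_shift {φ : ℝ → Vd d → ℝ} (h : IsTestFun φ) (Z : Vd d) :
    IsTestFun (fun s x => φ s (x + (1 - s) • Z)) := by
  refine ⟨?_, fun t x z => ?_⟩
  · have : ContDiff ℝ 2 fun q : ℝ × Vd d => (q.1, q.2 + (1 - q.1) • Z) :=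
      contDiff_fst.prodMk (contDiff_snd.add ((contDiff_const.sub contDiff_fst).smul contDiff_const))
    exact h.1.comp this
  · show φ t (x + intVec z + (1 - t) • Z) = _
    rw [add_right_comm, h.2]

lemma fderiv_eq_dotp (L : Vd d →L[ℝ] ℝ) (v : Vd d) : L v = dotp v fun i => L (Pi.single i 1) := by
  conv_lhs => rw [pi_eq_sum_univ' v]
  simp only [map_sum, map_smul, smul_eq_mul, dotp]

lemma Lop_shift {φ : ℝ → Vd d → ℝ} (h : IsTestFun φ) (Z : Vd d) (β : ℝ × Td d → Vd d)
    (q : ℝ × Td d) : Lop (fun s x => φ s (x + (1 - s) • Z)) β q =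
      Lop φ (fun q' => β (unshiftM Z q') + Z) (shiftM Z q) := by
  obtain ⟨s, y⟩ := q
  have e1 : ∀ g : Vd d → ℝ, gradv (fun x => g (x + (1 - s) • Z)) (secT y) =
      gradv g (secT y + (1 - s) • Z) := fun g => by
    funext i; simp only [gradv]; rw [fderiv_comp_add_right]
  have e2 : ∀ g : Vd d → ℝ, lapl (fun x => g (x + (1 - s) • Z)) (secT y) =
      lapl g (secT y + (1 - s) • Z) := fun g => by
    simp only [lapl, D2, fderiv_comp_add_right]
    refine Finset.sum_congr rfl fun i _ => ?_
    rw [fderiv_comp_add_right (f := fun x => fderiv ℝ g x (Pi.single i 1))]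
  have e3 : tderiv (fun s x => φ s (x + (1 - s) • Z)) s (secT y) =
      tderiv φ s (secT y + (1 - s) • Z) - dotp Z (gradv (φ s) (secT y + (1 - s) • Z)) := by
    have h1 : HasFDerivAt (fun q : ℝ × Vd d => φ q.1 q.2) _ (s, secT y + (1 - s) • Z) :=
      (h.1.differentiable (by norm_num) _).hasFDerivAt
    have h2 : HasDerivAt (fun r : ℝ => (r, secT y + (1 - r) • Z)) ((1:ℝ), -Z) s := by
      refine (hasDerivAt_id s).prodMk ?_
      have := (((hasDerivAt_id s).const_sub 1).smul_const Z).const_add (secT y)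
      simpa using this
    have h3 := h1.comp_hasDerivAt s h2
    have h4 : ((1:ℝ), -Z) = (1, 0) - (0, Z) := by simp
    rw [h4, map_sub, ← h.fderiv_x, fderiv_eq_dotp] at h3
    rw [show tderiv φ s (secT y + (1 - s) • Z) = _ from (h.tder s _).deriv]
    exact h3.deriv
  have p1 : tderiv φ s (secT (y + piT ((1 - s) • Z))) = tderiv φ s (secT y + (1 - s) • Z) :=
    per_sec_add (g := tderiv φ s) (fun x z => by simp only [tderiv, h.2]) _ _
  have p2 : lapl (φ s) (secT (y + piT ((1 - s) • Z))) = lapl (φ s) (secT y + (1 - s) • Z) :=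
    per_sec_add (g := lapl (φ s)) (lapl_per (h.2 s)) _ _
  have p3 : gradv (φ s) (secT (y + piT ((1 - s) • Z))) = gradv (φ s) (secT y + (1 - s) • Z) :=
    per_sec_add (g := gradv (φ s)) (gradv_per (h.2 s)) _ _
  simp only [Lop, unshift_shift]
  simp only [shiftM, e1, e2, e3, p1, p2, p3]
  simp only [dotp, Pi.add_apply, add_mul, Finset.sum_add_distrib]; ring

lemma GFP.shift {A : Measure (ℝ × Td d)} {β μ₀ μ₁} (G : GFP A β μ₀ μ₁) (Z : Vd d) :
    GFP (A.map (shiftM Z)) (fun q' => β (unshiftM Z q') + Z) (μ₀.map (· + piT Z)) μ₁ := by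
  have := G.finA; have := G.fin0; have := G.fin1
  have mS := (continuous_shiftM Z).measurable
  have hm : Measurable (fun q' => β (unshiftM Z q') + Z) :=
    (G.meas.comp (continuous_unshiftM Z).measurable).add_const Z
  refine ⟨inferInstance, inferInstance, inferInstance, ?_, hm, ?_, fun φ hφ => ?_⟩
  · rw [ae_map_iff mS.aemeasurable (measurable_fst measurableSet_Ioc)]; exact G.supp
  · have hs : Measurable fun q => sqnorm (β (unshiftM Z q) + Z) := continuous_sqnorm.measurable.comp hm
    rw [integrable_map_measure hs.aestronglyMeasurable mS.aemeasurable]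
    refine Integrable.mono' ((G.l2.const_mul 2).add (integrable_const (2 * sqnorm Z)))
      (continuous_sqnorm.measurable.comp (hm.comp mS)).aestronglyMeasurable
      (Eventually.of_forall fun q => ?_)
    simp only [Function.comp, unshift_shift, Real.norm_eq_abs, abs_of_nonneg (sqnorm_nonneg _),
      Pi.add_apply]
    simp only [sqnorm, Finset.mul_sum, ← Finset.sum_add_distrib, Pi.add_apply]
    exact Finset.sum_le_sum fun i _ => by nlinarith [sq_nonneg (β q i - Z i)]
  · have h := G.fp _ (test_shift hφ Z)
    simp only [Lop_shift hφ] at h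
    rw [integral_map mS.aemeasurable (Lop_meas hφ hm).aestronglyMeasurable, ← h,
      integral_map (measurable_add_const (piT Z)).aemeasurable
        (hφ.cs_slice 0).measurable.aestronglyMeasurable]
    congr 1
    · simp
    · refine integral_congr_ae (Eventually.of_forall fun y => ?_)
      have := per_sec_add (g := φ 0) (hφ.2 0) y Z
      simpa using this

/-! stationary -/
lemma int_deriv_zero {g : Vd d → ℝ} (hg : ContDiff ℝ 1 g)
    (hp : ∀ x (z : Fin d → ℤ), g (x + intVec z) = g x) (v : Vd d) :
    ∫ y : Td d, fderiv ℝ g (secT y) v = 0 := by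
  have hc : Continuous fun x => fderiv ℝ g x v := (hg.continuous_fderiv (by norm_num)).clm_apply continuous_const
  have hp' : ∀ x (z : Fin d → ℤ), fderiv ℝ g (x + intVec z) v = fderiv ℝ g x v := fun x z => by
    rw [fderiv_per hp]
  have cT : Continuous fun y : Td d => fderiv ℝ g (secT y) v := cont_sec1 hc hp'
  have key : ∀ y : Td d, ∫ r in (0:ℝ)..1, fderiv ℝ g (secT (y + piT (r • v))) v =
      g (secT (y + piT v)) - g (secT y) := by
    intro y
    have : ∀ r ∈ uIcc (0:ℝ) 1, HasDerivAt (fun r : ℝ => g (secT y + r • v))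
        (fderiv ℝ g (secT (y + piT (r • v))) v) r := fun r _ => by
      rw [per_sec_add (g := fun x => fderiv ℝ g x v) hp']
      have h1 : HasFDerivAt g _ (secT y + r • v) :=
        (hg.differentiable (by norm_num) _).hasFDerivAt
      have h2 : HasDerivAt (fun r : ℝ => secT y + r • v) v r := by
        simpa using ((hasDerivAt_id r).smul_const v).const_add (secT y)
      exact h1.comp_hasDerivAt r h2
    rw [intervalIntegral.integral_eq_sub_of_hasDerivAt this]
    · rw [per_sec_add (g := g) hp]; simp
    · refine Continuous.intervalIntegrable ?_ _ _
      exact cT.comp (continuous_const.add (continuous_piT.comp (continuous_id.smul continuous_const)))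
  have cg : Continuous fun y : Td d => g (secT y) := cont_sec1 hg.continuous hp
  have h0 : ∫ y : Td d, (g (secT (y + piT v)) - g (secT y)) = 0 := by
    rw [integral_sub (cont_int (f := fun y => g (secT (y + piT v))) (cg.comp (continuous_id.add continuous_const)) _) (cont_int cg _),
      integral_add_right_eq_self (fun y => g (secT y))]; simp
  simp only [← key] at h0
  rw [← intervalIntegral_integral_swap] at h0
  · simp only [integral_add_right_eq_self (fun y => fderiv ℝ g (secT y) v)] at h0
    simpa using h0
  · have : Continuous (Function.uncurry fun (r : ℝ) (y : Td d) => fderiv ℝ g (secT (y + piT (r • v))) v) :=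
      cT.comp (continuous_snd.add (continuous_piT.comp (continuous_fst.smul continuous_const)))
    obtain ⟨C, hC, hb⟩ := bdd_strip this
    rw [uIoc_of_le zero_le_one]
    refine Integrable.mono' (integrable_const C) this.measurable.aestronglyMeasurable ?_
    have : ∀ᵐ q ∂((volume.restrict (Ioc (0:ℝ) 1)).prod (volume : Measure (Td d))), q.1 ∈ Ioc (0:ℝ) 1 :=
      Measure.quasiMeasurePreserving_fst.ae (ae_restrict_mem measurableSet_Ioc)
    filter_upwards [this] with q hq
    exact hb q.1 ⟨hq.1.le, hq.2⟩ q.2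

abbrev I01 : Measure ℝ := volume.restrict (Ioc (0:ℝ) 1)

lemma I01_prod_supp (μ : Measure (Td d)) [SFinite μ] : ∀ᵐ q ∂(I01.prod μ), q.1 ∈ Ioc (0:ℝ) 1 :=
  Measure.quasiMeasurePreserving_fst.ae (ae_restrict_mem measurableSet_Ioc)

lemma cont_int2 {f : ℝ × Td d → ℝ} (hf : Continuous f) (A : Measure (ℝ × Td d)) [IsFiniteMeasure A]
    (hA : ∀ᵐ q ∂A, q.1 ∈ Ioc (0:ℝ) 1) : Integrable f A := by
  obtain ⟨C, hC, hb⟩ := bdd_strip hf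
  refine Integrable.mono' (integrable_const C) hf.measurable.aestronglyMeasurable ?_
  filter_upwards [hA] with q hq
  exact hb q.1 ⟨hq.1.le, hq.2⟩ q.2

lemma stat_gfp : GFP (I01.prod (volume : Measure (Td d))) (fun _ => 0) volume volume := by
  refine ⟨inferInstance, inferInstance, inferInstance, I01_prod_supp _, measurable_const, ?_,
    fun φ h => ?_⟩
  · simp [sqnorm]
  have i1 := cont_int2 h.cs_t _ (I01_prod_supp (volume : Measure (Td d)))
  have i2 := cont_int2 h.cs_l _ (I01_prod_supp (volume : Measure (Td d)))
  have : ∀ q : ℝ × Td d, Lop φ (fun _ => 0) q =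
      tderiv φ q.1 (secT q.2) + lapl (φ q.1) (secT q.2) := fun q => by simp [Lop, dotp]
  simp only [this]
  rw [integral_add i1 i2, integral_prod _ i2, integral_prod_symm _ i1]
  have l0 : ∀ s, ∫ y : Td d, lapl (φ s) (secT y) = 0 := fun s => by
    simp only [lapl]
    rw [integral_finsetSum _ fun i _ => cont_int (cont_sec1 (g := fun x => D2 (φ s) x (Pi.single i 1) (Pi.single i 1)) ((h.cont_D2 _ _).comp
      (Continuous.prodMk_right s)) (fun x z => D2_per (h.2 s) x _ _ z)) _]
    refine Finset.sum_eq_zero fun i _ => ?_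
    refine int_deriv_zero (g := fun y => fderiv ℝ (φ s) y (Pi.single i 1))
      ((h.c1_x _).comp (contDiff_prodMk_right s)) (fun x z => ?_) _
    rw [fderiv_per (h.2 s)]
  simp only [l0, integral_zero, add_zero]
  rw [← integral_sub (cont_int (h.cs_slice 1) _) (cont_int (h.cs_slice 0) _)]
  refine integral_congr_ae (Eventually.of_forall fun y => ?_)
  simp only
  rw [← intervalIntegral.integral_of_le zero_le_one]
  simp only [tderiv]
  rw [intervalIntegral.integral_eq_sub_of_hasDerivAt (f := fun r => φ r (secT y)) (fun r _ => (h.tder r _).differentiableAt.hasDerivAt)]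
  exact ((h.cs_t).comp (Continuous.prodMk_left y)).intervalIntegrable _ _
end transl
end partE

section partW
open scoped Topology

section wass
variable {d : ℕ}

instance instOMS : OpensMeasurableSpace (Td d) := inferInstance
instance instTopPT : TopologicalSpace (PTd d) := ProbabilityMeasure.instTopologicalSpace (Ω := Td d)
instance instCompPT : CompactSpace (PTd d) := inferInstanceAs (CompactSpace (ProbabilityMeasure (Td d)))

lemma Td_dist_le (y y' : Td d) : dist y y' ≤ 1 := by
  rw [dist_pi_le_iff zero_le_one]
  intro i
  rw [dist_eq_norm]
  have := AddCircle.norm_le_half_period (1:ℝ) (x := y i - y' i) one_ne_zero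
  rw [abs_one] at this; linarith

lemma lip_int {K : NNReal} {φ : Td d → ℝ} (h : LipschitzWith K φ) (μ : Measure (Td d)) [IsFiniteMeasure μ] :
    Integrable φ μ := cont_int h.continuous μ

lemma prob_int_const (μ : PTd d) (c : ℝ) : ∫ _y, c ∂(μ : Measure (Td d)) = c := by simp

lemma W1_diff_le {φ : Td d → ℝ} (h : LipschitzWith 1 φ) (μ ν : PTd d) :
    (∫ y, φ y ∂(μ : Measure (Td d))) - ∫ y, φ y ∂(ν : Measure (Td d)) ≤ 2 := by
  have b : ∀ y, |φ y - φ 0| ≤ 1 := fun y => by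
    have := h.dist_le_mul y 0
    rw [Real.dist_eq] at this
    simpa using this.trans (by simpa using Td_dist_le y 0)
  have h1 : ∫ y, φ y ∂(μ : Measure (Td d)) ≤ φ 0 + 1 := by
    rw [← prob_int_const μ (φ 0 + 1)]
    exact integral_mono (lip_int h _) (integrable_const _) fun y => by linarith [abs_le.1 (b y)]
  have h2 : φ 0 - 1 ≤ ∫ y, φ y ∂(ν : Measure (Td d)) := by
    rw [← prob_int_const ν (φ 0 - 1)]
    exact integral_mono (integrable_const _) (lip_int h _) fun y => by linarith [abs_le.1 (b y)]
  linarith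

lemma le_W1 {φ : Td d → ℝ} (h : LipschitzWith 1 φ) (μ ν : PTd d) :
    (∫ y, φ y ∂(μ : Measure (Td d))) - ∫ y, φ y ∂(ν : Measure (Td d)) ≤ W1 μ ν :=
  le_csSup ⟨2, by rintro r ⟨φ, hφ, rfl⟩; exact W1_diff_le hφ μ ν⟩ ⟨φ, h, rfl⟩

lemma W1_le {μ ν : PTd d} {r : ℝ} (h : ∀ φ : Td d → ℝ, LipschitzWith 1 φ →
    (∫ y, φ y ∂(μ : Measure (Td d))) - ∫ y, φ y ∂(ν : Measure (Td d)) ≤ r) : W1 μ ν ≤ r :=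
  csSup_le ⟨_, fun _ => 0, LipschitzWith.const' 0, rfl⟩ (by rintro r ⟨φ, hφ, rfl⟩; exact h φ hφ)

lemma W1_nonneg (μ ν : PTd d) : 0 ≤ W1 μ ν := by
  simpa using le_W1 (LipschitzWith.const' (0:ℝ) : LipschitzWith 1 fun _ : Td d => (0:ℝ)) μ ν

lemma W1_self (μ : PTd d) : W1 μ μ = 0 :=
  le_antisymm (W1_le fun φ _ => by simp) (W1_nonneg _ _)

lemma W1_le_symm (μ ν : PTd d) : W1 μ ν ≤ W1 ν μ := W1_le fun φ hφ => by
  have := le_W1 (LipschitzWith.neg hφ) ν μ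
  simp only [Pi.neg_apply, integral_neg] at this; linarith
lemma W1_symm (μ ν : PTd d) : W1 μ ν = W1 ν μ := le_antisymm (W1_le_symm _ _) (W1_le_symm _ _)
lemma W1_tri (μ ν ρ : PTd d) : W1 μ ρ ≤ W1 μ ν + W1 ν ρ := W1_le fun φ hφ => by
  linarith [le_W1 hφ μ ν, le_W1 hφ ν ρ]

lemma W1_lip {K : ℝ} (hK : 0 < K) {φ : Td d → ℝ} (h : ∀ y y', |φ y - φ y'| ≤ K * dist y y') (μ ν : PTd d) :
    |(∫ y, φ y ∂(μ : Measure (Td d))) - ∫ y, φ y ∂(ν : Measure (Td d))| ≤ K * W1 μ ν := by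
  have h1 : LipschitzWith 1 fun y => K⁻¹ * φ y := LipschitzWith.of_dist_le_mul fun y y' => by
    rw [Real.dist_eq, ← mul_sub, abs_mul, abs_of_pos (inv_pos.2 hK), inv_mul_le_iff₀ hK]
    simpa using h y y'
  have e : ∀ μ : PTd d, ∫ y, K⁻¹ * φ y ∂(μ : Measure (Td d)) = K⁻¹ * ∫ y, φ y ∂(μ : Measure (Td d)) :=
    fun μ => integral_const_mul _ _
  have a := le_W1 h1 μ ν
  have b := le_W1 h1 ν μ
  rw [e, e, ← mul_sub, inv_mul_le_iff₀ hK] at a b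
  rw [W1_symm] at b
  exact abs_le.2 ⟨by linarith, a⟩

lemma W1_le_fin {ε : ℝ} (hε : 0 < ε) : ∃ t : Finset (Td d), ∃ h : Td d → Td d → ℝ,
    (∀ k, Continuous (h k)) ∧ ∀ μ ν : PTd d, W1 μ ν ≤ ε +
      ∑ k ∈ t, |(∫ y, h k y ∂(μ : Measure (Td d))) - ∫ y, h k y ∂(ν : Measure (Td d))| := by
  set r := ε / 4 with hr
  have hr0 : 0 < r := by positivity
  obtain ⟨t, -, ht⟩ := (isCompact_univ (X := Td d)).elim_finite_subcover_image
    (b := univ) (c := fun x => Metric.ball x r) (fun x _ => Metric.isOpen_ball)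
    (fun x _ => by simp only [mem_univ, iUnion_true, mem_iUnion]; exact ⟨x, Metric.mem_ball_self hr0⟩)
  obtain ⟨hfin, hcov⟩ := ht
  let F := hfin.toFinset
  let g : Td d → Td d → ℝ := fun k y => max 0 (2 * r - dist y k)
  have g0 : ∀ k y, 0 ≤ g k y := fun k y => le_max_left _ _
  have gc : ∀ k, Continuous (g k) := fun k => by fun_prop
  let G : Td d → ℝ := fun y => ∑ k ∈ F, g k y
  have hG : ∀ y, 0 < G y := fun y => by
    obtain ⟨k, hk, hy⟩ : ∃ k ∈ t, y ∈ Metric.ball k r := by simpa using hcov (mem_univ y)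
    refine lt_of_lt_of_le ?_ (Finset.single_le_sum (f := fun k => g k y) (fun i _ => g0 i y) (hfin.mem_toFinset.2 hk))
    rw [Metric.mem_ball] at hy
    exact lt_max_of_lt_right (by linarith)
  have Gc : Continuous G := continuous_finsetSum _ fun k _ => gc k
  let h : Td d → Td d → ℝ := fun k y => g k y / G y
  have hc : ∀ k, Continuous (h k) := fun k => (gc k).div Gc fun y => (hG y).ne'
  have h0 : ∀ k y, 0 ≤ h k y := fun k y => div_nonneg (g0 k y) (hG y).le
  have hs : ∀ y, ∑ k ∈ F, h k y = 1 := fun y => by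
    simp only [h, ← Finset.sum_div]; exact div_self (hG y).ne'
  refine ⟨F, h, hc, fun μ ν => W1_le fun φ hφ => ?_⟩
  let c := φ 0
  let s : Td d → ℝ := fun y => ∑ k ∈ F, (φ k - c) * h k y
  have hφd : ∀ y y', |φ y - φ y'| ≤ dist y y' := fun y y' => by
    simpa [Real.dist_eq] using hφ.dist_le_mul y y'
  have hs' : ∀ y, |φ y - c - s y| ≤ 2 * r := fun y => by
    have e : φ y - c - s y = ∑ k ∈ F, (φ y - φ k) * h k y := by
      simp only [s]
      rw [← mul_one (φ y - c), ← hs y, Finset.mul_sum, ← Finset.sum_sub_distrib]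
      exact Finset.sum_congr rfl fun k _ => by ring
    rw [e]
    calc _ ≤ ∑ k ∈ F, |(φ y - φ k) * h k y| := Finset.abs_sum_le_sum_abs _ _
      _ ≤ ∑ k ∈ F, 2 * r * h k y := Finset.sum_le_sum fun k _ => by
          rw [abs_mul, abs_of_nonneg (h0 k y)]
          by_cases hd : dist y k ≤ 2 * r
          · exact mul_le_mul_of_nonneg_right ((hφd y k).trans hd) (h0 k y)
          · have : h k y = 0 := by
              simp only [h, g]; rw [max_eq_left (by linarith)]; simp
            simp [this]
      _ = 2 * r := by rw [← Finset.mul_sum, hs, mul_one]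
  have sc : Continuous s := continuous_finsetSum _ fun k _ => continuous_const.mul (hc k)
  have ints : ∀ ρ : PTd d, |(∫ y, φ y ∂(ρ : Measure (Td d))) - c - ∫ y, s y ∂(ρ : Measure (Td d))| ≤ 2 * r := by
    intro ρ
    have : (∫ y, φ y ∂(ρ : Measure (Td d))) - c - ∫ y, s y ∂(ρ : Measure (Td d)) =
        ∫ y, (φ y - c - s y) ∂(ρ : Measure (Td d)) := by
      rw [integral_sub (f := fun y => φ y - c) ((lip_int hφ _).sub (integrable_const _)) (cont_int sc _),
        integral_sub (lip_int hφ _) (integrable_const _), prob_int_const]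
    rw [this, ← Real.norm_eq_abs]
    have := norm_integral_le_of_norm_le_const (μ := (ρ : Measure (Td d))) (f := fun y => φ y - c - s y) (C := 2 * r) (Eventually.of_forall hs')
    simpa using this
  have es : ∀ ρ : PTd d, ∫ y, s y ∂(ρ : Measure (Td d)) = ∑ k ∈ F, (φ k - c) * ∫ y, h k y ∂(ρ : Measure (Td d)) := by
    intro ρ
    simp only [s]
    rw [integral_finsetSum _ fun k _ => (cont_int (hc k) _).const_mul _]
    simp only [integral_const_mul]
  have k1 := abs_le.1 (ints μ)
  have k2 := abs_le.1 (ints ν)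
  have k3 : (∫ y, s y ∂(μ : Measure (Td d))) - ∫ y, s y ∂(ν : Measure (Td d)) ≤
      ∑ k ∈ F, |(∫ y, h k y ∂(μ : Measure (Td d))) - ∫ y, h k y ∂(ν : Measure (Td d))| := by
    rw [es, es, ← Finset.sum_sub_distrib]
    refine Finset.sum_le_sum fun k _ => ?_
    rw [← mul_sub]
    refine (le_abs_self _).trans ?_
    rw [abs_mul]
    exact mul_le_of_le_one_left (abs_nonneg _) ((hφd k 0).trans (Td_dist_le _ _))
  linarith

lemma weak_int {ι : Type*} {l : Filter ι} {m : ι → PTd d} {μ : PTd d} (h : Tendsto m l (𝓝 μ))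
    {f : Td d → ℝ} (hf : Continuous f) :
    Tendsto (fun i => ∫ y, f y ∂(m i : Measure (Td d))) l (𝓝 (∫ y, f y ∂(μ : Measure (Td d)))) :=
  ProbabilityMeasure.tendsto_iff_forall_integral_tendsto.1 h (BoundedContinuousFunction.mkOfCompact ⟨f, hf⟩)

lemma tendsto_W1 {ι : Type*} {l : Filter ι} {m : ι → PTd d} {μ : PTd d} (h : Tendsto m l (𝓝 μ)) :
    Tendsto (fun i => W1 (m i) μ) l (𝓝 0) := by
  rw [Metric.tendsto_nhds]
  intro ε hε
  obtain ⟨t, hh, hc, hb⟩ := W1_le_fin (d := d) (half_pos hε)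
  have : Tendsto (fun i => ∑ k ∈ t, |(∫ y, hh k y ∂(m i : Measure (Td d))) - ∫ y, hh k y ∂(μ : Measure (Td d))|)
      l (𝓝 0) := by
    have : Tendsto _ l (𝓝 (∑ k ∈ t, |(∫ y, hh k y ∂(μ : Measure (Td d))) - ∫ y, hh k y ∂(μ : Measure (Td d))|)) :=
      tendsto_finsetSum t fun k _ => ((weak_int h (hc k)).sub_const _).abs
    simpa using this
  filter_upwards [this.eventually (gt_mem_nhds (half_pos hε))] with i hi
  rw [Real.dist_0_eq_abs, abs_of_nonneg (W1_nonneg _ _)]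
  linarith [hb (m i) μ]

lemma weak_of_W1 {ι : Type*} {l : Filter ι} [l.IsCountablyGenerated] {m : ι → PTd d} {μ : PTd d}
    (h : Tendsto (fun i => W1 (m i) μ) l (𝓝 0)) : Tendsto m l (𝓝 μ) := by
  rw [tendsto_iff_forall_lipschitz_integral_tendsto]
  rintro f - ⟨L, hL⟩
  rw [tendsto_iff_dist_tendsto_zero]
  have h2 := h.const_mul ((L:ℝ) + 1)
  rw [mul_zero] at h2
  refine squeeze_zero (fun _ => dist_nonneg) (fun i => ?_) h2
  rw [Real.dist_eq]
  refine W1_lip (by positivity) (fun y y' => ?_) _ _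
  have := hL.dist_le_mul y y'
  rw [Real.dist_eq] at this
  nlinarith [dist_nonneg (x := y) (y := y')]

lemma continuous_W1 : Continuous fun p : PTd d × PTd d => W1 p.1 p.2 := by
  rw [continuous_iff_continuousAt]
  rintro ⟨μ, ν⟩
  have h1 := tendsto_W1 (d := d) (m := Prod.fst) (continuous_fst.tendsto (μ, ν))
  have h2 := tendsto_W1 (d := d) (m := Prod.snd) (continuous_snd.tendsto (μ, ν))
  rw [ContinuousAt, tendsto_iff_dist_tendsto_zero]
  have h3 := h1.add h2
  rw [add_zero] at h3
  refine squeeze_zero (fun _ => dist_nonneg) (fun p => ?_) h3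
  rw [Real.dist_eq, abs_le]
  constructor
  · linarith [W1_tri μ p.1 ν, W1_tri p.1 p.2 ν, W1_symm μ p.1, W1_symm ν p.2]
  · linarith [W1_tri p.1 μ p.2, W1_tri μ ν p.2, W1_symm μ p.1, W1_symm ν p.2]

lemma cont_of_W1Continuous {χ : PTd d → ℝ} (h : W1Continuous χ) : Continuous χ := by
  rw [continuous_iff_continuousAt]
  intro μ
  rw [ContinuousAt, Metric.tendsto_nhds]
  intro ε hε
  obtain ⟨η, hη, hh⟩ := h μ ε hε
  filter_upwards [(tendsto_W1 (tendsto_id (x := 𝓝 μ))).eventually (gt_mem_nhds hη)] with ν hν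
  exact hh ν (by rw [W1_symm]; exact hν)
end wass
end partW

section partK
open scoped Topology
open ProbabilityTheory (Kernel IsFiniteKernel)
open scoped ProbabilityTheory

section kern
variable {d : ℕ}

lemma cp_int {κ : Kernel ℝ (Td d)} [IsFiniteKernel κ] {f : ℝ × Td d → ℝ}
    (hf : Integrable f (I01 ⊗ₘ κ)) : Integrable (fun s => ∫ y, f (s, y) ∂κ s) I01 := by
  unfold Measure.compProd at hf
  simpa using hf.integral_compProd

lemma Lop_timeMul {φ : ℝ → Vd d → ℝ} (h : IsTestFun φ) {η g : ℝ → ℝ} (hη : ∀ s, HasDerivAt η (g s) s)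
    (β : ℝ × Td d → Vd d) (q : ℝ × Td d) : Lop (fun s x => η s * φ s x) β q =
      g q.1 * φ q.1 (secT q.2) + η q.1 * Lop φ β q := by
  have e1 : tderiv (fun s x => η s * φ s x) q.1 (secT q.2) =
      g q.1 * φ q.1 (secT q.2) + η q.1 * tderiv φ q.1 (secT q.2) :=
    ((hη q.1).mul (h.tder q.1 (secT q.2)).differentiableAt.hasDerivAt).deriv
  have h0 := Lop_smul h (η q.1) β q
  simp only [Lop] at h0 ⊢
  have e2 : tderiv (η q.1 • φ) q.1 (secT q.2) = η q.1 * tderiv φ q.1 (secT q.2) :=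
    (((h.tder q.1 (secT q.2)).differentiableAt.hasDerivAt).const_mul _).deriv
  have e3 : (η q.1 • φ) q.1 = fun x => η q.1 * φ q.1 x := rfl
  rw [e2, e3] at h0
  rw [e1]; linarith

lemma GFP.ae_eq {κ : Kernel ℝ (Td d)} [IsFiniteKernel κ] {β μ₀ μ₁} (G : GFP (I01 ⊗ₘ κ) β μ₀ μ₁)
    {φ : ℝ → Vd d → ℝ} (h : IsTestFun φ) : ∀ᵐ r ∂I01, ∫ y, φ r (secT y) ∂κ r =
      (∫ y, φ 0 (secT y) ∂μ₀) + ∫ s in (0:ℝ)..r, ∫ y, Lop φ β (s, y) ∂κ s := by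
  set Λ : ℝ → ℝ := fun s => ∫ y, Lop φ β (s, y) ∂κ s with hΛ
  set J : ℝ → ℝ := fun r => ∫ y, φ r (secT y) ∂κ r with hJ
  set c := ∫ y, φ 0 (secT y) ∂μ₀ with hc
  have := G.finA
  have iΛ : Integrable Λ I01 := cp_int (G.int h)
  have iφ := cont_int2 h.cs_val _ G.supp
  have iJ : Integrable J I01 := cp_int iφ
  let U : ℝ → ℝ := fun r => ∫ s in Ioc 0 r, Λ s ∂I01
  have hU : ∀ r ∈ Ioc (0:ℝ) 1, U r = ∫ s in (0:ℝ)..r, Λ s := fun r hr => by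
    rw [intervalIntegral.integral_of_le hr.1.le]
    simp only [U, I01]
    rw [Measure.restrict_restrict measurableSet_Ioc, inter_eq_left.2 (Ioc_subset_Ioc_right hr.2)]
  have iprod : ∀ g : ℝ → ℝ, Continuous g → Integrable (fun z : ℝ × ℝ => indicator {z : ℝ × ℝ | 0 < z.2 ∧ z.2 ≤ z.1}
      (fun z => g z.1 * Λ z.2) z) (I01.prod I01) := fun g hg => by
    refine Integrable.indicator ?_ ((measurableSet_lt measurable_const measurable_snd).inter
      (measurableSet_le measurable_snd measurable_fst))
    exact ((hg.integrableOn_Icc (a := 0) (b := 1)).mono_set Ioc_subset_Icc_self).mul_prod iΛ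
  have eU : ∀ g : ℝ → ℝ, ∀ r, g r * U r = ∫ s, indicator {z : ℝ × ℝ | 0 < z.2 ∧ z.2 ≤ z.1}
      (fun z => g z.1 * Λ z.2) (r, s) ∂I01 := fun g r => by
    simp only [U]
    rw [← integral_const_mul, ← integral_indicator measurableSet_Ioc]
    rfl
  have igU : ∀ g : ℝ → ℝ, Continuous g → Integrable (fun r => g r * U r) I01 := fun g hg => by
    simp only [eU]; exact (iprod g hg).integral_prod_left
  have iU : Integrable U I01 := by simpa using igU (fun _ => 1) continuous_const
  have main : ∀ᵐ r ∂I01, J r - (c + U r) = 0 := by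
    refine ae_eq_zero_of_integral_contDiff_smul_eq_zero
      (iJ.sub ((integrable_const c).add iU)).locallyIntegrable fun g hg _ => ?_
    have gc : Continuous g := hg.continuous
    let η : ℝ → ℝ := fun s => ∫ r in (1:ℝ)..s, g r
    have hη : ∀ s, HasDerivAt η (g s) s := fun s =>
      intervalIntegral.integral_hasDerivAt_right (gc.intervalIntegrable _ _)
        (gc.stronglyMeasurable.stronglyMeasurableAtFilter) gc.continuousAt
    have hη2 : ContDiff ℝ 2 η := by
      rw [show (2 : WithTop ℕ∞) = 1 + 1 by norm_num, contDiff_succ_iff_deriv]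
      refine ⟨fun s => (hη s).differentiableAt, by simp, ?_⟩
      rw [show deriv η = g from funext fun s => (hη s).deriv]
      exact hg.of_le (by exact_mod_cast le_top)
    have ht : IsTestFun (fun s x => η s * φ s x) := by
      refine ⟨?_, fun t x z => by simp only [h.2]⟩
      exact (hη2.comp contDiff_fst).mul h.1
    have ηc : Continuous η := hη2.continuous
    have bI : ∀ (f : ℝ → ℝ), Continuous f → ∀ u : ℝ × Td d → ℝ, Integrable u (I01 ⊗ₘ κ) →
        Integrable (fun q => f q.1 * u q) (I01 ⊗ₘ κ) := fun f hf u hu => by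
      obtain ⟨C, hC⟩ := (isCompact_Icc (a := (0:ℝ)) (b := 1)).exists_bound_of_continuousOn hf.continuousOn
      refine hu.bdd_mul (c := C) (hf.comp continuous_fst).measurable.aestronglyMeasurable ?_
      filter_upwards [G.supp] with q hq using hC q.1 ⟨hq.1.le, hq.2⟩
    have bI1 : ∀ (f : ℝ → ℝ), Continuous f → ∀ u : ℝ → ℝ, Integrable u I01 →
        Integrable (fun q => f q * u q) I01 := fun f hf u hu => by
      obtain ⟨C, hC⟩ := (isCompact_Icc (a := (0:ℝ)) (b := 1)).exists_bound_of_continuousOn hf.continuousOn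
      refine hu.bdd_mul (c := C) hf.measurable.aestronglyMeasurable ?_
      filter_upwards [ae_restrict_mem measurableSet_Ioc] with q hq using hC q ⟨hq.1.le, hq.2⟩
    have e := G.fp _ ht
    simp only [Lop_timeMul h hη] at e
    rw [integral_add (bI g gc _ iφ) (bI η ηc _ (G.int h)),
      Measure.integral_compProd (bI g gc _ iφ), Measure.integral_compProd (bI η ηc _ (G.int h))] at e
    simp only [integral_const_mul] at e
    have η1 : η 1 = 0 := intervalIntegral.integral_same
    have η0 : η 0 = -∫ r, g r ∂I01 := by
      simp only [η]
      rw [intervalIntegral.integral_symm, intervalIntegral.integral_of_le zero_le_one]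
    rw [η1, η0, zero_mul, ← hc] at e
    have sw : ∫ s, η s * Λ s ∂I01 = -∫ r, g r * U r ∂I01 := by
      simp only [eU]
      rw [integral_integral_swap (f := fun r s => indicator {z : ℝ × ℝ | 0 < z.2 ∧ z.2 ≤ z.1}
        (fun z => g z.1 * Λ z.2) (r, s)) (iprod g gc), ← integral_neg]
      refine setIntegral_congr_fun measurableSet_Ioc fun s hs => ?_
      have : ∀ r, indicator {z : ℝ × ℝ | 0 < z.2 ∧ z.2 ≤ z.1} (fun z => g z.1 * Λ z.2) (r, s) =
          (indicator (Ici s) g r) * Λ s := fun r => by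
        by_cases hr : s ≤ r <;> simp [indicator, hs.1, hr]
      simp only [this]
      rw [integral_mul_const, integral_indicator measurableSet_Ici]
      simp only [η, I01]
      rw [Measure.restrict_restrict measurableSet_Ici, intervalIntegral.integral_symm,
        intervalIntegral.integral_of_le hs.2, ← integral_Icc_eq_integral_Ioc, neg_mul]
      congr 4
      ext r; simp only [mem_inter_iff, mem_Icc, mem_Ici, mem_Ioc]
      constructor
      · rintro ⟨a, b⟩; exact ⟨a, lt_of_lt_of_le hs.1 a, b⟩
      · rintro ⟨a, b, c⟩; exact ⟨a, c⟩
    have eJ : ∫ s, g s * ∫ y, φ s (secT y) ∂κ s ∂I01 = ∫ s, g s * J s ∂I01 := rfl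
    have eL : ∫ s, η s * ∫ y, Lop φ β (s, y) ∂κ s ∂I01 = ∫ s, η s * Λ s ∂I01 := rfl
    rw [eJ, eL, sw] at e
    simp only [smul_eq_mul, mul_sub, mul_add]
    rw [integral_sub (g := fun x => g x * c + g x * U x) (bI1 g gc _ iJ) ((bI1 g gc _ (integrable_const c)).add (igU g gc)),
      integral_add (bI1 g gc _ (integrable_const c)) (igU g gc), integral_mul_const]
    linarith
  filter_upwards [main, ae_restrict_mem measurableSet_Ioc] with r hr hm
  rw [hU r hm] at hr
  simp only [J] at hr ⊢
  linarith
end kern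
end partK

section partL1
open scoped Topology
open ProbabilityTheory (Kernel IsFiniteKernel IsMarkovKernel)
open scoped ProbabilityTheory

section disint
variable {d : ℕ}

lemma test_time {η : ℝ → ℝ} (hη : ContDiff ℝ 2 η) : IsTestFun (fun s (_ : Vd d) => η s) :=
  ⟨hη.comp contDiff_fst, fun _ _ _ => rfl⟩

lemma Lop_time (η : ℝ → ℝ) (β : ℝ × Td d → Vd d) (q : ℝ × Td d) :
    Lop (fun s (_ : Vd d) => η s) β q = deriv η q.1 := by
  simp [Lop, tderiv, lapl, D2, gradv, dotp]

lemma GFP.mass {A : Measure (ℝ × Td d)} {β μ₀ μ₁} (G : GFP A β μ₀ μ₁) : μ₁.real univ = μ₀.real univ := by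
  have := G.fp _ (test_time (η := fun _ => 1) contDiff_const)
  simp [Lop_time] at this
  linarith

lemma GFP.fst_int {A : Measure (ℝ × Td d)} {β μ₀ μ₁} (G : GFP A β μ₀ μ₁) {f : ℝ → ℝ} (hf : ContDiff ℝ 1 f) :
    ∫ q, f q.1 ∂A = μ₀.real univ * ∫ s, f s ∂I01 := by
  let η : ℝ → ℝ := fun s => ∫ r in (0:ℝ)..s, f r
  have hη : ∀ s, HasDerivAt η (f s) s := fun s =>
    intervalIntegral.integral_hasDerivAt_right (hf.continuous.intervalIntegrable _ _)
      (hf.continuous.stronglyMeasurable.stronglyMeasurableAtFilter) hf.continuous.continuousAt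
  have hd : deriv η = f := funext fun s => (hη s).deriv
  have hη2 : ContDiff ℝ 2 η := by
    rw [show (2 : WithTop ℕ∞) = 1 + 1 by norm_num, contDiff_succ_iff_deriv]
    refine ⟨fun s => (hη s).differentiableAt, by simp, ?_⟩
    rw [hd]; exact hf
  have e := G.fp _ (test_time hη2)
  simp only [Lop_time, hd, integral_const, smul_eq_mul, G.mass] at e
  have e0 : η 0 = 0 := intervalIntegral.integral_same
  have e1 : η 1 = ∫ s, f s ∂I01 := intervalIntegral.integral_of_le zero_le_one
  rw [e0, e1] at e; linarith

lemma GFP.disint {A : Measure (ℝ × Td d)} {β μ₀ μ₁} (G : GFP A β μ₀ μ₁) [hp : IsProbabilityMeasure μ₀] :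
    ∃ κ : Kernel ℝ (Td d), IsMarkovKernel κ ∧ A = I01 ⊗ₘ κ := by
  have := G.finA
  refine ⟨A.condKernel, inferInstance, ?_⟩
  have e : A.fst = I01 := by
    refine Measure.ext_of_charFun ?_
    ext t
    have key : ∀ f : ℝ → ℝ, ContDiff ℝ 1 f → ∫ s, f s ∂A.fst = ∫ s, f s ∂I01 := fun f hf => by
      rw [Measure.fst, integral_map measurable_fst.aemeasurable hf.continuous.aestronglyMeasurable,
        G.fst_int hf]; simp
    have h2 : ∀ μ : Measure ℝ, IsFiniteMeasure μ → charFun μ t =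
        ((∫ s, Real.cos (t * s) ∂μ : ℝ) : ℂ) + ((∫ s, Real.sin (t * s) ∂μ : ℝ) : ℂ) * Complex.I := by
      intro μ hμ
      have ic : Integrable (fun s => Real.cos (t * s)) μ := Integrable.of_bound (C := 1) (by fun_prop)
        (Eventually.of_forall fun s => by simpa using Real.abs_cos_le_one _)
      have is : Integrable (fun s => Real.sin (t * s)) μ := Integrable.of_bound (C := 1) (by fun_prop)
        (Eventually.of_forall fun s => by simpa using Real.abs_sin_le_one _)
      rw [charFun_apply_real, ← integral_complex_ofReal, ← integral_complex_ofReal,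
        ← integral_mul_const, ← integral_add]
      · refine integral_congr_ae (Eventually.of_forall fun s => ?_)
        simp only [Complex.exp_mul_I, ← Complex.ofReal_mul, ← Complex.ofReal_cos, ← Complex.ofReal_sin]
      · exact ic.ofReal
      · exact is.ofReal.mul_const _
    rw [h2 _ inferInstance, h2 _ inferInstance, key _ (by fun_prop), key _ (by fun_prop)]
  rw [← e]; exact (A.disintegrate _).symm
end disint
end partL1

section partL2
open scoped Topology
open ProbabilityTheory (Kernel IsFiniteKernel IsMarkovKernel)
open scoped ProbabilityTheory

section trig
variable {d : ℕ}

def trg (k : (Fin d → ℤ) × Bool) (x : Vd d) : ℝ :=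
  if k.2 then (UnitAddTorus.mFourier k.1 (piT x)).re else (UnitAddTorus.mFourier k.1 (piT x)).im

lemma trg_per (k : (Fin d → ℤ) × Bool) (x : Vd d) (z : Fin d → ℤ) : trg k (x + intVec z) = trg k x := by
  have : piT (x + intVec z) = piT x := by
    rw [piT_add]
    have : piT (intVec z) = 0 := by
      funext i; simp [piT, intVec]
    rw [this, add_zero]
  simp only [trg, this]

lemma trg_smooth (k : (Fin d → ℤ) × Bool) : ContDiff ℝ 2 (trg k) := by
  have h : ContDiff ℝ 2 (fun x : Vd d => (UnitAddTorus.mFourier k.1 (piT x) : ℂ)) := by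
    simp only [UnitAddTorus.mFourier, ContinuousMap.coe_mk, piT, fourier_coe_apply]
    refine contDiff_prod fun i _ => ?_
    refine Complex.contDiff_exp.comp ?_
    refine ContDiff.div_const (ContDiff.mul contDiff_const ?_) _
    exact Complex.ofRealCLM.contDiff.comp (contDiff_apply ℝ ℝ i)
  rcases k with ⟨k, b⟩
  cases b
  · exact Complex.imCLM.contDiff.comp h
  · exact Complex.reCLM.contDiff.comp h

lemma trg_det {μ ν : Measure (Td d)} [IsFiniteMeasure μ] [IsFiniteMeasure ν]
    (h : ∀ k, ∫ y, trg k (secT y) ∂μ = ∫ y, trg k (secT y) ∂ν) : μ = ν := by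
  have ci : ∀ (f : C(Td d, ℂ)) (ρ : Measure (Td d)) [IsFiniteMeasure ρ], Integrable f ρ := fun f ρ _ =>
    Integrable.of_bound (C := ‖f‖) f.continuous.aestronglyMeasurable
      (Eventually.of_forall fun y => f.norm_coe_le_norm y)
  let J (ρ : Measure (Td d)) [IsFiniteMeasure ρ] : C(Td d, ℂ) →L[ℂ] ℂ := LinearMap.mkContinuous
    { toFun := fun f => ∫ y, f y ∂ρ
      map_add' := fun f g => integral_add (ci f ρ) (ci g ρ)
      map_smul' := fun c f => integral_const_mul _ _ } (ρ.real univ) fun f => by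
        rw [mul_comm]
        exact norm_integral_le_of_norm_le_const (Eventually.of_forall fun y => f.norm_coe_le_norm y)
  have hJ : J μ = J ν := by
    refine ContinuousLinearMap.ext_on (s := Set.range (UnitAddTorus.mFourier (d := Fin d))) ?_ ?_
    · have := UnitAddTorus.span_mFourier_closure_eq_top (d := Fin d)
      rw [Submodule.dense_iff_topologicalClosure_eq_top]
      exact this
    · rintro _ ⟨k, rfl⟩
      have e : ∀ ρ : Measure (Td d), IsFiniteMeasure ρ → ∫ y, UnitAddTorus.mFourier k y ∂ρ =
          ((∫ y, trg (k, true) (secT y) ∂ρ : ℝ) : ℂ) + ((∫ y, trg (k, false) (secT y) ∂ρ : ℝ) : ℂ) * Complex.I := by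
        intro ρ hρ
        have := integral_re_add_im (ci (UnitAddTorus.mFourier k) ρ)
        rw [← this]
        simp only [trg, piT_secT]
        rfl
      show ∫ y, UnitAddTorus.mFourier k y ∂μ = ∫ y, UnitAddTorus.mFourier k y ∂ν
      rw [e _ inferInstance, e _ inferInstance, h, h]
  refine ext_of_forall_integral_eq_of_IsFiniteMeasure fun f => ?_
  have := DFunLike.congr_fun hJ ⟨fun y => (f y : ℂ), Complex.continuous_ofReal.comp f.continuous⟩
  have h2 : ∫ y, (f y : ℂ) ∂μ = ∫ y, (f y : ℂ) ∂ν := this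
  rw [integral_complex_ofReal, integral_complex_ofReal] at h2
  exact_mod_cast h2

lemma cont_pair {f : ℝ × Td d → ℝ} (hf : Continuous f) {X : Type*} [TopologicalSpace X] {t : X → ℝ} (ht : Continuous t)
    {m : X → PTd d} (hm : Continuous m) : Continuous fun r => ∫ y, f (t r, y) ∂(m r : Measure (Td d)) := by
  let F : ℝ → C(Td d, ℝ) := fun r => ⟨fun y => f (r, y), by fun_prop⟩
  have hF : Continuous F := ContinuousMap.continuous_of_continuous_uncurry F hf
  refine continuous_iff_continuousAt.2 fun r₀ => ?_
  have h1 : Tendsto (fun r => ∫ y, F (t r₀) y ∂(m r : Measure (Td d))) (𝓝 r₀)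
    (𝓝 (∫ y, F (t r₀) y ∂(m r₀ : Measure (Td d)))) := weak_int hm.continuousAt (F (t r₀)).continuous
  have h2 : Tendsto (fun r => ∫ y, (F (t r) y - F (t r₀) y) ∂(m r : Measure (Td d))) (𝓝 r₀) (𝓝 0) := by
    have h3 : Tendsto (fun r => ‖F (t r) - F (t r₀)‖) (𝓝 r₀) (𝓝 0) := by
      have := ((hF.comp ht).sub (continuous_const (y := F (t r₀)))).norm.tendsto r₀
      simpa using this
    refine squeeze_zero_norm (fun r => ?_) h3
    refine (norm_integral_le_of_norm_le_const (C := ‖F (t r) - F (t r₀)‖) (Eventually.of_forall fun y => ?_)).trans ?_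
    · exact (F (t r) - F (t r₀)).norm_coe_le_norm y
    · simp
  have h4 := h2.add h1
  rw [zero_add] at h4
  refine h4.congr fun r => ?_
  rw [integral_sub (cont_int (F (t r)).continuous _) (cont_int (F (t r₀)).continuous _)]
  simp [F]
end trig
end partL2

section partL3
open scoped Topology
open ProbabilityTheory (Kernel IsFiniteKernel IsMarkovKernel)
open scoped ProbabilityTheory

section curve
variable {d : ℕ}

def clip (r : ℝ) : ℝ := max 0 (min r 1)
lemma continuous_clip : Continuous clip := by unfold clip; fun_prop
lemma clip_mem (r : ℝ) : clip r ∈ Icc (0:ℝ) 1 := ⟨le_max_left _ _, max_le zero_le_one (min_le_right _ _)⟩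
lemma clip_eq {r : ℝ} (h : r ∈ Icc (0:ℝ) 1) : clip r = r := by
  unfold clip; rw [min_eq_left h.2, max_eq_right h.1]

lemma ae_of_I01 {p : ℝ → Prop} (h : ∀ᵐ r ∂I01, p r) : ∀ᵐ r ∂(volume.restrict (Icc (0:ℝ) 1)), p r := by
  rwa [restrict_Ioc_eq_restrict_Icc.symm]

lemma GFP.curve {κ : Kernel ℝ (Td d)} [IsMarkovKernel κ] {β μ₁} {ν : PTd d}
    (G : GFP (I01 ⊗ₘ κ) β ν μ₁) : ∃ m : ℝ → PTd d, Continuous m ∧ m 0 = ν ∧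
      (m 1 : Measure (Td d)) = μ₁ ∧ (∀ᵐ s ∂I01, (m s : Measure (Td d)) = κ s) ∧
      ∀ φ : ℝ → Vd d → ℝ, IsTestFun φ → ∀ r ∈ Icc (0:ℝ) 1, ∫ y, φ r (secT y) ∂(m r : Measure (Td d)) =
        (∫ y, φ 0 (secT y) ∂(ν : Measure (Td d))) + ∫ s in (0:ℝ)..r, ∫ y, Lop φ β (s, y) ∂κ s := by
  let Λ : (ℝ → Vd d → ℝ) → ℝ → ℝ := fun φ r =>
    (∫ y, φ 0 (secT y) ∂(ν : Measure (Td d))) + ∫ s in (0:ℝ)..r, ∫ y, Lop φ β (s, y) ∂κ s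
  have := G.fin1
  have hΛ : ∀ φ, IsTestFun φ → ContinuousOn (Λ φ) (Icc 0 1) := fun φ h => by
    have i : Integrable (fun s => ∫ y, Lop φ β (s, y) ∂κ s) I01 := cp_int (G.int h)
    refine continuousOn_const.add ?_
    rw [← uIcc_of_le (zero_le_one' ℝ)]
    refine intervalIntegral.continuousOn_primitive_interval ?_
    rw [uIcc_of_le zero_le_one]
    exact (integrableOn_Icc_iff_integrableOn_Ioc (by simp)).2 i
  let gk : (Fin d → ℤ) × Bool → ℝ → Vd d → ℝ := fun k _ x => trg k x
  have hgk : ∀ k, IsTestFun (gk k) := fun k =>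
    ⟨(trg_smooth k).comp contDiff_snd, fun _ x z => trg_per k x z⟩
  let Γ : PTd d → ((Fin d → ℤ) × Bool → ℝ) := fun μ k => ∫ y, trg k (secT y) ∂(μ : Measure (Td d))
  have Γc : Continuous Γ := continuous_pi fun k => continuous_iff_continuousAt.2 fun μ =>
    weak_int continuousAt_id ((hgk k).cs_slice 0)
  have Γi : Function.Injective Γ := fun μ μ' h =>
    Subtype.ext (trg_det (μ := (μ : Measure (Td d))) (ν := (μ' : Measure (Td d))) fun k => congrFun h k)
  have Γe := Γc.isClosedEmbedding Γi
  let Θ : ℝ → ((Fin d → ℤ) × Bool → ℝ) := fun r k => Λ (gk k) (clip r)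
  have Θc : Continuous Θ := continuous_pi fun k =>
    (hΛ _ (hgk k)).comp_continuous continuous_clip clip_mem
  have good : ∀ᵐ r ∂I01, Γ ⟨κ r, inferInstance⟩ = Θ r := by
    have : ∀ᵐ r ∂I01, ∀ k, ∫ y, gk k r (secT y) ∂κ r = Λ (gk k) r := by
      rw [ae_all_iff]; exact fun k => G.ae_eq (hgk k)
    filter_upwards [this, ae_restrict_mem measurableSet_Ioc] with r hr hm
    funext k
    show _ = Λ (gk k) (clip r)
    rw [clip_eq ⟨hm.1.le, hm.2⟩, ← hr k]
    rfl
  have rng : ∀ r, ∃ μ, Γ μ = Θ r := by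
    have cl : IsClosed {r | Θ r ∈ Set.range Γ} := Γe.isClosed_range.preimage Θc
    have D : Dense {r : ℝ | r ∈ Ioc (0:ℝ) 1 → Γ ⟨κ r, inferInstance⟩ = Θ r} := by
      refine Measure.dense_of_ae (μ := volume) ?_
      exact (ae_restrict_iff' measurableSet_Ioc).1 good
    have s1 : Ioo (0:ℝ) 1 ⊆ {r | Θ r ∈ Set.range Γ} :=
      (D.open_subset_closure_inter isOpen_Ioo).trans (closure_minimal
        (fun r hr => ⟨_, hr.2 ⟨hr.1.1, hr.1.2.le⟩⟩) cl)
    have s2 : Icc (0:ℝ) 1 ⊆ {r | Θ r ∈ Set.range Γ} := by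
      rw [← closure_Ioo (zero_ne_one' ℝ)]; exact closure_minimal s1 cl
    intro r
    obtain ⟨μ, h⟩ := s2 (clip_mem r)
    refine ⟨μ, h.trans ?_⟩
    simp only [Θ, clip_eq (clip_mem r)]
  choose m hm using rng
  have mc : Continuous m := by
    rw [Γe.isInducing.continuous_iff]
    exact Θc.congr fun r => (hm r).symm
  have mae : ∀ᵐ s ∂I01, (m s : Measure (Td d)) = κ s := by
    filter_upwards [good] with r hr
    have := Γi ((hm r).trans hr.symm)
    rw [this]; rfl
  have main : ∀ φ : ℝ → Vd d → ℝ, IsTestFun φ → ∀ r ∈ Icc (0:ℝ) 1, ∫ y, φ r (secT y) ∂(m r : Measure (Td d)) = Λ φ r := by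
    intro φ h
    have c1 : Continuous fun r => ∫ y, φ r (secT y) ∂(m r : Measure (Td d)) :=
      cont_pair h.cs_val continuous_id mc
    refine Measure.eqOn_Icc_of_ae_eq volume zero_ne_one ?_ c1.continuousOn (hΛ φ h)
    refine ae_of_I01 ?_
    filter_upwards [mae, G.ae_eq h] with r h1 h2
    rw [h1, h2]
  refine ⟨m, mc, Γi ?_, ?_, mae, main⟩
  · rw [hm]; funext k
    simp only [Θ, clip_eq (show (0:ℝ) ∈ Icc (0:ℝ) 1 by simp), Λ, intervalIntegral.integral_same, add_zero]
    rfl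
  · refine trg_det fun k => ?_
    have e := main _ (hgk k) 1 (by simp)
    have e2 := G.fp _ (hgk k)
    rw [Measure.integral_compProd (G.int (hgk k))] at e2
    simp only [Λ] at e
    rw [intervalIntegral.integral_of_le zero_le_one] at e
    simp only [gk] at e e2
    linarith
end curve
end partL3

section partF1
open scoped Topology

section ham
variable {d : ℕ}

lemma taylor_lo {g g' g'' : ℝ → ℝ} (h1 : ∀ t, HasDerivAt g (g' t) t) (h2 : ∀ t, HasDerivAt g' (g'' t) t)
    {a : ℝ} (ha : ∀ t, a ≤ g'' t) : g 0 + g' 0 + a / 2 ≤ g 1 := by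
  have k2 : ∀ t, HasDerivAt (fun t => g' t - g' 0 - a * t) (g'' t - a) t := fun t => by
    have := ((h2 t).sub_const (g' 0)).fun_sub ((hasDerivAt_id t).const_mul a)
    rw [mul_one] at this; exact this
  have m2 : Monotone (fun t => g' t - g' 0 - a * t) :=
    monotone_of_deriv_nonneg (fun t => (k2 t).differentiableAt) fun t => by
      rw [(k2 t).deriv]; linarith [ha t]
  have k1 : ∀ t, HasDerivAt (fun t => g t - g' 0 * t - a / 2 * t ^ 2) (g' t - g' 0 - a * t) t := fun t => by
    have := ((h1 t).fun_sub ((hasDerivAt_id t).const_mul (g' 0))).fun_sub ((hasDerivAt_pow 2 t).const_mul (a / 2))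
    refine this.congr_deriv ?_
    simp; ring
  have m1 : MonotoneOn (fun t => g t - g' 0 * t - a / 2 * t ^ 2) (Icc 0 1) := by
    refine monotoneOn_of_deriv_nonneg (convex_Icc _ _) (fun t _ => (k1 t).continuousAt.continuousWithinAt)
      (fun t _ => (k1 t).differentiableAt.differentiableWithinAt) fun t ht => ?_
    rw [interior_Icc] at ht
    rw [(k1 t).deriv]
    simpa using m2 ht.1.le
  have := m1 (show (0:ℝ) ∈ Icc (0:ℝ) 1 by simp) (show (1:ℝ) ∈ Icc (0:ℝ) 1 by simp) zero_le_one
  simp at this; linarith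

lemma taylorv_lo {f : Vd d → ℝ} (hf : ContDiff ℝ 2 f) (x v : Vd d) {a : ℝ} (ha : ∀ z, a ≤ D2 f z v v) :
    f x + fderiv ℝ f x v + a / 2 ≤ f (x + v) := by
  have l : ∀ t : ℝ, HasDerivAt (fun t : ℝ => x + t • v) v t := fun t => by
    simpa using ((hasDerivAt_id t).smul_const v).const_add x
  have := taylor_lo (g := fun t => f (x + t • v)) (g' := fun t => fderiv ℝ f (x + t • v) v)
    (g'' := fun t => D2 f (x + t • v) v v)
    (fun t => ((hf.differentiable (by norm_num)) _).hasFDerivAt.comp_hasDerivAt t (l t))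
    (fun t => HasFDerivAt.comp_hasDerivAt (f := fun t : ℝ => x + t • v) t (lapl_hasD2 hf (x + t • v) v) (l t)) (a := a) (fun t => ha _)
  simpa using this

lemma D2_neg (f : Vd d → ℝ) (x v w : Vd d) : D2 (fun y => - f y) x v w = - D2 f x v w := by
  unfold D2
  simp only [fderiv_fun_neg, neg_apply]

lemma taylorv_hi {f : Vd d → ℝ} (hf : ContDiff ℝ 2 f) (x v : Vd d) {b : ℝ} (hb : ∀ z, D2 f z v v ≤ b) :
    f (x + v) ≤ f x + fderiv ℝ f x v + b / 2 := by
  have := taylorv_lo hf.neg x v (a := -b) (fun z => by rw [D2_neg]; linarith [hb z])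
  rw [fderiv_fun_neg] at this
  simp only [neg_apply] at this
  linarith

variable (S : MFGSetting d)

lemma Hs_le {x q p : Vd d} : dotp q p - S.H x p ≤ S.Hstar x q := (S.Hstar_eq x q).1 ⟨p, rfl⟩

lemma Hs_per (x : Vd d) (z : Fin d → ℤ) : S.Hstar (x + intVec z) = S.Hstar x := by
  funext q
  have h1 := S.Hstar_eq (x + intVec z) q
  simp only [S.H_per] at h1
  exact h1.unique (S.Hstar_eq x q)

lemma Hs_convex (x : Vd d) : ConvexOn ℝ univ (S.Hstar x) := by
  refine ⟨convex_univ, fun q _ q' _ a b ha hb hab => (S.Hstar_eq x _).2 ?_⟩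
  rintro _ ⟨p, rfl⟩
  have h1 := mul_le_mul_of_nonneg_left (Hs_le S (x := x) (q := q) (p := p)) ha
  have h2 := mul_le_mul_of_nonneg_left (Hs_le S (x := x) (q := q') (p := p)) hb
  have e : dotp (a • q + b • q') p = a * dotp q p + b * dotp q' p := by
    simp only [dotp, Pi.add_apply, Pi.smul_apply, smul_eq_mul, Finset.mul_sum, ← Finset.sum_add_distrib]
    exact Finset.sum_congr rfl fun i _ => by ring
  simp only [smul_eq_mul, e]
  have : S.H x p = a * S.H x p + b * S.H x p := by rw [← add_mul, hab, one_mul]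
  linarith

lemma Hs_meas : Measurable fun q : Vd d × Vd d => S.Hstar q.1 q.2 := by
  have : LowerSemicontinuous fun q : Vd d × Vd d => S.Hstar q.1 q.2 := by
    intro q y hy
    obtain ⟨_, ⟨p, rfl⟩, h1⟩ := (lt_isLUB_iff (S.Hstar_eq q.1 q.2)).1 hy
    have c : Continuous fun q : Vd d × Vd d => dotp q.2 p - S.H q.1 p :=
      (continuous_dotp.comp (continuous_snd.prodMk continuous_const)).sub
        (S.H_smooth.continuous.comp (continuous_fst.prodMk continuous_const))
    filter_upwards [(c.tendsto q).eventually_const_lt h1] with z hz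
    exact hz.trans_le (Hs_le S)
  exact this.measurable

lemma Hp_smooth (x : Vd d) : ContDiff ℝ 2 (fun p => S.H x p) :=
  S.H_smooth.comp (contDiff_const.prodMk contDiff_id)
lemma Hx_smooth (p : Vd d) : ContDiff ℝ 2 (fun x => S.H x p) :=
  S.H_smooth.comp (contDiff_id.prodMk contDiff_const)

lemma H_T1 (x p v : Vd d) : S.H x p + dotp v (DpH S x p) + (S.Cbar⁻¹ * sqnorm v) / 2 ≤ S.H x (p + v) := by
  have := taylorv_lo (Hp_smooth S x) p v (fun z => S.Dpp_lower x z v)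
  rwa [fderiv_eq_dotp] at this
lemma H_T2 (x p v : Vd d) : S.H x (p + v) ≤ S.H x p + dotp v (DpH S x p) + (S.Cbar * sqnorm v) / 2 := by
  have := taylorv_hi (Hp_smooth S x) p v (fun z => S.Dpp_upper x z v)
  rwa [fderiv_eq_dotp] at this

lemma dotp_add_r (a b c : Vd d) : dotp a (b + c) = dotp a b + dotp a c := by
  simp [dotp, mul_add, Finset.sum_add_distrib]
lemma dotp_sub_l (a b c : Vd d) : dotp (a - b) c = dotp a c - dotp b c := by
  simp [dotp, sub_mul, Finset.sum_sub_distrib]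
lemma dotp_add_l (a b c : Vd d) : dotp (a + b) c = dotp a c + dotp b c := by
  simp [dotp, add_mul, Finset.sum_add_distrib]
lemma dotp_comm' (a b : Vd d) : dotp a b = dotp b a := by
  simp [dotp, mul_comm]
lemma dotp_self (a : Vd d) : dotp a a = sqnorm a := by simp [dotp, sqnorm, sq]
lemma dotp_smul_l (c : ℝ) (a b : Vd d) : dotp (c • a) b = c * dotp a b := by
  simp only [dotp, Pi.smul_apply, smul_eq_mul, Finset.mul_sum, mul_assoc]
lemma sqnorm_smul (c : ℝ) (a : Vd d) : sqnorm (c • a) = c ^ 2 * sqnorm a := by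
  simp only [sqnorm, Pi.smul_apply, smul_eq_mul, Finset.mul_sum, mul_pow]
lemma dotp_young {c : ℝ} (hc : 0 < c) (a b : Vd d) : 2 * dotp a b ≤ c * sqnorm a + c⁻¹ * sqnorm b := by
  simp only [dotp, sqnorm, Finset.mul_sum, ← Finset.sum_add_distrib]
  refine Finset.sum_le_sum fun i _ => ?_
  have : c * a i ^ 2 + c⁻¹ * b i ^ 2 - 2 * (a i * b i) = c⁻¹ * (c * a i - b i) ^ 2 := by
    field_simp; ring
  have h2 := mul_nonneg (inv_pos.2 hc).le (sq_nonneg (c * a i - b i))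
  linarith
lemma norm_sq_le (a : Vd d) : ‖a‖ ^ 2 ≤ sqnorm a := by
  have h : ‖a‖ ≤ Real.sqrt (sqnorm a) := (pi_norm_le_iff_of_nonneg (Real.sqrt_nonneg _)).2 fun i => by
    refine Real.le_sqrt_of_sq_le ?_
    rw [Real.norm_eq_abs, sq_abs]
    exact Finset.single_le_sum (f := fun i => a i ^ 2) (fun _ _ => sq_nonneg _) (Finset.mem_univ i)
  calc ‖a‖ ^ 2 ≤ (Real.sqrt (sqnorm a)) ^ 2 := by gcongr
    _ = _ := Real.sq_sqrt (sqnorm_nonneg a)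
lemma sqnorm_add_le (a b : Vd d) : sqnorm (a + b) ≤ 2 * sqnorm a + 2 * sqnorm b := by
  simp only [sqnorm, Finset.mul_sum, ← Finset.sum_add_distrib]
  exact Finset.sum_le_sum fun i _ => by simp only [Pi.add_apply]; nlinarith [sq_nonneg (a i - b i)]
lemma sqnorm_neg (a : Vd d) : sqnorm (-a) = sqnorm a := by simp [sqnorm]

lemma Hs_S1 (x q p : Vd d) : S.Hstar x q ≤ dotp q p - S.H x p + S.Cbar / 2 * sqnorm (q - DpH S x p) := by
  refine (S.Hstar_eq x q).2 ?_
  rintro _ ⟨p', rfl⟩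
  have h1 := H_T1 S x p (p' - p)
  have h2 := dotp_young S.Cbar_pos (q - DpH S x p) (p' - p)
  rw [dotp_sub_l] at h2
  rw [dotp_comm' (p' - p)] at h1
  have e : dotp q p' = dotp q p + dotp q (p' - p) := by rw [← dotp_add_r]; simp
  rw [add_sub_cancel] at h1
  simp only
  linarith
end ham
end partF1

section partF2
open scoped Topology

section ham2
variable {d : ℕ} (S : MFGSetting d)

lemma per_bdd {f : Vd d → ℝ} (hc : Continuous f) (hp : ∀ x (z : Fin d → ℤ), f (x + intVec z) = f x) :
    ∃ B, 0 ≤ B ∧ ∀ x, |f x| ≤ B := by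
  obtain ⟨B, hB⟩ := (isCompact_univ (X := Td d)).exists_bound_of_continuousOn
    (cont_sec1 hc hp).continuousOn
  refine ⟨B, (norm_nonneg _).trans (hB 0 (mem_univ _)), fun x => ?_⟩
  have := hB (piT x) (mem_univ _)
  rwa [per_sec hp] at this

lemma DpH_eq (x p v : Vd d) : fderiv ℝ (fun p' => S.H x p') p v =
    fderiv ℝ (fun q : Vd d × Vd d => S.H q.1 q.2) (x, p) (0, v) := by
  have h : HasFDerivAt (fun p' : Vd d => (x, p')) (ContinuousLinearMap.inr ℝ (Vd d) (Vd d)) p :=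
    hasFDerivAt_prodMk_right x p
  have h1 := (S.H_smooth.differentiable (by norm_num) (x, p)).hasFDerivAt
  have := HasFDerivAt.comp p h1 h
  have e : fderiv ℝ (fun p' => S.H x p') p = _ := this.fderiv
  rw [e]; rfl

lemma DpH_c1 (p v : Vd d) : ContDiff ℝ 1 (fun x => fderiv ℝ (fun p' => S.H x p') p v) := by
  simp only [DpH_eq]
  have : ContDiff ℝ 1 (fderiv ℝ (fun q : Vd d × Vd d => S.H q.1 q.2)) :=
    S.H_smooth.fderiv_right (by norm_num)
  exact (this.comp (contDiff_id.prodMk contDiff_const)).clm_apply contDiff_const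

lemma H0_bdd : ∃ B, 0 ≤ B ∧ ∀ x, |S.H x 0| ≤ B ∧ sqnorm (DpH S x 0) ≤ B := by
  obtain ⟨B1, h1, H1⟩ := per_bdd (Hx_smooth S 0).continuous (fun x z => S.H_per x z 0)
  have hp : ∀ x (z : Fin d → ℤ), DpH S (x + intVec z) 0 = DpH S x 0 := fun x z => by
    funext i; simp only [DpH, S.H_per]
  have hc : Continuous fun x => sqnorm (DpH S x 0) := continuous_sqnorm.comp
    (continuous_pi fun i => (DpH_c1 S 0 (Pi.single i 1)).continuous)
  obtain ⟨B2, h2, H2⟩ := per_bdd hc (fun x z => by rw [hp])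
  exact ⟨B1 + B2, by positivity, fun x => ⟨by linarith [H1 x], by linarith [le_abs_self _ |>.trans (H2 x)]⟩⟩

lemma Hs_bounds : ∃ c C, 0 < c ∧ 0 ≤ C ∧ ∀ x q, c * sqnorm q - C ≤ S.Hstar x q ∧
    S.Hstar x q ≤ C * (1 + sqnorm q) := by
  obtain ⟨B, hB, H⟩ := H0_bdd S
  have hC := S.Cbar_pos
  refine ⟨S.Cbar⁻¹ / 4, B + S.Cbar⁻¹ * B + S.Cbar * (B + 1), by positivity, by positivity, fun x q => ?_⟩
  obtain ⟨h1, h2⟩ := H x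
  have h1' := abs_le.1 h1
  have i0 : 0 < S.Cbar⁻¹ := inv_pos.2 hC
  have nq := sqnorm_nonneg q
  constructor
  · have a1 := H_T2 S x 0 (S.Cbar⁻¹ • q)
    have a2 := Hs_le S (x := x) (q := q) (p := 0 + S.Cbar⁻¹ • q)
    rw [sqnorm_smul, dotp_smul_l] at a1
    rw [zero_add] at a1 a2
    have e1 : dotp q (S.Cbar⁻¹ • q) = S.Cbar⁻¹ * sqnorm q := by
      rw [dotp_comm', dotp_smul_l, dotp_self]
    have a3 := dotp_young (show (0:ℝ) < 1/2 by norm_num) q (DpH S x 0)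
    have e2 : S.Cbar * (S.Cbar⁻¹ ^ 2 * sqnorm q) = S.Cbar⁻¹ * sqnorm q := by field_simp
    have a4 : S.Cbar⁻¹ * dotp q (DpH S x 0) ≤ S.Cbar⁻¹ * (sqnorm q / 4 + B) := by
      refine mul_le_mul_of_nonneg_left ?_ i0.le
      norm_num at a3; linarith
    rw [e1] at a2; rw [e2] at a1
    have : 0 ≤ S.Cbar * (B + 1) := by positivity
    nlinarith
  · have a1 := Hs_S1 S x q 0
    have e1 : dotp q 0 = 0 := by simp [dotp]
    have a2 : sqnorm (q - DpH S x 0) ≤ 2 * sqnorm q + 2 * B := by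
      have := sqnorm_add_le q (-DpH S x 0)
      rw [sqnorm_neg, ← sub_eq_add_neg] at this; linarith
    have a3 := mul_le_mul_of_nonneg_left a2 (show 0 ≤ S.Cbar / 2 by positivity)
    rw [e1] at a1
    have t1 : 0 ≤ S.Cbar⁻¹ * B := by positivity
    have t2 : 0 ≤ S.Cbar * B * sqnorm q := by positivity
    have t3 : 0 ≤ B * sqnorm q := by positivity
    have t4 : 0 ≤ S.Cbar⁻¹ * B * sqnorm q := by positivity
    nlinarith

lemma Hs_max : ∃ K, 0 ≤ K ∧ ∀ x q, ∃ p, S.Hstar x q = dotp q p - S.H x p ∧ q = DpH S x p ∧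
    sqnorm p ≤ K * (1 + sqnorm q) := by
  obtain ⟨B, hB, H⟩ := H0_bdd S
  have hC := S.Cbar_pos
  refine ⟨16 * S.Cbar ^ 2 * (1 + B), by positivity, fun x q => ?_⟩
  obtain ⟨h1, h2⟩ := H x
  have i0 : 0 < S.Cbar⁻¹ := inv_pos.2 hC
  have cf : Continuous fun p => dotp q p - S.H x p :=
    (continuous_dotp.comp (continuous_const.prodMk continuous_id)).sub (Hp_smooth S x).continuous
  have nq := sqnorm_nonneg q
  have bd : ∀ p, S.Cbar⁻¹ / 4 * sqnorm p ≤ S.Cbar * (2 * sqnorm q + 2 * B) +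
      ((dotp q 0 - S.H x 0) - (dotp q p - S.H x p)) := fun p => by
    have a1 := H_T1 S x 0 p
    rw [zero_add] at a1
    have a2 := dotp_young (show 0 < 2 * S.Cbar by positivity) (q - DpH S x 0) p
    have a3 : sqnorm (q - DpH S x 0) ≤ 2 * sqnorm q + 2 * B := by
      have := sqnorm_add_le q (-DpH S x 0)
      rw [sqnorm_neg, ← sub_eq_add_neg] at this; linarith
    have a4 := mul_le_mul_of_nonneg_left a3 hC.le
    rw [dotp_sub_l, dotp_comm' (DpH S x 0), mul_inv] at a2
    have e1 : dotp q 0 = 0 := by simp [dotp]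
    rw [e1]
    nlinarith
  obtain ⟨p, hp⟩ : ∃ p, ∀ p', dotp q p' - S.H x p' ≤ dotp q p - S.H x p := by
    refine cf.exists_forall_ge' 0 ?_
    have hb : Bornology.IsBounded {p : Vd d | S.Cbar⁻¹ / 4 * sqnorm p ≤ S.Cbar * (2 * sqnorm q + 2 * B)} := by
      refine (Metric.isBounded_closedBall (x := (0 : Vd d))
        (r := S.Cbar * (2 * sqnorm q + 2 * B) / (S.Cbar⁻¹ / 4) + 1)).subset fun p hp => ?_
      rw [mem_setOf_eq, mul_comm, ← le_div_iff₀ (by positivity)] at hp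
      rw [mem_closedBall_zero_iff]
      nlinarith [norm_sq_le p, sq_nonneg (‖p‖ - 1), norm_nonneg p]
    have := hb.isCompact_closure.compl_mem_cocompact
    filter_upwards [this] with p hp
    by_contra hn
    push Not at hn
    exact hp (subset_closure (by have := bd p; simp only [mem_setOf_eq]; linarith))
  refine ⟨p, (S.Hstar_eq x q).unique ⟨?_, fun b hb => hb ⟨p, rfl⟩⟩, ?_, ?_⟩
  · rintro _ ⟨p', rfl⟩; exact hp p'
  · have hm : IsLocalMax (fun p => dotp q p - S.H x p) p := Eventually.of_forall hp
    have hd := (Hp_smooth S x).differentiable (by norm_num) p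
    let Lq : Vd d →L[ℝ] ℝ := ∑ i, q i • ContinuousLinearMap.proj (R := ℝ) (φ := fun _ : Fin d => ℝ) i
    have eL : ∀ v, Lq v = dotp q v := fun v => by simp [Lq, dotp]
    have hf : HasFDerivAt (fun p => dotp q p - S.H x p) (Lq - fderiv ℝ (fun p => S.H x p) p) p := by
      have := Lq.hasFDerivAt.fun_sub (x := p) hd.hasFDerivAt
      simpa only [eL] using this
    have z := hm.hasFDerivAt_eq_zero hf
    funext i
    have := DFunLike.congr_fun z (Pi.single i (1:ℝ))
    simp only [sub_apply, zero_apply, eL] at this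
    have e3 : dotp q (Pi.single i 1) = q i := by simp [dotp, Pi.single_apply]
    rw [e3] at this
    exact sub_eq_zero.1 this
  · have a := bd p
    have b := hp 0
    have a2 : S.Cbar⁻¹ / 4 * sqnorm p ≤ S.Cbar * (2 * sqnorm q + 2 * B) := by linarith
    have a3 := mul_le_mul_of_nonneg_left a2 (show 0 ≤ 4 * S.Cbar by positivity)
    have e : 4 * S.Cbar * (S.Cbar⁻¹ / 4 * sqnorm p) = sqnorm p := by field_simp
    rw [e] at a3
    have : 0 ≤ S.Cbar ^ 2 * B * sqnorm q := by positivity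
    have t2 : 0 ≤ S.Cbar ^ 2 * sqnorm q := by positivity
    have t3 : 0 ≤ S.Cbar ^ 2 * B := by positivity
    nlinarith
end ham2
end partF2

section partF3
open scoped Topology

section ham3
variable {d : ℕ} (S : MFGSetting d)

lemma rpow_young {θ : ℝ} (hθ : θ ∈ Ioo (0:ℝ) 1) {τ : ℝ} (hτ : 0 < τ) : ∃ C, 0 ≤ C ∧ ∀ P : ℝ, 1 ≤ P →
    P ^ (1 + θ) ≤ τ * P ^ 2 + C := by
  set R := τ ^ (1 / (θ - 1)) with hR
  have R0 : 0 < R := rpow_pos_of_pos hτ _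
  have hne : θ - 1 ≠ 0 := by linarith [hθ.2]
  have hR1 : R ^ (θ - 1) = τ := by
    rw [hR, ← rpow_mul hτ.le, one_div, inv_mul_cancel₀ hne, rpow_one]
  refine ⟨R ^ (1 + θ), rpow_nonneg R0.le _, fun P hP => ?_⟩
  have P0 : 0 < P := by linarith
  rcases le_total P R with h | h
  · have : P ^ (1 + θ) ≤ R ^ (1 + θ) := rpow_le_rpow P0.le h (by linarith [hθ.1])
    have := mul_nonneg hτ.le (sq_nonneg P); linarith
  · have e : P ^ (1 + θ) = P ^ (θ - 1) * P ^ 2 := by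
      rw [← rpow_natCast P 2, ← rpow_add P0]; congr 1; push_cast; ring
    have : P ^ (θ - 1) ≤ τ := by
      rw [← hR1]; exact rpow_le_rpow_of_nonpos R0 h (by linarith [hθ.2])
    rw [e]
    have := mul_le_mul_of_nonneg_right this (sq_nonneg P)
    have := rpow_nonneg R0.le (1 + θ); linarith

lemma dir_mvt {g : Vd d → ℝ} (hg : ContDiff ℝ 1 g) (x w : Vd d) {K : ℝ} (hK : ∀ z, |fderiv ℝ g z w| ≤ K) :
    |g (x + w) - g x| ≤ K := by
  have l : ∀ t : ℝ, HasDerivAt (fun t : ℝ => x + t • w) w t := fun t => by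
    simpa using ((hasDerivAt_id t).smul_const w).const_add x
  have := norm_image_sub_le_of_norm_deriv_le_segment_01' (f := fun t : ℝ => g (x + t • w))
    (f' := fun t => fderiv ℝ g (x + t • w) w) (C := K)
    (fun t _ => (((hg.differentiable (by norm_num)) _).hasFDerivAt.comp_hasDerivAt t (l t)).hasDerivWithinAt)
    (fun t _ => hK _)
  simpa using this

lemma nsing (i : Fin d) : ‖(Pi.single i 1 : Vd d)‖ = 1 := by
  refine le_antisymm ((pi_norm_le_iff_of_nonneg zero_le_one).2 fun j => ?_) ?_
  · by_cases h : j = i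
    · subst h; simp
    · simp [h]
  · simpa using norm_le_pi_norm (Pi.single i 1 : Vd d) i

lemma Hs_one (x q p : Vd d) (hq : q = DpH S x p) (i : Fin d) {t r : ℝ} (ht : t ∈ Icc (0:ℝ) 1) :
    S.Hstar (x + (t * r) • Pi.single i 1) (q + r • Pi.single i 1) ≤
      dotp q p - S.H x p + r * (p i - t * fderiv ℝ (fun x => S.H x p) x (Pi.single i 1)) +
      r ^ 2 * ((S.Cg + S.Cbar * d * (1 + S.Cg) ^ 2) * (1 + ‖p‖) ^ (1 + S.θ)) := by
  set e : Vd d := Pi.single i 1 with he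
  have ne : ‖e‖ = 1 := nsing i
  have hCg := S.Cg_pos
  have hC := S.Cbar_pos
  have hθ := S.θ_mem
  set P := 1 + ‖p‖ with hP
  have P1 : 1 ≤ P := by simp [hP]
  have P0 : 0 < P := by linarith
  have t2 : t ^ 2 ≤ 1 := by nlinarith [ht.1, ht.2]
  have T : S.H x p + t * r * fderiv ℝ (fun x => S.H x p) x e - S.Cg * P ^ (1 + S.θ) * r ^ 2 / 2 ≤
      S.H (x + (t * r) • e) p := by
    have := taylorv_lo (Hx_smooth S p) x ((t * r) • e) (a := -(S.Cg * P ^ (1 + S.θ) * r ^ 2)) fun z => by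
      have := (abs_le.1 (S.Dxx_growth z p ((t * r) • e) ((t * r) • e))).1
      rw [norm_smul, ne, mul_one, mul_assoc, Real.norm_eq_abs, abs_mul_abs_self] at this
      have h2 : S.Cg * P ^ (1 + S.θ) * (t * r * (t * r)) ≤ S.Cg * P ^ (1 + S.θ) * r ^ 2 := by
        refine mul_le_mul_of_nonneg_left ?_ (by positivity)
        nlinarith [sq_nonneg r]
      linarith
    rw [map_smul, smul_eq_mul] at this
    linarith
  have D : sqnorm (q + r • e - DpH S (x + (t * r) • e) p) ≤ d * ((1 + S.Cg) ^ 2 * P ^ (1 + S.θ) * r ^ 2) := by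
    have hpow : 1 ≤ P ^ S.θ := one_le_rpow P1 hθ.1.le
    have key : ∀ j, |(q + r • e - DpH S (x + (t * r) • e) p) j| ≤ (1 + S.Cg) * P ^ S.θ * |r| := fun j => by
      have := dir_mvt (DpH_c1 S p (Pi.single j 1)) x ((t * r) • e) (K := S.Cg * P ^ S.θ * |r|) fun z => by
        refine (S.Dxp_growth z p (Pi.single j 1) ((t * r) • e)).trans ?_
        have n1 : ‖(Pi.single j 1 : Vd d)‖ = 1 := nsing j
        rw [norm_smul, ne, n1, mul_one, mul_one, Real.norm_eq_abs, abs_mul, abs_of_nonneg ht.1]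
        refine mul_le_mul_of_nonneg_left ?_ (by positivity)
        exact mul_le_of_le_one_left (abs_nonneg _) ht.2
      have e1 : (q + r • e - DpH S (x + (t * r) • e) p) j = r * e j -
        (DpH S (x + (t * r) • e) p j - DpH S x p j) := by
        simp only [Pi.add_apply, Pi.sub_apply, Pi.smul_apply, smul_eq_mul]
        rw [show q j = DpH S x p j by rw [← hq]]; ring
      rw [e1]
      refine (abs_sub _ _).trans ?_
      have h3 : |r * e j| ≤ |r| := by
        rw [abs_mul]
        refine mul_le_of_le_one_right (abs_nonneg _) ?_
        rw [← ne]; exact norm_le_pi_norm e j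
      have h4 : |DpH S (x + (t * r) • e) p j - DpH S x p j| ≤ S.Cg * P ^ S.θ * |r| := this
      nlinarith [abs_nonneg r, mul_le_mul_of_nonneg_right hpow (abs_nonneg r)]
    have : ∀ j, ((q + r • e - DpH S (x + (t * r) • e) p) j) ^ 2 ≤ (1 + S.Cg) ^ 2 * P ^ (1 + S.θ) * r ^ 2 := fun j => by
      rw [← sq_abs]
      calc _ ≤ ((1 + S.Cg) * P ^ S.θ * |r|) ^ 2 := by gcongr; exact key j
        _ = (1 + S.Cg) ^ 2 * (P ^ S.θ) ^ 2 * r ^ 2 := by rw [mul_pow, mul_pow, sq_abs]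
        _ ≤ _ := by
          gcongr
          rw [← rpow_natCast, ← rpow_mul P0.le]
          refine rpow_le_rpow_of_exponent_le P1 ?_
          push_cast; linarith [hθ.2]
    refine (Finset.sum_le_sum fun j _ => this j).trans ?_
    simp
  have M := Hs_S1 S (x + (t * r) • e) (q + r • e) p
  have e5 : dotp (q + r • e) p = dotp q p + r * p i := by
    rw [dotp_add_l, dotp_smul_l]
    congr 2
    simp [he, dotp, Pi.single_apply]
  rw [e5] at M
  have D' := mul_le_mul_of_nonneg_left D (show 0 ≤ S.Cbar / 2 by positivity)
  have pos1 : 0 ≤ S.Cg * P ^ (1 + S.θ) * r ^ 2 := by positivity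
  have pos2 : 0 ≤ S.Cbar * (d * ((1 + S.Cg) ^ 2 * P ^ (1 + S.θ) * r ^ 2)) := by positivity
  linarith

lemma Hs_second {τ : ℝ} (hτ : 0 < τ) : ∃ C, 0 ≤ C ∧ ∀ (x q : Vd d) (i : Fin d) (p r₁ r₂ t : ℝ),
    0 ≤ p → p ≤ 1 → p * r₁ + (1 - p) * r₂ = 0 → t ∈ Icc (0:ℝ) 1 →
    p * S.Hstar (x + (t * r₁) • Pi.single i 1) (q + r₁ • Pi.single i 1) +
      (1 - p) * S.Hstar (x + (t * r₂) • Pi.single i 1) (q + r₂ • Pi.single i 1) ≤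
      S.Hstar x q + (τ * sqnorm q + C) * (p * r₁ ^ 2 + (1 - p) * r₂ ^ 2) := by
  obtain ⟨K, K0, hK⟩ := Hs_max S
  have hCg := S.Cg_pos
  have hC := S.Cbar_pos
  set M := S.Cg + S.Cbar * d * (1 + S.Cg) ^ 2 with hM
  have M0 : 0 < M := by positivity
  obtain ⟨C, C0, hY⟩ := rpow_young S.θ_mem (τ := τ / (M * (2 * K + 1))) (by positivity)
  refine ⟨M * C + 2 * (τ / (2 * K + 1)) * (1 + K), by positivity, fun x q i p r₁ r₂ t p0 p1 hr ht => ?_⟩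
  obtain ⟨pb, h1, h2, h3⟩ := hK x q
  have a1 := Hs_one S x q pb h2 i (r := r₁) ht
  have a2 := Hs_one S x q pb h2 i (r := r₂) ht
  rw [← hM] at a1 a2
  have y := hY (1 + ‖pb‖) (by linarith [norm_nonneg pb])
  have nP : (1 + ‖pb‖) ^ 2 ≤ 2 + 2 * (K * (1 + sqnorm q)) := by
    nlinarith [norm_sq_le pb, sq_nonneg (‖pb‖ - 1)]
  set Y := (1 + ‖pb‖) ^ (1 + S.θ)
  have b : M * Y ≤ τ * sqnorm q + (M * C + 2 * (τ / (2 * K + 1)) * (1 + K)) := by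
    have s1 : τ / (M * (2 * K + 1)) * (1 + ‖pb‖) ^ 2 ≤ τ / (M * (2 * K + 1)) * (2 + 2 * (K * (1 + sqnorm q))) :=
      mul_le_mul_of_nonneg_left nP (by positivity)
    have s2 := mul_le_mul_of_nonneg_left (y.trans (add_le_add_left s1 C)) M0.le
    have e : M * (τ / (M * (2 * K + 1)) * (2 + 2 * (K * (1 + sqnorm q))) + C) =
      M * C + 2 * (τ / (2 * K + 1)) * (1 + K) + (2 * K / (2 * K + 1)) * (τ * sqnorm q) := by
      field_simp; ring
    have s3 : (2 * K / (2 * K + 1)) * (τ * sqnorm q) ≤ τ * sqnorm q := by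
      refine mul_le_of_le_one_left (mul_nonneg hτ.le (sqnorm_nonneg q)) ?_
      rw [div_le_one (by positivity)]; linarith
    linarith
  have p0' : 0 ≤ 1 - p := by linarith
  have c1 := mul_le_mul_of_nonneg_left a1 p0
  have c2 := mul_le_mul_of_nonneg_left a2 p0'
  have V : 0 ≤ p * r₁ ^ 2 + (1 - p) * r₂ ^ 2 := by positivity
  have c3 := mul_le_mul_of_nonneg_right b V
  set Z := pb i - t * fderiv ℝ (fun x => S.H x pb) x (Pi.single i 1)
  have c4 : p * (r₁ * Z) + (1 - p) * (r₂ * Z) = 0 := by rw [← zero_mul Z, ← hr]; ring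
  rw [h1]
  nlinarith
end ham3
end partF3

section partG
open scoped Topology

section coupl
variable {d : ℕ}

lemma lift1 (z : AddCircle (1:ℝ)) : ∃ r : ℝ, (r : AddCircle (1:ℝ)) = z ∧ |r| = ‖z‖ := by
  obtain ⟨x, rfl⟩ := QuotientAddGroup.mk_surjective z
  refine ⟨x - round x, ?_, ?_⟩
  · have : ((round x : ℝ) : AddCircle (1:ℝ)) = 0 := by
      have := AddCircle.coe_period (1:ℝ)
      rw [show ((round x : ℤ) : ℝ) = (round x) • (1:ℝ) by simp, AddCircle.coe_zsmul, this, smul_zero]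
    rw [AddCircle.coe_sub, this, sub_zero]
  · have := AddCircle.norm_eq (p := (1:ℝ)) (x := x)
    simp at this; exact this.symm

lemma liftT (y y' : Td d) : ∃ v : Vd d, y' = y + piT v ∧ ∀ i, |v i| = ‖y' i - y i‖ := by
  choose v h1 h2 using fun i => lift1 (y' i - y i)
  refine ⟨v, ?_, h2⟩
  funext i
  simp [piT, h1]

lemma lift_norm {y y' : Td d} {v : Vd d} (h : ∀ i, |v i| = ‖y' i - y i‖) : ‖v‖ ≤ dist y y' := by
  refine (pi_norm_le_iff_of_nonneg dist_nonneg).2 fun i => ?_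
  rw [Real.norm_eq_abs, h i, dist_comm, ← dist_eq_norm]
  exact dist_le_pi_dist y' y i

variable (S : MFGSetting d)

lemma Fd_cont (ρ : PTd d) : Continuous fun y : Td d => S.Fd (ρ : Measure (Td d)) (secT y) :=
  cont_sec1 (S.Fd_smooth _ inferInstance).continuous (S.Fd_per _)

lemma Fd_lip : ∃ K, 0 < K ∧ ∀ (ρ : PTd d) (y y' : Td d),
    |S.Fd (ρ : Measure (Td d)) (secT y) - S.Fd (ρ : Measure (Td d)) (secT y')| ≤ K * dist y y' := by
  obtain ⟨M, hM⟩ := S.Fd_bounded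
  refine ⟨2 * |M| + |S.CF| + 1, by positivity, fun ρ y y' => ?_⟩
  have sm := S.Fd_smooth (ρ : Measure (Td d)) inferInstance
  have gb : ∀ x v, |fderiv ℝ (S.Fd (ρ : Measure (Td d))) x v| ≤ (2 * |M| + |S.CF| + 1) * ‖v‖ := by
    intro x
    have g1 : ∀ v : Vd d, ‖v‖ = 1 → fderiv ℝ (S.Fd (ρ : Measure (Td d))) x v ≤ 2 * |M| + |S.CF| := fun v hv => by
      have := taylorv_lo sm x v (a := -|S.CF|) fun z => by
        have := (abs_le.1 (S.Fd_D2_bound (ρ : Measure (Td d)) inferInstance z v v)).1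
        rw [hv] at this; linarith [le_abs_self S.CF]
      have b1 := abs_le.1 (hM ρ x)
      have b2 := abs_le.1 (hM ρ (x + v))
      linarith [le_abs_self M, abs_nonneg S.CF]
    intro v
    rcases eq_or_ne v 0 with rfl | hv
    · simp
    have nv : 0 < ‖v‖ := norm_pos_iff.2 hv
    have u1 : ‖(‖v‖⁻¹ • v)‖ = 1 := by rw [norm_smul, norm_inv, norm_norm, inv_mul_cancel₀ nv.ne']
    have a1 := g1 _ u1
    have a2 := g1 (-(‖v‖⁻¹ • v)) (by rw [norm_neg, u1])
    rw [map_neg] at a2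
    have : fderiv ℝ (S.Fd (ρ : Measure (Td d))) x v = ‖v‖ * fderiv ℝ (S.Fd (ρ : Measure (Td d))) x (‖v‖⁻¹ • v) := by
      rw [map_smul, smul_eq_mul, mul_inv_cancel_left₀ nv.ne']
    rw [this, abs_mul, abs_of_pos nv, mul_comm]
    refine mul_le_mul_of_nonneg_right ?_ nv.le
    rw [abs_le]; constructor <;> linarith
  obtain ⟨v, rfl, hv⟩ := liftT y y'
  rw [per_sec_add (S.Fd_per _), abs_sub_comm]
  refine dir_mvt (sm.of_le (by norm_num)) _ _ fun z => (gb z v).trans ?_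
  exact mul_le_mul_of_nonneg_left (lift_norm hv) (by positivity)

lemma Fc_diff (μ ν : PTd d) {K : ℝ} (h : ∀ ρ : PTd d,
    |(∫ y, S.Fd (ρ : Measure (Td d)) (secT y) ∂(ν : Measure (Td d))) -
      ∫ y, S.Fd (ρ : Measure (Td d)) (secT y) ∂(μ : Measure (Td d))| ≤ K) : |S.Fc ν - S.Fc μ| ≤ K := by
  rw [S.flat_deriv μ ν]
  have := norm_setIntegral_le_of_norm_le_const (C := K) (s := Icc (0:ℝ) 1) (μ := volume)
    (f := fun t => ((∫ y, S.Fd (lineComb t μ ν) (secT y) ∂(ν : Measure (Td d))) -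
        ∫ y, S.Fd (lineComb t μ ν) (secT y) ∂(μ : Measure (Td d)))) (by simp) fun t ht => by
      have hp : IsProbabilityMeasure (lineComb t μ ν) := ⟨by
        simp only [lineComb, Measure.add_apply, Measure.smul_apply, measure_univ, smul_eq_mul, mul_one]
        rw [← ENNReal.ofReal_add (by linarith [ht.2]) ht.1]; simp⟩
      exact h ⟨lineComb t μ ν, hp⟩
  simpa using this

lemma Fc_cont : Continuous S.Fc := by
  obtain ⟨K, K0, hK⟩ := Fd_lip S
  refine cont_of_W1Continuous fun μ ε hε => ⟨ε / K, by positivity, fun ν h => ?_⟩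
  have := Fc_diff S μ ν (K := K * W1 ν μ) fun ρ => W1_lip K0 (hK ρ) ν μ
  refine this.trans_lt ?_
  rw [W1_symm, mul_comm]
  exact (lt_div_iff₀ K0).1 h

lemma Fc_swap : ∃ M, 0 ≤ M ∧ ∀ (μ ν : PTd d) (b a a' : Measure (Td d)), IsFiniteMeasure b → IsFiniteMeasure a →
    IsFiniteMeasure a' → (μ : Measure (Td d)) = b + a → (ν : Measure (Td d)) = b + a' →
      a'.real univ = a.real univ → |S.Fc ν - S.Fc μ| ≤ M * a.real univ := by
  obtain ⟨M, hM⟩ := S.Fd_bounded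
  refine ⟨2 * |M|, by positivity, fun μ ν b a a' _ _ _ e1 e2 e => Fc_diff S μ ν fun ρ => ?_⟩
  have ci := fun (c : Measure (Td d)) (_ : IsFiniteMeasure c) => cont_int (Fd_cont S ρ) c
  rw [e1, e2, integral_add_measure (ci _ ‹_›) (ci _ ‹_›), integral_add_measure (ci _ ‹_›) (ci _ ‹_›)]
  have n : ∀ c : Measure (Td d), IsFiniteMeasure c → |∫ y, S.Fd (ρ : Measure (Td d)) (secT y) ∂c| ≤ |M| * c.real univ :=
    fun c _ => by
      rw [← Real.norm_eq_abs]
      exact norm_integral_le_of_norm_le_const (Eventually.of_forall fun y => (hM ρ _).trans (le_abs_self M))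
  have h1 := abs_le.1 (n a ‹_›)
  have h2 := abs_le.1 (n a' ‹_›)
  rw [e] at h2
  rw [abs_le]; constructor <;> linarith

lemma Fc_second : ∃ C, 0 ≤ C ∧ ∀ (μ ν : PTd d) (b a : Measure (Td d)), IsFiniteMeasure b → IsFiniteMeasure a →
    ∀ (i : Fin d) (p r₁ r₂ t : ℝ), 0 ≤ p → p ≤ 1 → p * r₁ + (1 - p) * r₂ = 0 → t ∈ Icc (0:ℝ) 1 →
    (μ : Measure (Td d)) = b + a →
    (ν : Measure (Td d)) = b + (ENNReal.ofReal p • a.map (· + piT (t • (r₁ • Pi.single i (1:ℝ)))) +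
      ENNReal.ofReal (1 - p) • a.map (· + piT (t • (r₂ • Pi.single i (1:ℝ))))) →
    |S.Fc ν - S.Fc μ| ≤ C * (p * r₁ ^ 2 + (1 - p) * r₂ ^ 2) * a.real univ := by
  refine ⟨|S.CF|, abs_nonneg _, fun μ ν b a _ _ i p r₁ r₂ t p0 p1 hr ht e1 e2 => Fc_diff S μ ν fun ρ => ?_⟩
  have fc := Fd_cont S ρ
  have sm := S.Fd_smooth (ρ : Measure (Td d)) inferInstance
  set F := S.Fd (ρ : Measure (Td d)) with hF
  have ci := fun (c : Measure (Td d)) (_ : IsFiniteMeasure c) => cont_int fc c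
  have cv : ∀ v : Vd d, Continuous fun y : Td d => F (secT y + v) := fun v => by
    have : Continuous fun y : Td d => F (secT (y + piT v)) := fc.comp (continuous_id.add continuous_const)
    simpa only [per_sec_add (S.Fd_per _), hF] using this
  have im : ∀ v : Vd d, ∫ y, F (secT y) ∂(a.map (· + piT v)) = ∫ y, F (secT y + v) ∂a := fun v => by
    rw [integral_map (by fun_prop) fc.aestronglyMeasurable]
    simp only [per_sec_add (S.Fd_per _), hF]
  have f1 := Measure.smul_finite (a.map (· + piT (t • (r₁ • Pi.single i (1:ℝ))))) (ENNReal.ofReal_ne_top (r := p))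
  have f2 := Measure.smul_finite (a.map (· + piT (t • (r₂ • Pi.single i (1:ℝ))))) (ENNReal.ofReal_ne_top (r := 1 - p))
  have ii : Integrable (fun y => p * F (secT y + t • (r₁ • Pi.single i (1:ℝ))) +
      (1 - p) * F (secT y + t • (r₂ • Pi.single i (1:ℝ)))) a :=
    ((cont_int (cv _) a).const_mul _).add ((cont_int (cv _) a).const_mul _)
  rw [e2, integral_add_measure (ci _ ‹_›) (ci _ inferInstance),
    integral_add_measure ((ci _ inferInstance).smul_measure (by simp)) ((ci _ inferInstance).smul_measure (by simp)),
    integral_smul_measure, integral_smul_measure, im, im, e1, integral_add_measure (ci _ ‹_›) (ci _ ‹_›), ENNReal.toReal_ofReal p0,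
    ENNReal.toReal_ofReal (by linarith), smul_eq_mul, smul_eq_mul, add_sub_add_left_eq_sub,
    ← integral_const_mul, ← integral_const_mul, ← integral_add ((cont_int (cv _) a).const_mul _)
    ((cont_int (cv _) a).const_mul _), ← integral_sub ii (ci a ‹_›)]
  rw [← Real.norm_eq_abs]
  refine norm_integral_le_of_norm_le_const (Eventually.of_forall fun y => ?_)
  have q0 : 0 ≤ 1 - p := by linarith
  have D : ∀ r z, |D2 F z (t • (r • Pi.single i (1:ℝ))) (t • (r • Pi.single i (1:ℝ)))| ≤ |S.CF| * r ^ 2 := fun r z => by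
    refine (S.Fd_D2_bound (ρ : Measure (Td d)) inferInstance z _ _).trans ?_
    rw [norm_smul, norm_smul, nsing, mul_one, mul_assoc, Real.norm_eq_abs, Real.norm_eq_abs,
      abs_of_nonneg ht.1]
    have : t * |r| * (t * |r|) ≤ r ^ 2 := by 
      have t1 : t * |r| ≤ |r| := by nlinarith [ht.2, abs_nonneg r]
      rw [← sq_abs r, sq]
      exact mul_le_mul t1 t1 (mul_nonneg ht.1 (abs_nonneg _)) (abs_nonneg _)
    have n2 : 0 ≤ t * |r| * (t * |r|) := mul_self_nonneg _
    calc _ ≤ |S.CF| * (t * |r| * (t * |r|)) := mul_le_mul_of_nonneg_right (le_abs_self _) n2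
      _ ≤ _ := mul_le_mul_of_nonneg_left this (abs_nonneg _)
  set x := secT y
  have l1 := taylorv_lo sm x _ (fun z => (abs_le.1 (D r₁ z)).1)
  have l2 := taylorv_lo sm x _ (fun z => (abs_le.1 (D r₂ z)).1)
  have u1 := taylorv_hi sm x _ (fun z => (abs_le.1 (D r₁ z)).2)
  have u2 := taylorv_hi sm x _ (fun z => (abs_le.1 (D r₂ z)).2)
  rw [map_smul, map_smul, smul_eq_mul, smul_eq_mul] at l1 l2 u1 u2
  set G := fderiv ℝ F x (Pi.single i 1)
  have c0 : p * (t * (r₁ * G)) + (1 - p) * (t * (r₂ * G)) = 0 := by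
    rw [← zero_mul (t * G), ← hr]; ring
  have l1' := mul_le_mul_of_nonneg_left l1 p0
  have u1' := mul_le_mul_of_nonneg_left u1 p0
  have l2' := mul_le_mul_of_nonneg_left l2 q0
  have u2' := mul_le_mul_of_nonneg_left u2 q0
  have V : 0 ≤ |S.CF| * (p * r₁ ^ 2 + (1 - p) * r₂ ^ 2) := by positivity
  rw [Real.norm_eq_abs, abs_le]
  constructor <;> nlinarith
end coupl
end partG

section partM
open scoped Topology
open ProbabilityTheory (Kernel IsFiniteKernel IsMarkovKernel)
open scoped ProbabilityTheory

section kers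
variable {d : ℕ}

lemma smul_ker (κ : Kernel ℝ (Td d)) [IsFiniteKernel κ] {c : ENNReal} (hc : c ≠ ⊤) :
    ∃ κ' : Kernel ℝ (Td d), IsFiniteKernel κ' ∧ c • (I01 ⊗ₘ κ) = I01 ⊗ₘ κ' ∧ ∀ s, κ' s = c • κ s := by
  let κ' : Kernel ℝ (Td d) := ⟨fun s => c • κ s, by
    refine Measure.measurable_of_measurable_coe _ fun s hs => ?_
    simp only [Measure.smul_apply, smul_eq_mul]
    exact (κ.measurable_coe hs).const_mul c⟩
  have e : ∀ s, κ' s = c • κ s := fun s => rfl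
  have hf : IsFiniteKernel κ' := ⟨⟨c * κ.bound, ENNReal.mul_lt_top hc.lt_top κ.bound_lt_top, fun s => by
    rw [e, Measure.smul_apply, smul_eq_mul]; gcongr; exact κ.measure_le_bound s univ⟩⟩
  refine ⟨κ', hf, ?_, e⟩
  ext s hs
  rw [Measure.smul_apply, Measure.compProd_apply hs, Measure.compProd_apply hs, smul_eq_mul,
    ← lintegral_const_mul' _ _ hc]
  rfl

lemma shift_ker (κ : Kernel ℝ (Td d)) [IsFiniteKernel κ] (Z : Vd d) :
    ∃ κ' : Kernel ℝ (Td d), IsFiniteKernel κ' ∧ (I01 ⊗ₘ κ).map (shiftM Z) = I01 ⊗ₘ κ' ∧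
      ∀ s, κ' s = (κ s).map (· + piT ((1 - s) • Z)) := by
  have ms : Measurable (shiftM Z) := (continuous_shiftM Z).measurable
  have ta : ∀ s : ℝ, Measurable fun y : Td d => y + piT ((1 - s) • Z) := fun s =>
    (continuous_id.add continuous_const).measurable
  let κ' : Kernel ℝ (Td d) := ⟨fun s => (κ s).map (· + piT ((1 - s) • Z)), by
    refine Measure.measurable_of_measurable_coe _ fun t ht => ?_
    have := Kernel.measurable_kernel_prodMk_left (κ := κ) ((measurable_snd.comp ms) ht)
    convert this using 2 with s
    exact Measure.map_apply (ta s) ht⟩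
  have e : ∀ s, κ' s = (κ s).map (· + piT ((1 - s) • Z)) := fun s => rfl
  have hf : IsFiniteKernel κ' := ⟨⟨κ.bound, κ.bound_lt_top, fun s => by
    rw [e, Measure.map_apply (ta s) MeasurableSet.univ]; exact κ.measure_le_bound s _⟩⟩
  refine ⟨κ', hf, ?_, e⟩
  ext s hs
  rw [Measure.map_apply ms hs, Measure.compProd_apply hs, Measure.compProd_apply (ms hs)]
  refine lintegral_congr fun t => ?_
  rw [e, Measure.map_apply (ta t) (measurable_prodMk_left hs)]
  rfl

lemma GFP.ker {A : Measure (ℝ × Td d)} {β μ₀ μ₁} (G : GFP A β μ₀ μ₁) :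
    ∃ κ : Kernel ℝ (Td d), IsFiniteKernel κ ∧ A = I01 ⊗ₘ κ ∧ ∀ s, (κ s).real univ = μ₀.real univ := by
  have f0 := G.fin0
  have fA := G.finA
  rcases eq_or_ne μ₀ 0 with rfl | h
  · refine ⟨0, inferInstance, ?_, by simp⟩
    have := G.fst_int (f := fun _ => 1) contDiff_const
    simp [Measure.real, ENNReal.toReal_eq_zero_iff] at this
    simp [this]
  have c0 : μ₀ univ ≠ 0 := by simpa using h
  have ct : μ₀ univ ≠ ⊤ := measure_ne_top _ _
  have G1 := G.smul (c := (μ₀ univ)⁻¹) (by simpa using h)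
  have hp : IsProbabilityMeasure ((μ₀ univ)⁻¹ • μ₀) := ⟨by simp [ENNReal.inv_mul_cancel c0 ct]⟩
  obtain ⟨κ, _, e⟩ := G1.disint
  obtain ⟨κ', h1, h2, h3⟩ := smul_ker κ ct
  refine ⟨κ', h1, ?_, fun s => ?_⟩
  · rw [← h2, ← e, smul_smul, ENNReal.mul_inv_cancel c0 ct, one_smul]
  · rw [h3]; simp [Measure.real]

lemma ker_uniq {κ κ' : Kernel ℝ (Td d)} [IsFiniteKernel κ] [IsFiniteKernel κ']
    (h : I01 ⊗ₘ κ = I01 ⊗ₘ κ') : ∀ᵐ s ∂I01, κ s = κ' s := Kernel.ae_eq_of_compProd_eq h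

def kerOf (m : ℝ → PTd d) (hm : Continuous m) : Kernel ℝ (Td d) := ⟨fun s => (m s : Measure (Td d)), by
  refine Measurable.measure_of_isPiSystem_of_isProbabilityMeasure
    (S := {s | IsClosed s}) ?_ isPiSystem_isClosed ?_
  · rw [← borel_eq_generateFrom_isClosed]; exact BorelSpace.measurable_eq
  · intro F hF
    have : UpperSemicontinuous fun s => (m s : Measure (Td d)) F := by
      intro s c hc
      have := ProbabilityMeasure.limsup_measure_closed_le_of_tendsto (hm.tendsto s) hF
      exact eventually_lt_of_limsup_lt (this.trans_lt hc)
    exact this.measurable⟩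

instance (m : ℝ → PTd d) (hm : Continuous m) : IsMarkovKernel (kerOf m hm) :=
  ⟨fun s => (m s).2⟩

end kers
end partM

section partN
open scoped Topology
open ProbabilityTheory (Kernel IsFiniteKernel IsMarkovKernel)
open scoped ProbabilityTheory

section updown
variable {d : ℕ} (S : MFGSetting d)

lemma GFP.Hint {A : Measure (ℝ × Td d)} {β μ₀ μ₁} (G : GFP A β μ₀ μ₁) :
    Integrable (fun q => S.Hstar (secT q.2) (β q)) A := by
  obtain ⟨c, C, c0, C0, hb⟩ := Hs_bounds S
  have := G.finA
  have i1 : Integrable (fun q => C * (1 + sqnorm (β q)) + C) A :=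
    (((integrable_const 1).add G.l2).const_mul C).add (integrable_const C)
  refine i1.mono' ((Hs_meas S).comp ((measurable_secT.comp measurable_snd).prodMk G.meas)).aestronglyMeasurable ?_
  refine Eventually.of_forall fun q => ?_
  have h := hb (secT q.2) (β q)
  have h2 := sqnorm_nonneg (β q)
  rw [Real.norm_eq_abs, abs_le]
  constructor
  · nlinarith [mul_nonneg c0.le h2, mul_nonneg C0 h2]
  · linarith

lemma lint_cp (m : ℝ → PTd d) (hm : Continuous m) {f : ℝ × Td d → ENNReal} (hf : Measurable f) :
    ∫⁻ s in Ioc (0:ℝ) 1, ∫⁻ y, f (s, y) ∂(m s : Measure (Td d)) = ∫⁻ q, f q ∂(I01 ⊗ₘ kerOf m hm) := by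
  rw [Measure.lintegral_compProd hf]; rfl

lemma fc_int (m : ℝ → PTd d) (hm : Continuous m) : Integrable (fun s => S.Fc (m s)) I01 := by
  have : IntervalIntegrable (fun s => S.Fc (m s)) volume 0 1 := ((Fc_cont S).comp hm).intervalIntegrable _ _
  exact (intervalIntegrable_iff_integrableOn_Ioc_of_le zero_le_one).1 this

lemma cost_eq (m : ℝ → PTd d) (hm : Continuous m) {β μ₀ μ₁}
    (G : GFP (I01 ⊗ₘ kerOf m hm) β μ₀ μ₁) : IntervalIntegrable (runCost S m fun s y => β (s, y)) volume 0 1 ∧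
    ∫ s in (0:ℝ)..1, runCost S m (fun s y => β (s, y)) s =
      (∫ q, S.Hstar (secT q.2) (β q) ∂(I01 ⊗ₘ kerOf m hm)) + ∫ s, S.Fc (m s) ∂I01 := by
  have i1 := G.Hint S
  have i2 := cp_int i1
  have i3 := fc_int S m hm
  refine ⟨(intervalIntegrable_iff_integrableOn_Ioc_of_le zero_le_one).2 (i2.add i3), ?_⟩
  rw [intervalIntegral.integral_of_le zero_le_one, Measure.integral_compProd i1]
  exact integral_add i2 i3

lemma GFP.up {A : Measure (ℝ × Td d)} {β} {ν : PTd d} {μ₁} (G : GFP A β ν μ₁) :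
    ∃ (m : ℝ → PTd d) (hm : Continuous m), A = I01 ⊗ₘ kerOf m hm ∧ (m 1 : Measure (Td d)) = μ₁ ∧
      ∀ (ψ : PTd d → ℝ) (lam : ℝ), (∫ q, S.Hstar (secT q.2) (β q) ∂A) + (∫ s, S.Fc (m s) ∂I01) +
        ψ (m 1) + lam ∈ DPPval S 1 ψ lam 1 ν := by
  obtain ⟨κ, _, rfl⟩ := G.disint
  obtain ⟨m, hm, m0, m1, mk, main⟩ := G.curve
  have e : I01 ⊗ₘ κ = I01 ⊗ₘ kerOf m hm :=
    Measure.compProd_congr (mk.mono fun s hs => hs.symm)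
  have G' := G
  rw [e] at G'
  obtain ⟨c1, c2⟩ := cost_eq S m hm G'
  refine ⟨m, hm, e, m1, fun ψ lam => ⟨m, fun s y => β (s, y), ⟨m0, ?_, ?_, ?_, ?_, c1⟩, by rw [c2, e, mul_one]⟩⟩
  · intro t _ ε hε
    have := (tendsto_W1 (hm.tendsto t)).eventually (gt_mem_nhds hε)
    obtain ⟨η, h1, h2⟩ := Metric.eventually_nhds_iff.1 this
    exact ⟨η, h1, fun s _ hs => h2 hs⟩
  · intro s₁ s₂ h0 h12 h1 φ hφ
    have ii : IntervalIntegrable (fun s => ∫ y, Lop φ β (s, y) ∂κ s) volume 0 1 :=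
      (intervalIntegrable_iff_integrableOn_Ioc_of_le zero_le_one).2 (cp_int (G.int hφ))
    have sub : ∀ r ∈ Icc (0:ℝ) 1, IntervalIntegrable (fun s => ∫ y, Lop φ β (s, y) ∂κ s) volume 0 r := fun r hr =>
      ii.mono_set (by rw [uIcc_of_le hr.1, uIcc_of_le zero_le_one]; exact Icc_subset_Icc_right hr.2)
    have r1 : s₁ ∈ Icc (0:ℝ) 1 := ⟨h0, h12.trans h1⟩
    have r2 : s₂ ∈ Icc (0:ℝ) 1 := ⟨h0.trans h12, h1⟩
    rw [main φ hφ s₁ r1, main φ hφ s₂ r2, add_sub_add_left_eq_sub,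
      intervalIntegral.integral_interval_sub_left (sub _ r2) (sub _ r1)]
    refine intervalIntegral.integral_congr_ae ?_
    have mk' := (ae_restrict_iff' measurableSet_Ioc).1 mk
    filter_upwards [mk'] with s hs hs2
    rw [uIoc_of_le h12] at hs2
    rw [hs ⟨h0.trans_lt hs2.1, hs2.2.trans h1⟩]
    simp only [Lop, one_mul]
  · exact G.meas
  · rw [lint_cp m hm (f := fun q => ENNReal.ofReal (sqnorm (β q)))
      ((continuous_sqnorm.measurable.comp G.meas).ennreal_ofReal)]
    exact G'.l2.lintegral_lt_top

lemma adm_down {ψ : PTd d → ℝ} {lam r : ℝ} {ν : PTd d} (h : r ∈ DPPval S 1 ψ lam 1 ν) :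
    ∃ (m : ℝ → PTd d) (hm : Continuous m) (β : ℝ × Td d → Vd d), GFP (I01 ⊗ₘ kerOf m hm) β ν (m 1) ∧
      r = (∫ q, S.Hstar (secT q.2) (β q) ∂(I01 ⊗ₘ kerOf m hm)) + (∫ s, S.Fc (m s) ∂I01) + ψ (m 1) + lam := by
  obtain ⟨m, α, ⟨m0, mc, fp, ma, l2, ci⟩, rfl⟩ := h
  let n : ℝ → PTd d := fun s => m (clip s)
  have nm : ∀ s ∈ Ioc (0:ℝ) 1, n s = m s := fun s hs => by simp only [n, clip_eq (Ioc_subset_Icc_self hs)]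
  have n1 : n 1 = m 1 := nm 1 (by simp)
  have hn : Continuous n := by
    refine continuous_iff_continuousAt.2 fun t => weak_of_W1 ?_
    rw [Metric.tendsto_nhds]
    intro ε hε
    obtain ⟨η, h1, h2⟩ := mc (clip t) (clip_mem t) ε hε
    filter_upwards [(continuous_clip.tendsto t).eventually (Metric.ball_mem_nhds _ h1)] with s hs
    rw [Real.dist_0_eq_abs, abs_of_nonneg (W1_nonneg _ _)]
    exact h2 _ (clip_mem s) hs
  have aen : ∀ᵐ s ∂I01, n s = m s := (ae_restrict_iff' measurableSet_Ioc).2 (Eventually.of_forall nm)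
  have l2' : Integrable (fun q : ℝ × Td d => sqnorm (α q.1 q.2)) (I01 ⊗ₘ kerOf n hn) := by
    refine ⟨(continuous_sqnorm.measurable.comp ma).aestronglyMeasurable, ?_⟩
    rw [hasFiniteIntegral_iff_ofReal (Eventually.of_forall fun q => sqnorm_nonneg _),
      ← lint_cp n hn (f := fun q => ENNReal.ofReal (sqnorm (α q.1 q.2)))
      ((continuous_sqnorm.measurable.comp ma).ennreal_ofReal)]
    refine lt_of_eq_of_lt (lintegral_congr_ae (aen.mono fun s hs => ?_)) l2
    simp only [hs]
  have supp : ∀ᵐ q ∂(I01 ⊗ₘ kerOf n hn), q.1 ∈ Ioc (0:ℝ) 1 := by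
    refine (Measure.ae_compProd_iff (measurable_fst measurableSet_Ioc)).2 ?_
    filter_upwards [ae_restrict_mem measurableSet_Ioc] with s hs
    exact Eventually.of_forall fun _ => hs
  have G : GFP (I01 ⊗ₘ kerOf n hn) (fun q => α q.1 q.2) ν (n 1) := by
    refine ⟨inferInstance, inferInstance, inferInstance, supp, ma, l2', fun φ hφ => ?_⟩
    have iL : Integrable (Lop φ fun q => α q.1 q.2) (I01 ⊗ₘ kerOf n hn) := by
      obtain ⟨C, C0, hC⟩ := Lop_sq hφ
      have i2 : Integrable (fun q : ℝ × Td d => 1 + C * (1 + sqnorm (α q.1 q.2))) (I01 ⊗ₘ kerOf n hn) :=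
        (integrable_const 1).add (((integrable_const 1).add l2').const_mul C)
      refine i2.mono' (Lop_meas hφ ma).aestronglyMeasurable ?_
      filter_upwards [supp] with q hq
      have := hC (fun q => α q.1 q.2) q (Ioc_subset_Icc_self hq)
      rw [Real.norm_eq_abs, abs_le]
      constructor <;> nlinarith [sq_nonneg (Lop φ (fun q => α q.1 q.2) q - 1), sq_nonneg (Lop φ (fun q => α q.1 q.2) q + 1)]
    rw [Measure.integral_compProd iL, n1, ← m0, fp 0 1 le_rfl zero_le_one le_rfl φ hφ,
      intervalIntegral.integral_of_le zero_le_one]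
    refine integral_congr_ae (aen.mono fun s hs => ?_)
    simp only [Lop, one_mul]
    rw [← hs]; rfl
  refine ⟨n, hn, _, G, ?_⟩
  rw [← (cost_eq S n hn G).2, n1, mul_one]
  congr 2
  rw [intervalIntegral.integral_of_le zero_le_one, intervalIntegral.integral_of_le zero_le_one]
  refine integral_congr_ae (aen.mono fun s hs => ?_)
  simp only [runCost, hs]
end updown
end partN

section partO
open scoped Topology
open ProbabilityTheory (Kernel IsFiniteKernel IsMarkovKernel)
open scoped ProbabilityTheory

section energy
variable {d : ℕ}

lemma GFP.split {A : Measure (ℝ × Td d)} {β μ₀ μ₁} {b a : Measure (Td d)} (G : GFP A β μ₀ μ₁)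
    (e : μ₀ = b + a) (hb : IsFiniteMeasure b) (ha : IsFiniteMeasure a) :
    ∃ A₁ A₂ μ' μ'', A = A₁ + A₂ ∧ μ₁ = μ' + μ'' ∧ GFP A₁ β b μ' ∧ GFP A₂ β a μ'' := by
  subst e
  obtain ⟨w, wm, w0, e1, e2⟩ := exists_split b a
  obtain ⟨f, f₁, fm, f1m, f0, f10, G1, G2⟩ := G.decomp wm w0
  rw [← e1] at G1
  rw [← e2] at G2
  exact ⟨_, _, _, _, (wd_compl fm f0).symm, (wd_compl f1m f10).symm, G1, G2⟩

def Good (a : Measure (Td d)) : Prop := ∃ C : ENNReal, C ≠ ⊤ ∧ a ≤ C • volume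

lemma Good.fin {a : Measure (Td d)} (h : Good a) : IsFiniteMeasure a := by
  obtain ⟨C, hC, h⟩ := h
  have := Measure.smul_finite (volume : Measure (Td d)) hC
  exact isFiniteMeasure_of_le _ h

lemma Good.heat {a : Measure (Td d)} (h : Good a) : ∃ B η, GFP B (fun _ => (0 : Vd d)) a η := by
  have ha := h.fin
  obtain ⟨C, hC, h⟩ := h
  have := Measure.smul_finite (volume : Measure (Td d)) hC
  obtain ⟨_, A₂, _, μ, _, _, _, G⟩ := (stat_gfp.smul hC).split (Measure.sub_add_cancel_of_le h).symm inferInstance ha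
  exact ⟨_, _, G⟩

lemma GFP.massA {A : Measure (ℝ × Td d)} {β μ₀ μ₁} (G : GFP A β μ₀ μ₁) : A.real univ = μ₀.real univ := by
  have := G.fst_int (f := fun _ => 1) contDiff_const
  simpa using this

lemma W1_le_two (μ ν : PTd d) : W1 μ ν ≤ 2 := W1_le fun _ h => W1_diff_le h μ ν

lemma W1_swap {μ ν : PTd d} {b a a' : Measure (Td d)} (hb : IsFiniteMeasure b) (ha : IsFiniteMeasure a)
    (ha' : IsFiniteMeasure a') (e1 : (μ : Measure (Td d)) = b + a) (e2 : (ν : Measure (Td d)) = b + a')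
    (e : a'.real univ = a.real univ) : W1 μ ν ≤ a.real univ := by
  refine W1_le fun φ h => ?_
  rw [e1, e2, integral_add_measure (lip_int h _) (lip_int h _), integral_add_measure (lip_int h _) (lip_int h _)]
  have k : ∀ (c : Measure (Td d)), IsFiniteMeasure c → (φ 0 - 1/2) * c.real univ ≤ ∫ y, φ y ∂c ∧
      ∫ y, φ y ∂c ≤ (φ 0 + 1/2) * c.real univ := fun c _ => by
    have hd : ∀ y, |φ y - φ 0| ≤ 1/2 := fun y => by
      have h1 := h.dist_le_mul y 0
      rw [Real.dist_eq, NNReal.coe_one, one_mul] at h1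
      refine h1.trans ((dist_pi_le_iff (by norm_num)).2 fun i => ?_)
      rw [dist_eq_norm]
      simpa using AddCircle.norm_le_half_period (p := (1:ℝ)) (x := y i - (0 : Td d) i) one_ne_zero
    constructor
    · have := integral_mono (integrable_const (μ := c) (φ 0 - 1/2)) (lip_int h c) fun y => by
        linarith [(abs_le.1 (hd y)).1]
      rw [integral_const, smul_eq_mul] at this; linarith
    · have := integral_mono (lip_int h c) (integrable_const (μ := c) (φ 0 + 1/2)) fun y => by
        linarith [(abs_le.1 (hd y)).2]
      rw [integral_const, smul_eq_mul] at this; linarith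
  have k1 := k a ha
  have k2 := k a' ha'
  rw [e] at k2
  linarith [k1.2, k2.1]

variable (S : MFGSetting d)

def val (ψ : PTd d → ℝ) (lam : ℝ) (ν : PTd d) : ℝ := sInf (DPPval S 1 ψ lam 1 ν)

lemma DPP_bdd {ψ : PTd d → ℝ} {c : ℝ} (h : ∀ μ, c ≤ ψ μ) (lam : ℝ) (ν : PTd d) : BddBelow (DPPval S 1 ψ lam 1 ν) := by
  obtain ⟨c', C, c0, C0, hb⟩ := Hs_bounds S
  obtain ⟨M, hM⟩ := S.Fc_bounded
  refine ⟨-C - M + c + lam, fun r hr => ?_⟩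
  obtain ⟨m, hm, β, G, rfl⟩ := adm_down S hr
  have h1 : -C ≤ ∫ q, S.Hstar (secT q.2) (β q) ∂(I01 ⊗ₘ kerOf m hm) := by
    have := G.finA
    have := integral_mono (integrable_const (μ := I01 ⊗ₘ kerOf m hm) (-C)) (G.Hint S) fun q => by
      have := (hb (secT q.2) (β q)).1
      nlinarith [sqnorm_nonneg (β q)]
    rw [integral_const, G.massA] at this
    simpa using this
  have h2 : -M ≤ ∫ s, S.Fc (m s) ∂I01 := by
    have ip : IsProbabilityMeasure I01 := ⟨by simp⟩
    have := integral_mono (integrable_const (μ := I01) (-M)) (fc_int S m hm) fun s => (abs_le.1 (hM (m s))).1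
    simpa using this
  linarith [h (m 1)]

lemma DPP_ne {ν : PTd d} (h : Good (ν : Measure (Td d))) (ψ : PTd d → ℝ) (lam : ℝ) : (DPPval S 1 ψ lam 1 ν).Nonempty := by
  obtain ⟨B, η, G⟩ := h.heat
  obtain ⟨m, _, _, _, k⟩ := G.up S
  exact ⟨_, k ψ lam⟩

lemma Hconv (q : ℝ × Td d) : ConvexOn ℝ univ (fun v => S.Hstar (secT q.2) v) := Hs_convex S _

lemma GFP.addH {A A' : Measure (ℝ × Td d)} {β β' μ₀ μ₁ μ₀' μ₁'} (G : GFP A β μ₀ μ₁)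
    (G' : GFP A' β' μ₀' μ₁') : ∃ γ, GFP (A + A') γ (μ₀ + μ₀') (μ₁ + μ₁') ∧
      ∫ q, S.Hstar (secT q.2) (γ q) ∂(A + A') ≤ (∫ q, S.Hstar (secT q.2) (β q) ∂A) + ∫ q, S.Hstar (secT q.2) (β' q) ∂A' := by
  obtain ⟨γ, g, h⟩ := G.add G'
  exact ⟨γ, g, h _ (Hconv S) (G.Hint S) (G'.Hint S) (g.Hint S)⟩

lemma ker_of_add {m : ℝ → PTd d} {hm : Continuous m} {A₁ A₂ : Measure (ℝ × Td d)}
    (e : I01 ⊗ₘ kerOf m hm = A₁ + A₂) {κ₁ κ₂ : Kernel ℝ (Td d)} [IsFiniteKernel κ₁] [IsFiniteKernel κ₂]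
    (h1 : A₁ = I01 ⊗ₘ κ₁) (h2 : A₂ = I01 ⊗ₘ κ₂) : ∀ᵐ s ∂I01, (m s : Measure (Td d)) = κ₁ s + κ₂ s := by
  rw [h1, h2, ← Measure.compProd_add_right] at e
  exact ker_uniq e

end energy
end partO

section partP
open scoped Topology
open ProbabilityTheory (Kernel IsFiniteKernel IsMarkovKernel)
open scoped ProbabilityTheory

section move
variable {d : ℕ} (S : MFGSetting d)

lemma lip_bdd {ψ : PTd d → ℝ} {L : ℝ} (L0 : 0 ≤ L) (h : ∀ μ ν, |ψ μ - ψ ν| ≤ L * W1 μ ν) (ν : PTd d) :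
    ∀ μ, ψ ν - 2 * L ≤ ψ μ := fun μ => by
  have := (abs_le.1 (h μ ν)).1
  nlinarith [W1_le_two μ ν]

lemma fc_compare {m m' : ℝ → PTd d} (hm : Continuous m) (hm' : Continuous m') {D : ℝ}
    (h : ∀ᵐ s ∂I01, |S.Fc (m' s) - S.Fc (m s)| ≤ D) : ∫ s, S.Fc (m' s) ∂I01 ≤ (∫ s, S.Fc (m s) ∂I01) + D := by
  have ip : IsProbabilityMeasure I01 := ⟨by simp⟩
  have i := fc_int S m hm
  have := integral_mono_ae (fc_int S m' hm') (i.add (integrable_const D)) (h.mono fun s hs => by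
    show _ ≤ S.Fc (m s) + D
    linarith [(abs_le.1 hs).2])
  refine this.trans (le_of_eq ?_)
  rw [integral_add' i (integrable_const D)]
  simp

lemma energy : ∃ c K, 0 < c ∧ 0 ≤ K ∧ ∀ (ψ : PTd d → ℝ) (L lam ε₀ : ℝ), 0 ≤ L →
    (∀ μ ν, |ψ μ - ψ ν| ≤ L * W1 μ ν) → ∀ (ν : PTd d) (b a : Measure (Td d)) (m : ℝ → PTd d) (hm : Continuous m)
    (β : ℝ × Td d → Vd d) (A₁ A₂ : Measure (ℝ × Td d)) (μ' μ'' : Measure (Td d)), Good a →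
    (ν : Measure (Td d)) = b + a → I01 ⊗ₘ kerOf m hm = A₁ + A₂ → (m 1 : Measure (Td d)) = μ' + μ'' →
    GFP A₁ β b μ' → GFP A₂ β a μ'' →
    (∫ q, S.Hstar (secT q.2) (β q) ∂(I01 ⊗ₘ kerOf m hm)) + (∫ s, S.Fc (m s) ∂I01) + ψ (m 1) + lam ≤ val S ψ lam ν + ε₀ →
    c * ∫ q, sqnorm (β q) ∂A₂ ≤ ε₀ + (K + L) * a.real univ := by
  obtain ⟨c, C, c0, C0, hb⟩ := Hs_bounds S
  obtain ⟨M, M0, hM⟩ := Fc_swap S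
  refine ⟨c, 2 * C + M, c0, by positivity, fun ψ L lam ε₀ L0 hψ ν b a m hm β A₁ A₂ μ' μ'' ga eν eA eμ G1 G2 hopt => ?_⟩
  obtain ⟨B, η, GB⟩ := ga.heat
  have := G1.finA; have := G2.finA; have := GB.finA
  have := G1.fin1; have := G2.fin1; have := GB.fin1
  obtain ⟨γ, Gγ, hγ⟩ := G1.addH S GB
  rw [← eν] at Gγ
  obtain ⟨m', hm', eA', eμ', hv⟩ := Gγ.up S
  have low := csInf_le (DPP_bdd S (lip_bdd L0 hψ ν) lam ν) (hv ψ lam)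
  obtain ⟨κ₁, _, k1, q1⟩ := G1.ker
  obtain ⟨κ₂, _, k2, q2⟩ := G2.ker
  obtain ⟨κ₃, _, k3, q3⟩ := GB.ker
  have fc : ∀ᵐ s ∂I01, |S.Fc (m' s) - S.Fc (m s)| ≤ M * a.real univ := by
    filter_upwards [ker_of_add eA k1 k2, ker_of_add eA'.symm k1 k3] with s h1 h2
    have := hM (m s) (m' s) (κ₁ s) (κ₂ s) (κ₃ s) inferInstance inferInstance inferInstance h1 h2 (by rw [q2, q3])
    rwa [q2] at this
  have fc2 := fc_compare S hm hm' fc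
  have w : W1 (m' 1) (m 1) ≤ a.real univ := by
    have := W1_swap (μ := m' 1) (ν := m 1) ‹IsFiniteMeasure μ'› ‹IsFiniteMeasure η› ‹IsFiniteMeasure μ''› eμ' eμ (by rw [GB.mass, G2.mass])
    rwa [GB.mass] at this
  have w2 := (abs_le.1 (hψ (m' 1) (m 1))).2
  have w3 := mul_le_mul_of_nonneg_left w L0
  have hB : ∫ q, S.Hstar (secT q.2) 0 ∂B ≤ C * a.real univ := by
    have := integral_mono (GB.Hint S) (integrable_const (μ := B) C) fun q => by
      have := (hb (secT q.2) 0).2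
      simpa [sqnorm] using this
    rw [integral_const, GB.massA, smul_eq_mul] at this; linarith
  have h2 : c * (∫ q, sqnorm (β q) ∂A₂) - C * a.real univ ≤ ∫ q, S.Hstar (secT q.2) (β q) ∂A₂ := by
    have := integral_mono ((G2.l2.const_mul c).sub (integrable_const (μ := A₂) C)) (G2.Hint S) fun q => (hb (secT q.2) (β q)).1
    rw [integral_sub' (G2.l2.const_mul c) (integrable_const (μ := A₂) C), integral_const_mul, integral_const,
      G2.massA, smul_eq_mul] at this; linarith
  rw [eA, integral_add_measure (G1.Hint S) (G2.Hint S)] at hopt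
  unfold val at hopt
  linarith

lemma shift_cost {A : Measure (ℝ × Td d)} (β : ℝ × Td d → Vd d) (hβ : Measurable β) (Z : Vd d) :
    ∫ q, S.Hstar (secT q.2) (β (unshiftM Z q) + Z) ∂(A.map (shiftM Z)) =
      ∫ q, S.Hstar (secT q.2 + (1 - q.1) • Z) (β q + Z) ∂A := by
  rw [integral_map (continuous_shiftM Z).measurable.aemeasurable]
  · refine integral_congr_ae (Eventually.of_forall fun q => ?_)
    simp only [unshift_shift]
    exact per_sec_add (g := fun x => S.Hstar x (β q + Z)) (fun x z => by rw [Hs_per]) _ _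
  · exact ((Hs_meas S).comp ((measurable_secT.comp measurable_snd).prodMk
      ((hβ.comp (continuous_unshiftM Z).measurable).add_const Z))).aestronglyMeasurable

lemma move {τ : ℝ} (hτ : 0 < τ) : ∃ K, 0 ≤ K ∧ ∀ (ψ : PTd d → ℝ) (L lam : ℝ), 0 ≤ L →
    (∀ μ ν, |ψ μ - ψ ν| ≤ L * W1 μ ν) → ∀ (ν ν' : PTd d) (b a : Measure (Td d)) (i : Fin d) (p r₁ r₂ : ℝ),
    0 ≤ p → p ≤ 1 → p * r₁ + (1 - p) * r₂ = 0 → Good (ν : Measure (Td d)) → Good a → (ν : Measure (Td d)) = b + a →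
    (ν' : Measure (Td d)) = b + (ENNReal.ofReal p • a.map (· + piT (r₁ • Pi.single i (1:ℝ))) +
      ENNReal.ofReal (1 - p) • a.map (· + piT (r₂ • Pi.single i (1:ℝ)))) →
    val S ψ lam ν' ≤ val S ψ lam ν + (τ * L + K) * (p * r₁ ^ 2 + (1 - p) * r₂ ^ 2) * a.real univ := by
  obtain ⟨c, K, c0, K0, hE⟩ := energy S
  obtain ⟨C₁, C10, hS⟩ := Hs_second S (τ := τ * c) (by positivity)
  obtain ⟨C₂, C20, hF⟩ := Fc_second S
  refine ⟨τ * K + C₁ + C₂, by positivity, fun ψ L lam L0 hψ ν ν' b a i p r₁ r₂ p0 p1 hr gν ga eν eν' => ?_⟩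
  set V := p * r₁ ^ 2 + (1 - p) * r₂ ^ 2 with hV
  have q0 : 0 ≤ 1 - p := by linarith
  have V0 : 0 ≤ V := by positivity
  refine le_of_forall_pos_le_add fun ε hε => ?_
  obtain ⟨ε₀, ε0, hε₀⟩ : ∃ ε₀ > 0, (1 + τ * V) * ε₀ ≤ ε := ⟨ε / (1 + τ * V), by positivity, by
    rw [mul_div_cancel₀ _ (by positivity)]⟩
  obtain ⟨r, hr', hlt⟩ := exists_lt_of_csInf_lt (DPP_ne S gν ψ lam) (lt_add_of_pos_right (val S ψ lam ν) ε0)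
  obtain ⟨m, hm, β, G, rfl⟩ := adm_down S hr'
  have fb : IsFiniteMeasure b := isFiniteMeasure_of_le (ν : Measure (Td d)) (by rw [eν]; exact Measure.le_add_right le_rfl)
  obtain ⟨A₁, A₂, μ', μ'', eA, eμ, G1, G2⟩ := G.split eν fb ga.fin
  have en := hE ψ L lam ε₀ L0 hψ ν b a m hm β A₁ A₂ μ' μ'' ga eν eA eμ G1 G2 hlt.le
  have := G1.finA; have := G2.finA
  set Z₁ : Vd d := r₁ • Pi.single i (1:ℝ)
  set Z₂ : Vd d := r₂ • Pi.single i (1:ℝ)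
  have S1 := (G2.shift Z₁).smul (c := ENNReal.ofReal p) ENNReal.ofReal_ne_top
  have S2 := (G2.shift Z₂).smul (c := ENNReal.ofReal (1 - p)) ENNReal.ofReal_ne_top
  obtain ⟨γ, Gγ, hγ⟩ := S1.addH S S2
  obtain ⟨δ, Gδ, hδ⟩ := G1.addH S Gγ
  rw [← eν'] at Gδ
  obtain ⟨m', hm', eA', eμ', hv⟩ := Gδ.up S
  have low := csInf_le (DPP_bdd S (lip_bdd L0 hψ ν) lam ν') (hv ψ lam)
  have e1 : m' 1 = m 1 := by
    apply Subtype.ext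
    show (m' 1 : Measure (Td d)) = m 1
    rw [eμ', eμ, ← add_smul, ← ENNReal.ofReal_add p0 q0]
    simp
  obtain ⟨κ₁, _, k1, _⟩ := G1.ker
  obtain ⟨κ₂, _, k2, mass⟩ := G2.ker
  obtain ⟨κ₃, _, k3, s3⟩ := shift_ker κ₂ Z₁
  obtain ⟨κ₄, _, k4, s4⟩ := shift_ker κ₂ Z₂
  obtain ⟨κ₅, _, k5, s5⟩ := smul_ker κ₃ (c := ENNReal.ofReal p) ENNReal.ofReal_ne_top
  obtain ⟨κ₆, _, k6, s6⟩ := smul_ker κ₄ (c := ENNReal.ofReal (1 - p)) ENNReal.ofReal_ne_top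
  have eA'' : ENNReal.ofReal p • A₂.map (shiftM Z₁) + ENNReal.ofReal (1 - p) • A₂.map (shiftM Z₂) = I01 ⊗ₘ (κ₅ + κ₆) := by
    rw [Measure.compProd_add_right, ← k5, ← k6, ← k3, ← k4, ← k2]
  have fc : ∀ᵐ s ∂I01, |S.Fc (m' s) - S.Fc (m s)| ≤ C₂ * V * a.real univ := by
    filter_upwards [ker_of_add eA k1 k2, ker_of_add eA'.symm k1 eA'', ae_restrict_mem measurableSet_Ioc] with s h1 h2 h3
    have := hF (m s) (m' s) (κ₁ s) (κ₂ s) inferInstance inferInstance i p r₁ r₂ (1 - s) p0 p1 hr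
      ⟨by linarith [h3.2], by linarith [h3.1]⟩ h1 (by
        rw [h2]
        show κ₁ s + (κ₅ s + κ₆ s) = _
        rw [s5, s6, s3, s4])
    rwa [mass] at this
  have fc2 := fc_compare S hm hm' fc
  rw [integral_smul_measure, integral_smul_measure, shift_cost S β G2.meas, shift_cost S β G2.meas,
    ENNReal.toReal_ofReal p0, ENNReal.toReal_ofReal q0, smul_eq_mul, smul_eq_mul] at hγ
  have si : ∀ Z : Vd d, Integrable (fun q : ℝ × Td d => S.Hstar (secT q.2 + (1 - q.1) • Z) (β q + Z)) A₂ := fun Z => by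
    have := (G2.shift Z).Hint S
    have := this.comp_measurable (continuous_shiftM Z).measurable
    refine this.congr (Eventually.of_forall fun q => ?_)
    simp only [Function.comp, unshift_shift]
    exact per_sec_add (g := fun x => S.Hstar x (β q + Z)) (fun x z => by rw [Hs_per]) _ _
  have hc : p * (∫ q, S.Hstar (secT q.2 + (1 - q.1) • Z₁) (β q + Z₁) ∂A₂) +
      (1 - p) * (∫ q, S.Hstar (secT q.2 + (1 - q.1) • Z₂) (β q + Z₂) ∂A₂) ≤
      (∫ q, S.Hstar (secT q.2) (β q) ∂A₂) + (τ * c * (∫ q, sqnorm (β q) ∂A₂) + C₁ * a.real univ) * V := by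
    have i1 := (si Z₁).const_mul p
    have i2 := (si Z₂).const_mul (1 - p)
    have i3 := (((G2.l2.const_mul (τ * c)).add (integrable_const (μ := A₂) C₁)).mul_const V)
    have := integral_mono_ae (i1.add i2) ((G2.Hint S).add i3) (by
      filter_upwards [G2.supp] with q hq
      have := hS (secT q.2) (β q) i p r₁ r₂ (1 - q.1) p0 p1 hr ⟨by linarith [hq.2], by linarith [hq.1]⟩
      simpa only [Pi.add_apply, Z₁, Z₂, smul_smul] using this)
    rw [integral_add' i1 i2, integral_add' (G2.Hint S) i3, integral_const_mul, integral_const_mul, integral_mul_const,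
      integral_add' (G2.l2.const_mul (τ * c)) (integrable_const (μ := A₂) C₁), integral_const_mul, integral_const,
      G2.massA, smul_eq_mul, mul_comm (a.real univ)] at this
    exact this
  rw [eA, integral_add_measure (G1.Hint S) (G2.Hint S)] at hlt
  rw [e1] at low
  have en2 := mul_le_mul_of_nonneg_left (mul_le_mul_of_nonneg_left en hτ.le) V0
  unfold val at hlt ⊢
  nlinarith
end move
end partP

section partQ
open scoped Topology

section moves
variable {d : ℕ}

lemma tr_meas (x : Td d) : Measurable fun y : Td d => y + x := (continuous_id.add continuous_const).measurable

lemma Good.add {a b : Measure (Td d)} (ha : Good a) (hb : Good b) : Good (a + b) := by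
  obtain ⟨C, hC, h⟩ := ha
  obtain ⟨D, hD, h'⟩ := hb
  exact ⟨C + D, ENNReal.add_ne_top.2 ⟨hC, hD⟩, by rw [add_smul]; exact add_le_add h h'⟩

lemma Good.smul {a : Measure (Td d)} (ha : Good a) {c : ENNReal} (hc : c ≠ ⊤) : Good (c • a) := by
  obtain ⟨C, hC, h⟩ := ha
  refine ⟨c * C, ENNReal.mul_ne_top hc hC, Measure.le_iff.2 fun s _ => ?_⟩
  have := h s
  simp only [Measure.smul_apply, smul_eq_mul, mul_assoc] at this ⊢
  gcongr

lemma Good.tr {a : Measure (Td d)} (ha : Good a) (x : Td d) : Good (a.map (· + x)) := by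
  obtain ⟨C, hC, h⟩ := ha
  refine ⟨C, hC, ?_⟩
  have := Measure.map_mono h (tr_meas x)
  rwa [Measure.map_smul, map_add_right_eq_self (volume : Measure (Td d)) x] at this

lemma Good.sum {ι : Type*} (s : Finset ι) {f : ι → Measure (Td d)} (h : ∀ i ∈ s, Good (f i)) : Good (∑ i ∈ s, f i) :=
  Finset.sum_induction f Good (fun _ _ => Good.add) ⟨0, by simp, by simp⟩ h

lemma move1 (z : AddCircle (1:ℝ)) : ∃ p r₁ r₂ : ℝ, 0 ≤ p ∧ p ≤ 1 ∧ p * r₁ + (1 - p) * r₂ = 0 ∧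
    (r₁ : AddCircle (1:ℝ)) = z ∧ (r₂ : AddCircle (1:ℝ)) = z ∧ p * r₁ ^ 2 + (1 - p) * r₂ ^ 2 ≤ ‖z‖ := by
  obtain ⟨r, rfl, h⟩ := lift1 z
  have hl : |r| ≤ 1 := by
    rw [h]; exact (AddCircle.norm_le_half_period (p := (1:ℝ)) one_ne_zero).trans (by norm_num)
  have h2 := abs_le.1 hl
  rw [← h]
  rcases le_or_gt 0 r with h0 | h0
  · rw [abs_of_nonneg h0]
    refine ⟨1 - r, r, r - 1, by linarith, by linarith, by ring, rfl, ?_, by nlinarith⟩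
    rw [AddCircle.coe_sub, AddCircle.coe_period, sub_zero]
  · rw [abs_of_neg h0]
    refine ⟨1 + r, r, r + 1, by linarith, by linarith, by ring, rfl, ?_, by nlinarith⟩
    rw [AddCircle.coe_add, AddCircle.coe_period, add_zero]

lemma piT_single (r : ℝ) (i : Fin d) : piT (r • Pi.single i (1:ℝ)) = Pi.single i (r : AddCircle (1:ℝ)) := by
  funext j
  rcases eq_or_ne j i with rfl | h
  · simp [piT]
  · simp [piT, h]

lemma add_fin_of {ν : PTd d} {b a : Measure (Td d)} (e : (ν : Measure (Td d)) = b + a) (x : Td d) :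
    IsProbabilityMeasure (b + a.map (· + x)) := ⟨by
  have : (ν : Measure (Td d)) univ = 1 := measure_univ
  rw [e] at this
  rw [Measure.add_apply, Measure.map_apply (tr_meas x) MeasurableSet.univ, preimage_univ, ← Measure.add_apply, this]⟩

variable (S : MFGSetting d)

lemma moveT : ∃ K, 0 ≤ K ∧ ∀ (ψ : PTd d → ℝ) (L lam : ℝ), 0 ≤ L →
    (∀ μ ν, |ψ μ - ψ ν| ≤ L * W1 μ ν) → ∀ (ν ν' : PTd d) (b a : Measure (Td d)) (x : Td d),
    Good b → Good a → (ν : Measure (Td d)) = b + a → (ν' : Measure (Td d)) = b + a.map (· + x) →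
    val S ψ lam ν' ≤ val S ψ lam ν + (L / 2 + K) * ‖x‖ * a.real univ := by
  obtain ⟨K, K0, hK⟩ := move S (τ := 1 / (2 * (d + 1))) (by positivity)
  refine ⟨d * K, by positivity, fun ψ L lam L0 hψ ν ν' b a x gb ga eν eν' => ?_⟩
  set τ : ℝ := 1 / (2 * (d + 1)) with hτ
  have τ0 : 0 ≤ τ := by positivity
  have key : ∀ s : Finset (Fin d), ∀ ν' : PTd d, (ν' : Measure (Td d)) = b + a.map (· + fun i => if i ∈ s then x i else 0) →
      val S ψ lam ν' ≤ val S ψ lam ν + (τ * L + K) * (∑ i ∈ s, ‖x i‖) * a.real univ := by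
    intro s
    induction s using Finset.induction_on with
    | empty =>
      intro ν' h
      have : ν' = ν := by
        apply Subtype.ext
        show (ν' : Measure (Td d)) = ν
        rw [h, eν]
        simp only [Finset.notMem_empty, if_false]
        have : (fun y : Td d => y + fun _ => (0 : AddCircle (1:ℝ))) = id := by funext y; exact add_zero y
        rw [this, Measure.map_id]
      rw [this]; simp
    | insert i s hi ih =>
      intro ν' h
      obtain ⟨p, r₁, r₂, p0, p1, hr, e1, e2, hV⟩ := move1 (x i)
      set xs : Td d := fun i => if i ∈ s then x i else 0 with hxs
      let ρ : PTd d := ⟨b + a.map (· + xs), add_fin_of eν xs⟩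
      have h1 := ih ρ rfl
      have ga' := ga.tr xs
      have hmap : (a.map (· + xs)).map (· + Pi.single i (x i)) =
          a.map (· + fun j => if j ∈ insert i s then x j else 0) := by
        rw [Measure.map_map (tr_meas _) (tr_meas _)]
        congr 1
        funext y j
        show (y + xs + Pi.single i (x i) : Td d) j = y j + if j ∈ insert i s then x j else 0
        rw [Pi.add_apply, Pi.add_apply, add_assoc]
        congr 1
        rcases eq_or_ne j i with rfl | hj
        · simp [hxs, hi]
        · simp [hxs, hj]
      have h2 := hK ψ L lam L0 hψ ρ ν' b (a.map (· + xs)) i p r₁ r₂ p0 p1 hr (gb.add ga') ga' rfl (by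
        rw [piT_single, piT_single, e1, e2, ← add_smul, ← ENNReal.ofReal_add p0 (by linarith), hmap, h]; simp)
      have m1 : (a.map (· + xs)).real univ = a.real univ := by
        rw [map_measureReal_apply (tr_meas _) MeasurableSet.univ, preimage_univ]
      rw [m1] at h2
      rw [Finset.sum_insert hi]
      have h3 := mul_le_mul_of_nonneg_right (mul_le_mul_of_nonneg_left hV (show 0 ≤ τ * L + K by positivity))
        (measureReal_nonneg (μ := a) (s := univ))
      linarith
  have h := key Finset.univ ν' (by simpa using eν')
  refine h.trans (add_le_add_right (mul_le_mul_of_nonneg_right ?_ measureReal_nonneg) _)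
  have hs : ∑ i, ‖x i‖ ≤ d * ‖x‖ := by
    refine (Finset.sum_le_sum fun i _ => norm_le_pi_norm x i).trans ?_
    simp
  refine (mul_le_mul_of_nonneg_left hs (by positivity)).trans ?_
  rw [← mul_assoc]
  refine mul_le_mul_of_nonneg_right ?_ (norm_nonneg _)
  have : (d:ℝ) * τ ≤ 1 / 2 := by
    rw [hτ, mul_one_div, div_le_div_iff₀ (by positivity) (by norm_num)]; linarith
  nlinarith

def smear {ι : Type*} [Fintype ι] (u : Measure (Td d)) (w : ι → ℝ) (y : ι → Td d) : Measure (Td d) :=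
  ∑ j, ENNReal.ofReal (w j) • u.map (· + y j)

lemma smear_prob {ι : Type*} [Fintype ι] {u : Measure (Td d)} (hu : IsProbabilityMeasure u) {w : ι → ℝ} (w0 : ∀ j, 0 ≤ w j)
    (w1 : ∑ j, w j = 1) (y : ι → Td d) : IsProbabilityMeasure (smear u w y) := ⟨by
  simp only [smear, Measure.finsetSum_apply, Measure.smul_apply, smul_eq_mul]
  simp only [Measure.map_apply (tr_meas _) MeasurableSet.univ, preimage_univ, measure_univ, mul_one]
  rw [← ENNReal.ofReal_sum_of_nonneg fun j _ => w0 j, w1, ENNReal.ofReal_one]⟩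

lemma smear_good {ι : Type*} [Fintype ι] {u : Measure (Td d)} (hu : Good u) (w : ι → ℝ) (y : ι → Td d) :
    Good (smear u w y) := Good.sum _ fun _ _ => (hu.tr _).smul ENNReal.ofReal_ne_top

lemma moveS : ∃ K, 0 ≤ K ∧ ∀ (ψ : PTd d → ℝ) (L lam : ℝ), 0 ≤ L →
    (∀ μ ν, |ψ μ - ψ ν| ≤ L * W1 μ ν) → ∀ (ι : Type) [Fintype ι] (u : Measure (Td d)) (w : ι → ℝ) (y y' : ι → Td d)
    (ν ν' : PTd d), IsProbabilityMeasure u → Good u → (∀ j, 0 ≤ w j) → ∑ j, w j = 1 → (ν : Measure (Td d)) = smear u w y →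
    (ν' : Measure (Td d)) = smear u w y' →
    val S ψ lam ν' ≤ val S ψ lam ν + (L / 2 + K) * ∑ j, w j * dist (y j) (y' j) := by
  classical
  obtain ⟨K, K0, hK⟩ := moveT S
  refine ⟨K, K0, fun ψ L lam L0 hψ ι _ u w y y' ν ν' hu gu w0 w1 eν eν' => ?_⟩
  have key : ∀ s : Finset ι, ∀ ν' : PTd d, (ν' : Measure (Td d)) = smear u w (fun j => if j ∈ s then y' j else y j) →
      val S ψ lam ν' ≤ val S ψ lam ν + (L / 2 + K) * ∑ j ∈ s, w j * dist (y j) (y' j) := by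
    intro s
    induction s using Finset.induction_on with
    | empty =>
      intro ν' h
      have : ν' = ν := Subtype.ext (by
        show (ν' : Measure (Td d)) = ν
        rw [h, eν]; simp)
      rw [this]; simp
    | insert i s hi ih =>
      intro ν' h
      let ys : ι → Td d := fun j => if j ∈ s then y' j else y j
      let ρ : PTd d := ⟨smear u w ys, smear_prob hu w0 w1 _⟩
      have h1 := ih ρ rfl
      have g := fun j => ((gu.tr (ys j)).smul (c := ENNReal.ofReal (w j)) ENNReal.ofReal_ne_top)
      have h2 := hK ψ L lam L0 hψ ρ ν' (∑ j ∈ Finset.univ.erase i, ENNReal.ofReal (w j) • u.map (· + ys j))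
        (ENNReal.ofReal (w i) • u.map (· + ys i)) (y' i - y i) (Good.sum _ fun j _ => g j) (g i)
        (Finset.sum_erase_add _ _ (Finset.mem_univ i)).symm (by
          rw [h, smear, ← Finset.sum_erase_add _ _ (Finset.mem_univ i)]
          congr 1
          · refine Finset.sum_congr rfl fun j hj => ?_
            have : j ≠ i := (Finset.mem_erase.1 hj).1
            simp [ys, this]
          · rw [Measure.map_smul, Measure.map_map (tr_meas _) (tr_meas _)]
            congr 2
            funext z
            simp [ys, hi, add_assoc])
      have m1 : (ENNReal.ofReal (w i) • u.map (· + ys i)).real univ = w i := by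
        rw [measureReal_ennreal_smul_apply, map_measureReal_apply (tr_meas _) MeasurableSet.univ, preimage_univ]
        simp [ENNReal.toReal_ofReal (w0 i)]
      rw [m1, ← dist_eq_norm, dist_comm] at h2
      rw [Finset.sum_insert hi]
      linarith
  exact key Finset.univ ν' (by simpa using eν')
end moves
end partQ

section partR
open scoped Topology

section coup
variable {d : ℕ}

lemma coupling {ι : Type} [Fintype ι] (x : ι → Td d) {c c' : ι → ℝ} (c0 : ∀ k, 0 ≤ c k) (c1 : ∑ k, c k = 1)
    (c0' : ∀ k, 0 ≤ c' k) (c1' : ∑ k, c' k = 1) {D : ℝ}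
    (hD : ∀ h : Td d → ℝ, LipschitzWith 1 h → ∑ k, h (x k) * (c k - c' k) ≤ D) :
    ∃ P : ι × ι → ℝ, (∀ p, 0 ≤ P p) ∧ (∀ k, ∑ l, P (k, l) = c k) ∧ (∀ l, ∑ k, P (k, l) = c' l) ∧
      ∑ p, P p * dist (x p.1) (x p.2) ≤ D := by
  classical
  by_contra hno
  have : Nonempty ι := by
    by_contra he
    rw [not_nonempty_iff] at he
    simp at c1
  let T : (ι × ι → ℝ) →ₗ[ℝ] (ι → ℝ) × (ι → ℝ) × ℝ :=
    { toFun := fun P => (fun k => ∑ l, P (k, l), fun l => ∑ k, P (k, l), ∑ p, P p * dist (x p.1) (x p.2))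
      map_add' := fun P Q => by
        ext <;> simp [Finset.sum_add_distrib, add_mul]
      map_smul' := fun a P => by
        ext <;> simp [Finset.mul_sum, mul_assoc] }
  have hT : Continuous T := T.continuous_of_finiteDimensional
  let s : Set ((ι → ℝ) × (ι → ℝ) × ℝ) := T '' stdSimplex ℝ (ι × ι)
  let t : Set ((ι → ℝ) × (ι → ℝ) × ℝ) := {c} ×ˢ ({c'} ×ˢ Set.Iic D)
  have hs : IsCompact s := (isCompact_stdSimplex ℝ (ι × ι)).image hT
  have hs' : Convex ℝ s := (convex_stdSimplex ℝ (ι × ι)).linear_image T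
  have ht : IsClosed t := isClosed_singleton.prod (isClosed_singleton.prod isClosed_Iic)
  have ht' : Convex ℝ t := (convex_singleton c).prod ((convex_singleton c').prod (convex_Iic D))
  have hdis : Disjoint s t := by
    rw [Set.disjoint_left]
    rintro _ ⟨P, hP, rfl⟩ ⟨h1, h2, h3⟩
    exact hno ⟨P, hP.1, fun k => congrFun h1 k, fun k => congrFun h2 k, h3⟩
  obtain ⟨f, u, v, hu, huv, hv⟩ := geometric_hahn_banach_compact_closed hs' hs ht' ht hdis
  set f1 : ι → ℝ := fun k => f (Pi.single k 1, 0, 0)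
  set f2 : ι → ℝ := fun k => f (0, Pi.single k 1, 0)
  set Λ : ℝ := - f (0, 0, 1) with hΛ
  have hf : ∀ a b τ, f (a, b, τ) = ∑ k, a k * f1 k + ∑ k, b k * f2 k - Λ * τ := by
    intro a b τ
    have e : ((a, b, τ) : (ι → ℝ) × (ι → ℝ) × ℝ) = ∑ k, a k • ((Pi.single k 1, 0, 0) : (ι → ℝ) × (ι → ℝ) × ℝ)
        + ∑ k, b k • ((0, Pi.single k 1, 0) : (ι → ℝ) × (ι → ℝ) × ℝ) + τ • ((0, 0, 1) : (ι → ℝ) × (ι → ℝ) × ℝ) := by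
      ext j <;> simp [Prod.fst_sum, Prod.snd_sum, Finset.sum_apply, Pi.single_apply]
    rw [e, map_add, map_add, map_sum, map_sum, map_smul]
    simp only [map_smul, smul_eq_mul, f1, f2, hΛ]
    ring
  have H1 : ∀ k l, f1 k + f2 l - Λ * dist (x k) (x l) < u := by
    intro k l
    have := hu (T (Pi.single (k, l) 1)) ⟨_, single_mem_stdSimplex ℝ (k, l), rfl⟩
    have e : T (Pi.single (k, l) 1) = (Pi.single k 1, Pi.single l 1, dist (x k) (x l)) := by
      ext j
      · simp only [T, LinearMap.coe_mk, AddHom.coe_mk, Pi.single_apply, Prod.ext_iff]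
        by_cases h : j = k <;> simp [h]
      · simp only [T, LinearMap.coe_mk, AddHom.coe_mk, Pi.single_apply, Prod.ext_iff]
        by_cases h : j = l <;> simp [h]
      · simp [T, Pi.single_apply]
    rw [e, hf] at this
    simpa [Pi.single_apply] using this
  have H2 : ∀ τ ≤ D, v < ∑ k, c k * f1 k + ∑ k, c' k * f2 k - Λ * τ := fun τ hτ => by
    rw [← hf]; exact hv _ ⟨rfl, rfl, hτ⟩
  have Λ0 : 0 ≤ Λ := by
    by_contra! hneg
    set A := ∑ k, c k * f1 k + ∑ k, c' k * f2 k
    have := H2 (min D ((A - v) / Λ)) (min_le_left _ _)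
    have h3 : Λ * ((A - v) / Λ) = A - v := mul_div_cancel₀ _ hneg.ne
    have h4 := mul_le_mul_of_nonpos_left (min_le_right D ((A - v) / Λ)) hneg.le
    linarith
  let g : Td d → ℝ := fun y => ⨅ l, (u - f2 l + Λ * dist y (x l))
  have gb : ∀ y, BddBelow (range fun l => (u - f2 l + Λ * dist y (x l))) := fun y => (finite_range _).bddBelow
  have g1 : ∀ k, f1 k ≤ g (x k) := fun k => le_ciInf fun l => by linarith [H1 k l]
  have g2 : ∀ l, f2 l ≤ u - g (x l) := fun l => by
    have := ciInf_le (gb (x l)) l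
    simp only [dist_self, mul_zero, add_zero] at this
    change g (x l) ≤ _ at this
    linarith
  have gL : ∀ y y', g y ≤ g y' + Λ * dist y y' := fun y y' => by
    rw [← sub_le_iff_le_add]
    refine le_ciInf fun l => ?_
    have := ciInf_le (gb y) l
    change g y ≤ _ at this
    nlinarith [mul_le_mul_of_nonneg_left (dist_triangle y y' (x l)) Λ0]
  have H3 : ∑ k, g (x k) * (c k - c' k) ≤ Λ * D := by
    rcases Λ0.eq_or_lt with h0 | h0
    · obtain ⟨k0⟩ := this
      have : ∀ k, g (x k) = g (x k0) := fun k => by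
        have a := gL (x k) (x k0)
        have b := gL (x k0) (x k)
        rw [← h0] at a b
        linarith
      simp only [this, ← Finset.mul_sum, Finset.sum_sub_distrib, c1, c1', ← h0]
      simp
    · have := hD (fun y => g y / Λ) (LipschitzWith.of_le_add fun y y' => by
        rw [div_le_iff₀ h0, add_mul, div_mul_cancel₀ _ h0.ne', mul_comm (dist y y')]; exact gL y y')
      have e : ∑ k, g (x k) / Λ * (c k - c' k) = (∑ k, g (x k) * (c k - c' k)) / Λ := by
        rw [Finset.sum_div]; exact Finset.sum_congr rfl fun _ _ => by ring
      rw [e, div_le_iff₀ h0] at this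
      linarith
  have H4 := H2 D le_rfl
  have H5 : ∑ k, c k * f1 k ≤ ∑ k, c k * g (x k) := Finset.sum_le_sum fun k _ => mul_le_mul_of_nonneg_left (g1 k) (c0 k)
  have H6 : ∑ k, c' k * f2 k ≤ ∑ k, c' k * (u - g (x k)) := Finset.sum_le_sum fun k _ => mul_le_mul_of_nonneg_left (g2 k) (c0' k)
  have H7 : ∑ k, c k * g (x k) + ∑ k, c' k * (u - g (x k)) = u + ∑ k, g (x k) * (c k - c' k) := by
    have : u = ∑ k, c' k * u := by rw [← Finset.sum_mul, c1', one_mul]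
    nth_rewrite 2 [this]
    rw [← Finset.sum_add_distrib, ← Finset.sum_add_distrib]
    exact Finset.sum_congr rfl fun _ _ => by ring
  linarith

lemma smear_fst {ι : Type} [Fintype ι] (u : Measure (Td d)) (x : ι → Td d) {c : ι → ℝ} {P : ι × ι → ℝ} (P0 : ∀ p, 0 ≤ P p)
    (h : ∀ k, ∑ l, P (k, l) = c k) : smear u c x = smear u P (fun p => x p.1) := by
  rw [smear, smear, Fintype.sum_prod_type]
  refine Finset.sum_congr rfl fun k _ => ?_
  show _ = ∑ l, ENNReal.ofReal (P (k, l)) • Measure.map (· + x k) u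
  rw [← Finset.sum_smul, ← ENNReal.ofReal_sum_of_nonneg fun l _ => P0 _, h]

lemma smear_snd {ι : Type} [Fintype ι] (u : Measure (Td d)) (x : ι → Td d) {c : ι → ℝ} {P : ι × ι → ℝ} (P0 : ∀ p, 0 ≤ P p)
    (h : ∀ l, ∑ k, P (k, l) = c l) : smear u c x = smear u P (fun p => x p.2) := by
  rw [smear, smear, Fintype.sum_prod_type_right]
  refine Finset.sum_congr rfl fun k _ => ?_
  show _ = ∑ l, ENNReal.ofReal (P (l, k)) • Measure.map (· + x k) u
  rw [← Finset.sum_smul, ← ENNReal.ofReal_sum_of_nonneg fun l _ => P0 _, h]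

lemma disc {r : ℝ} (r0 : 0 < r) : ∃ (ι : Type) (_ : Fintype ι) (x : ι → Td d) (u : Measure (Td d)) (c : PTd d → ι → ℝ),
    IsProbabilityMeasure u ∧ Good u ∧ (∀ μ k, 0 ≤ c μ k) ∧ (∀ μ, ∑ k, c μ k = 1) ∧
    (∀ μ ν (h : Td d → ℝ), LipschitzWith 1 h → ∑ k, h (x k) * (c μ k - c ν k) ≤ W1 μ ν + 2 * r) ∧
    ∀ μ ρ : PTd d, (ρ : Measure (Td d)) = smear u (c μ) x → W1 μ ρ ≤ 2 * r := by
  classical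
  obtain ⟨t, -, ht⟩ := isCompact_univ.elim_nhds_subcover (fun y : Td d => Metric.ball y r) fun y _ => Metric.ball_mem_nhds y r0
  let g : t → Td d → ℝ := fun k y => max 0 (r - dist y k)
  have gc : ∀ k, Continuous (g k) := fun k => by fun_prop
  have g0 : ∀ k y, 0 ≤ g k y := fun k y => le_max_left _ _
  have gp : ∀ y, 0 < ∑ k, g k y := fun y => by
    have : y ∈ ⋃ z ∈ t, Metric.ball z r := ht (mem_univ y)
    simp only [mem_iUnion, Metric.mem_ball] at this
    obtain ⟨z, hz, h⟩ := this
    refine Finset.sum_pos' (fun k _ => g0 k y) ⟨⟨z, hz⟩, Finset.mem_univ _, lt_max_of_lt_right ?_⟩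
    simpa using h
  let ρ : t → Td d → ℝ := fun k y => g k y / ∑ l, g l y
  have ρc : ∀ k, Continuous (ρ k) := fun k => (gc k).div (continuous_finsetSum _ fun l _ => gc l) fun y => (gp y).ne'
  have ρ0 : ∀ k y, 0 ≤ ρ k y := fun k y => div_nonneg (g0 k y) (gp y).le
  have ρ1 : ∀ y, ∑ k, ρ k y = 1 := fun y => by
    simp only [ρ, ← Finset.sum_div]; exact div_self (gp y).ne'
  have ρs : ∀ k y, ρ k y * dist y k ≤ ρ k y * r := fun k y => by
    rcases le_total r (dist y k) with h | h
    · have : ρ k y = 0 := by simp [ρ, g, h]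
      simp [this]
    · exact mul_le_mul_of_nonneg_left h (ρ0 k y)
  let c : PTd d → t → ℝ := fun μ k => ∫ y, ρ k y ∂(μ : Measure (Td d))
  have ci : ∀ (μ : PTd d) k, Integrable (ρ k) (μ : Measure (Td d)) := fun μ k => cont_int (ρc k) _
  have c1 : ∀ μ, ∑ k, c μ k = 1 := fun μ => by
    simp only [c]
    rw [← integral_finsetSum _ fun k _ => ci μ k]
    simp only [ρ1]
    exact prob_int_const μ 1
  have c0 : ∀ μ k, 0 ≤ c μ k := fun μ k => integral_nonneg fun y => ρ0 k y
  have A : ∀ (μ : PTd d) (h : Td d → ℝ), LipschitzWith 1 h →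
      |∑ k : t, h k * c μ k - ∫ y, h y ∂(μ : Measure (Td d))| ≤ r := by
    intro μ h hh
    have e : ∑ k : t, h k * c μ k = ∫ y, ∑ k : t, h k * ρ k y ∂(μ : Measure (Td d)) := by
      rw [integral_finsetSum _ fun k _ => (ci μ k).const_mul _]
      simp only [integral_const_mul, c]
    rw [e, ← integral_sub (integrable_finsetSum _ fun k _ => (ci μ k).const_mul _) (lip_int hh _)]
    have := norm_integral_le_of_norm_le_const (μ := (μ : Measure (Td d))) (C := r)
      (f := fun y => ∑ k : t, h k * ρ k y - h y) (Eventually.of_forall fun y => by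
        have e : ∑ k : t, h k * ρ k y - h y = ∑ k : t, ρ k y * (h k - h y) := by
          have : h y = ∑ k : t, ρ k y * h y := by rw [← Finset.sum_mul, ρ1, one_mul]
          nth_rewrite 1 [this]
          rw [← Finset.sum_sub_distrib]
          exact Finset.sum_congr rfl fun _ _ => by ring
        rw [e]
        refine (norm_sum_le _ _).trans ?_
        calc _ ≤ ∑ k : t, ρ k y * r := Finset.sum_le_sum fun k _ => by
              rw [norm_mul, Real.norm_of_nonneg (ρ0 k y)]
              refine le_trans (mul_le_mul_of_nonneg_left ?_ (ρ0 k y)) (ρs k y)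
              have := hh.dist_le_mul k y
              rw [dist_comm y, ← dist_eq_norm]; simpa using this
          _ = r := by rw [← Finset.sum_mul, ρ1, one_mul])
    simpa using this
  let B : Set (Td d) := Metric.ball 0 r
  have hB : (volume B) ≠ 0 := (Metric.measure_ball_pos _ _ r0).ne'
  let u : Measure (Td d) := (volume B)⁻¹ • volume.restrict B
  have hu : IsProbabilityMeasure u := ⟨by
    simp only [u, Measure.smul_apply, Measure.restrict_apply_univ, smul_eq_mul]
    exact ENNReal.inv_mul_cancel hB (measure_ne_top _ _)⟩
  have gu : Good u := Good.smul ⟨1, by simp, by rw [one_smul]; exact Measure.restrict_le_self⟩ (by simpa using hB)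
  refine ⟨t, inferInstance, fun k => k, u, c, hu, gu, c0, c1, fun μ ν h hh => ?_, fun μ η e => W1_le fun h hh => ?_⟩
  · have a1 := abs_le.1 (A μ h hh)
    have a2 := abs_le.1 (A ν h hh)
    have a3 := le_W1 hh μ ν
    simp only [mul_sub, Finset.sum_sub_distrib]
    linarith
  · have a1 := abs_le.1 (A μ h hh)
    have hk : ∀ k : Td d, h k - r ≤ ∫ y, h (y + k) ∂u := by
      intro k
      have hc : Continuous fun y => h (y + k) := hh.continuous.comp (continuous_id.add continuous_const)
      have : ∫ _y, (h k - r) ∂u ≤ ∫ y, h (y + k) ∂u := by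
        refine integral_mono_ae (integrable_const _) (cont_int hc _) ?_
        refine Measure.ae_smul_measure ?_ _
        filter_upwards [ae_restrict_mem (measurableSet_ball)] with y hy
        have h1 := hh.dist_le_mul k (y + k)
        have h2 : dist k (y + k) = dist y 0 := by rw [dist_comm, dist_eq_norm, dist_eq_norm]; simp
        rw [h2] at h1
        have h3 : dist y 0 < r := hy
        have h4 := (abs_le.1 (Real.dist_eq _ _ ▸ h1)).2
        simp at h4
        simp at h3
        linarith
      simpa using this
    have e2 : ∫ y, h y ∂(η : Measure (Td d)) = ∑ k : t, c μ k * ∫ y, h (y + k) ∂u := by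
      rw [e, smear, integral_finsetSum_measure]
      · refine Finset.sum_congr rfl fun k _ => ?_
        rw [integral_smul_measure, integral_map (tr_meas _).aemeasurable hh.continuous.aestronglyMeasurable,
          ENNReal.toReal_ofReal (c0 μ k), smul_eq_mul]
      · intro k _
        have := Measure.isFiniteMeasure_map u (fun y => y + (k : Td d))
        exact (lip_int hh _).smul_measure ENNReal.ofReal_ne_top
    have e3 : ∑ k : t, c μ k * (h k - r) ≤ ∫ y, h y ∂(η : Measure (Td d)) := by
      rw [e2]; exact Finset.sum_le_sum fun k _ => mul_le_mul_of_nonneg_left (hk k) (c0 μ k)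
    simp only [mul_sub, Finset.sum_sub_distrib, ← Finset.sum_mul, c1] at e3
    have e4 : ∑ k : t, c μ k * h k = ∑ k : t, h k * c μ k := Finset.sum_congr rfl fun _ _ => mul_comm _ _
    linarith
end coup
end partR

section partS
open scoped Topology

section concl
variable {d : ℕ} (S : MFGSetting d)

lemma val_cmp {ψ χ : PTd d → ℝ} {e c lam : ℝ} (h : ∀ μ, ψ μ ≤ χ μ + e) (hb : ∀ μ, c ≤ ψ μ) {ν : PTd d}
    (g : Good (ν : Measure (Td d))) : val S ψ lam ν ≤ val S χ lam ν + e := by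
  rw [← sub_le_iff_le_add]
  refine le_csInf (DPP_ne S g χ lam) ?_
  rintro r ⟨m, α, hA, rfl⟩
  have := csInf_le (DPP_bdd S hb lam ν) ⟨m, α, hA, rfl⟩
  change val S ψ lam ν ≤ _ at this
  linarith [h (m 1)]

lemma step_Q : ∃ K, 0 ≤ K ∧ ∀ (χ : PTd d → ℝ) (lam L η : ℝ), IsCorrector S 1 lam χ → 0 ≤ L →
    (∀ μ ν, χ μ - χ ν ≤ η + L * W1 μ ν) → ∀ μ ν, χ μ - χ ν ≤ η + (L / 2 + K) * W1 μ ν := by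
  obtain ⟨K, K0, hK⟩ := moveS S
  refine ⟨K, K0, fun χ lam L η hχ L0 Q μ ν => ?_⟩
  have : Nonempty (PTd d) := ⟨μ⟩
  let ψ : PTd d → ℝ := fun a => ⨅ b, (χ b + L * W1 a b)
  have hbd : ∀ a, BddBelow (range fun b => χ b + L * W1 a b) := fun a => ⟨χ a - η, by
    rintro _ ⟨b, rfl⟩
    have := Q a b
    simp only
    linarith⟩
  have ψ1 : ∀ a, ψ a ≤ χ a + 0 := fun a => by
    have := ciInf_le (hbd a) a
    rwa [W1_self, mul_zero] at this
  have ψ2 : ∀ a, χ a ≤ ψ a + η := fun a => by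
    rw [← sub_le_iff_le_add]
    exact le_ciInf fun b => by linarith [Q a b]
  have ψ3 : ∀ a a', ψ a ≤ ψ a' + L * W1 a a' := fun a a' => by
    rw [← sub_le_iff_le_add]
    refine le_ciInf fun b => ?_
    have := ciInf_le (hbd a) b
    change ψ a ≤ _ at this
    nlinarith [mul_le_mul_of_nonneg_left (W1_tri a a' b) L0]
  have ψL : ∀ a a', |ψ a - ψ a'| ≤ L * W1 a a' := fun a a' => by
    rw [abs_le]
    have h1 := ψ3 a a'
    have h2 := ψ3 a' a
    rw [W1_symm a' a] at h2
    constructor <;> linarith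
  have χb : ∀ a, χ μ - η - L * 2 ≤ χ a := fun a => by
    have := Q μ a
    nlinarith [mul_le_mul_of_nonneg_left (W1_le_two μ a) L0]
  refine le_of_forall_pos_le_add fun ε ε0 => ?_
  obtain ⟨δ₁, d1, h1⟩ := hχ.1 μ (ε / 3) (by linarith)
  obtain ⟨δ₂, d2, h2⟩ := hχ.1 ν (ε / 3) (by linarith)
  have LK : 0 ≤ L / 2 + K := by linarith
  set M := L / 2 + K with hM
  obtain ⟨r, r0, hr1, hr2, hr3⟩ : ∃ r > 0, 2 * r < δ₁ ∧ 2 * r < δ₂ ∧ M * (2 * r) ≤ ε / 3 := by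
    refine ⟨min (δ₁ / 4) (min (δ₂ / 4) (ε / (6 * (M + 1)))), by positivity, ?_, ?_, ?_⟩
    · linarith [min_le_left (δ₁ / 4) (min (δ₂ / 4) (ε / (6 * (M + 1))))]
    · linarith [(min_le_right (δ₁ / 4) (min (δ₂ / 4) (ε / (6 * (M + 1))))).trans (min_le_left _ _)]
    · have h := (min_le_right (δ₁ / 4) (min (δ₂ / 4) (ε / (6 * (M + 1))))).trans (min_le_right _ _)
      have h' : M * (2 * (ε / (6 * (M + 1)))) ≤ ε / 3 := by
        rw [show M * (2 * (ε / (6 * (M + 1)))) = ε / 3 * (M / (M + 1)) by field_simp; ring]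
        exact mul_le_of_le_one_right (by linarith) ((div_le_one (by linarith)).2 (by linarith))
      exact (mul_le_mul_of_nonneg_left (mul_le_mul_of_nonneg_left h (by norm_num)) LK).trans h'
  obtain ⟨ι, _, x, u, c, hu, gu, c0, c1, hc, hs⟩ := disc (d := d) r0
  let a : PTd d := ⟨smear u (c μ) x, smear_prob hu (c0 μ) (c1 μ) _⟩
  let b : PTd d := ⟨smear u (c ν) x, smear_prob hu (c0 ν) (c1 ν) _⟩
  obtain ⟨P, P0, P1, P2, P3⟩ := coupling x (c0 μ) (c1 μ) (c0 ν) (c1 ν) (hc μ ν)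
  have Ps : ∑ p, P p = 1 := by
    rw [Fintype.sum_prod_type]; simp only [P1]; exact c1 μ
  have k1 := hK ψ L lam L0 ψL (ι × ι) u P (fun p => x p.2) (fun p => x p.1) b a hu gu P0 Ps
    (smear_snd u x P0 P2) (smear_fst u x P0 P1)
  have k2 := val_cmp S (lam := lam) ψ2 χb (ν := a) (smear_good gu _ _)
  have k3 := val_cmp S (lam := lam) ψ1 (lip_bdd L0 ψL μ) (ν := b) (smear_good gu _ _)
  have k4 : χ a = val S χ lam a := hχ.2 a 1 one_pos
  have k5 : χ b = val S χ lam b := hχ.2 b 1 one_pos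
  have k6 : ∑ p : ι × ι, P p * dist (x p.2) (x p.1) ≤ W1 μ ν + 2 * r := by
    simpa only [dist_comm] using P3
  have k7 := mul_le_mul_of_nonneg_left k6 LK
  have k8 := abs_lt.1 (h1 a ((hs μ a rfl).trans_lt hr1))
  have k9 := abs_lt.1 (h2 b ((hs ν b rfl).trans_lt hr2))
  rw [mul_add] at k7
  rw [← hM] at k1
  linarith [k8.1, k9.2]

lemma start_Q {χ : PTd d → ℝ} (h : W1Continuous χ) {η : ℝ} (η0 : 0 < η) :
    ∃ L, 0 ≤ L ∧ ∀ μ ν, χ μ - χ ν ≤ η + L * W1 μ ν := by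
  have hc := cont_of_W1Continuous h
  let B : Set (PTd d × PTd d) := {p | η ≤ χ p.1 - χ p.2}
  have dc : Continuous fun p : PTd d × PTd d => χ p.1 - χ p.2 := (hc.comp continuous_fst).sub (hc.comp continuous_snd)
  have hB : IsCompact B := (isClosed_le continuous_const dc).isCompact
  rcases B.eq_empty_or_nonempty with he | hne
  · refine ⟨0, le_rfl, fun μ ν => ?_⟩
    by_contra! hlt
    have : (μ, ν) ∈ B := by show η ≤ χ μ - χ ν; linarith
    rw [he] at this
    exact this
  · obtain ⟨p, hp, pm⟩ := hB.exists_isMinOn hne continuous_W1.continuousOn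
    obtain ⟨q, hq, qm⟩ := hB.exists_isMaxOn hne dc.continuousOn
    have δ0 : 0 < W1 p.1 p.2 := by
      refine lt_of_le_of_ne (W1_nonneg _ _) fun h0 => ?_
      obtain ⟨e, e0, he⟩ := h p.1 η η0
      have := (abs_lt.1 (he p.2 (by rw [← h0]; exact e0))).1
      have hp' : η ≤ χ p.1 - χ p.2 := hp
      linarith
    have hq' : η ≤ χ q.1 - χ q.2 := hq
    set M := χ q.1 - χ q.2
    refine ⟨M / W1 p.1 p.2, div_nonneg (by linarith) δ0.le, fun μ ν => ?_⟩
    by_cases hb : (μ, ν) ∈ B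
    · have a1 : χ μ - χ ν ≤ M := qm hb
      have a2 : W1 p.1 p.2 ≤ W1 μ ν := pm hb
      have a3 : M / W1 p.1 p.2 * W1 p.1 p.2 = M := div_mul_cancel₀ _ δ0.ne'
      have a4 := mul_le_mul_of_nonneg_left a2 (div_nonneg (by linarith : 0 ≤ M) δ0.le)
      linarith
    · have : χ μ - χ ν < η := not_le.1 hb
      have := mul_nonneg (div_nonneg (by linarith : 0 ≤ M) δ0.le) (W1_nonneg μ ν)
      linarith

lemma final_lip : ∃ K : ℝ, 0 < K ∧ ∀ (χ : PTd d → ℝ) (lam : ℝ), IsCorrector S 1 lam χ →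
    ∀ μ ν : PTd d, |χ μ - χ ν| ≤ K * W1 μ ν := by
  obtain ⟨K, K0, hK⟩ := step_Q S
  refine ⟨2 * K + 1, by linarith, fun χ lam hχ => ?_⟩
  have key : ∀ μ ν, χ μ - χ ν ≤ 2 * K * W1 μ ν := by
    intro μ ν
    refine le_of_forall_pos_le_add fun η η0 => ?_
    obtain ⟨L, L0, hL⟩ := start_Q hχ.1 η0
    have it : ∀ n : ℕ, ∀ μ ν, χ μ - χ ν ≤ η + (L * (1 / 2) ^ n + 2 * K) * W1 μ ν := by
      intro n
      induction n with
      | zero =>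
        intro μ ν
        have := hL μ ν
        have := mul_nonneg K0 (W1_nonneg μ ν)
        simp only [pow_zero, mul_one, add_mul]
        linarith
      | succ n ih =>
        intro μ ν
        have := hK χ lam _ η hχ (by positivity) ih μ ν
        rw [show L * (1 / 2) ^ (n + 1) + 2 * K = (L * (1 / 2) ^ n + 2 * K) / 2 + K by ring]
        exact this
    have lim : Tendsto (fun n : ℕ => η + (L * (1 / 2) ^ n + 2 * K) * W1 μ ν) atTop (𝓝 (η + (L * 0 + 2 * K) * W1 μ ν)) :=
      ((((tendsto_pow_atTop_nhds_zero_of_lt_one (by norm_num : (0:ℝ) ≤ 1 / 2) (by norm_num)).const_mul L).add_const _).mul_const _).const_add _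
    have := ge_of_tendsto' lim fun n => it n μ ν
    linarith
  intro μ ν
  have h1 := key μ ν
  have h2 := key ν μ
  rw [W1_symm ν μ] at h2
  have := W1_nonneg μ ν
  rw [abs_le]
  constructor <;> linarith
end concl
end partS

/-- Proposition 2.7 of the paper.  The set of corrector functions is
uniformly Lipschitz continuous with respect to the 1-Wasserstein distance. -/
theorem correctors_uniformly_lipschitz (d : ℕ) (S : MFGSetting d) (lam : ℝ)
    (hlam : IsLimitValueV S 1 lam) :
    ∃ K : ℝ, 0 < K ∧ ∀ χ : PTd d → ℝ, IsCorrector S 1 lam χ →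
      ∀ μ ν : PTd d, |χ μ - χ ν| ≤ K * W1 μ ν := by
  obtain ⟨K, K0, h⟩ := final_lip S
  exact ⟨K, K0, fun χ hχ => h χ lam hχ⟩
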